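/- arXiv:math/0611122 — 2 statements merged into one kernel-verified Lean document; each statement's English description precedes it below -/
import Mathlib

section
/- For the invariant algebra of the binary septimic there are exactly two new irreducible invariants in degree 22: δ_22 = dim_ℂ(V_22 / W_22) = 2. -/
open MvPolynomial Finset

/-- The derivation `D1 = t·∂/∂x₁ + 2x₁·∂/∂x₂ + ⋯ + 7x₆·∂/∂x₇` on `ℂ[t, x₁, …, x₇]`,
where the variable of index `0` is `t` and the variable of index `j ≥ 1` is `x_j`. -/
noncomputable def D1 : Derivation ℂ (MvPolynomial (Fin 8) ℂ) (MvPolynomial (Fin 8) ℂ) :=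
  MvPolynomial.mkDerivation ℂ
    ![0, MvPolynomial.X 0, 2 * MvPolynomial.X 1, 3 * MvPolynomial.X 2, 4 * MvPolynomial.X 3,
      5 * MvPolynomial.X 4, 6 * MvPolynomial.X 5, 7 * MvPolynomial.X 6]

/-- The derivation `D2 = 7x₁·∂/∂t + 6x₂·∂/∂x₁ + ⋯ + x₇·∂/∂x₆` on `ℂ[t, x₁, …, x₇]`. -/
noncomputable def D2 : Derivation ℂ (MvPolynomial (Fin 8) ℂ) (MvPolynomial (Fin 8) ℂ) :=
  MvPolynomial.mkDerivation ℂ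
    ![7 * MvPolynomial.X 1, 6 * MvPolynomial.X 2, 5 * MvPolynomial.X 3, 4 * MvPolynomial.X 4,
      3 * MvPolynomial.X 5, 2 * MvPolynomial.X 6, MvPolynomial.X 7, 0]


/-- `V n` is the space of invariants of degree `n` of the binary septimic: homogeneous
polynomials of total degree `n` annihilated by both `D1` and `D2`. -/
noncomputable def V (n : ℕ) : Submodule ℂ (MvPolynomial (Fin 8) ℂ) :=
  MvPolynomial.homogeneousSubmodule (Fin 8) ℂ n ⊓
    LinearMap.ker D1.toLinearMap ⊓ LinearMap.ker D2.toLinearMap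

/-- `W n ⊆ V n` is the `ℂ`-span of the reducible invariants of degree `n`: products
`g·h` of homogeneous invariants `g, h` of positive degrees summing to `n`. -/
noncomputable def W (n : ℕ) : Submodule ℂ (MvPolynomial (Fin 8) ℂ) :=
  Submodule.span ℂ
    {p : MvPolynomial (Fin 8) ℂ | ∃ g h : MvPolynomial (Fin 8) ℂ, ∃ a b : ℕ,
      0 < a ∧ 0 < b ∧ a + b = n ∧ g.IsHomogeneous a ∧ h.IsHomogeneous b ∧
      D1 g = 0 ∧ D2 g = 0 ∧ D1 h = 0 ∧ D2 h = 0 ∧ p = g * h}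

/-- `δ n = dim_ℂ (V n / W n)`, the number of irreducible invariants of degree `n`
(the quotient is formed inside `V n` by pulling `W n` back along the inclusion). -/
noncomputable def delta (n : ℕ) : ℕ :=
  Module.finrank ℂ (↥(V n) ⧸ Submodule.comap (V n).subtype (W n))

/-- Shorthand for the polynomial ring. -/
abbrev RR := MvPolynomial (Fin 8) ℂ

/-- Euler derivation. -/
noncomputable def EN : Derivation ℂ RR RR := mkDerivation ℂ (fun i => X i)
/-- Weight derivation. -/
noncomputable def EW : Derivation ℂ RR RR := mkDerivation ℂ (fun i => C ((i : ℕ) : ℂ) * X i)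

theorem coeff_diag (a : Fin 8 → ℂ) (u : RR) (s : Fin 8 →₀ ℕ) :
    coeff s (mkDerivation ℂ (fun i => C (a i) * X i) u) = (∑ i, a i * s i) * coeff s u := by
  induction u using MvPolynomial.induction_on' with
  | add p q hp hq => rw [map_add, coeff_add, hp, hq, coeff_add, mul_add]
  | monomial t r =>
    rw [mkDerivation_monomial]
    have : (t.sum fun i k => monomial (t - Finsupp.single i 1) (k : ℂ) • (C (a i) * X i : RR))
        = monomial t (∑ i, a i * t i) := by
      rw [Finsupp.sum_fintype _ _ (by intro i; simp)]
      rw [map_sum]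
      refine Finset.sum_congr rfl fun i _ => ?_
      by_cases h : t i = 0
      · simp [h]
      · have h1 : t - Finsupp.single i 1 + Finsupp.single i 1 = t := by
          apply tsub_add_cancel_of_le
          rw [Finsupp.single_le_iff]; omega
        rw [smul_eq_mul, X, C_mul_monomial, monomial_mul, h1]
        congr 1; ring
    rw [this, coeff_smul, coeff_monomial, coeff_monomial]
    split_ifs with h
    · subst h; simp [mul_comm]
    · simp

theorem coeff_EN (u : RR) (s : Fin 8 →₀ ℕ) :
    coeff s (EN u) = ((∑ i, s i : ℕ) : ℂ) * coeff s u := by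
  have := coeff_diag (fun _ => 1) u s
  simp only [C_1, one_mul] at this
  rw [EN, this]; push_cast; rfl

theorem coeff_EW (u : RR) (s : Fin 8 →₀ ℕ) :
    coeff s (EW u) = ((∑ i : Fin 8, (i : ℕ) * s i : ℕ) : ℂ) * coeff s u := by
  rw [EW, coeff_diag]; push_cast; rfl

theorem der_num (D : Derivation ℂ (MvPolynomial (Fin 8) ℂ) (MvPolynomial (Fin 8) ℂ)) :
    D 2 = 0 ∧ D 3 = 0 ∧ D 4 = 0 ∧ D 5 = 0 ∧ D 6 = 0 ∧ D 7 = 0 :=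
  ⟨D.map_natCast 2, D.map_natCast 3, D.map_natCast 4, D.map_natCast 5, D.map_natCast 6,
    D.map_natCast 7⟩

theorem brWD1 : ⁅EW, D1⁆ = - D1 := by
  apply MvPolynomial.derivation_ext
  intro i
  rw [Derivation.commutator_apply]
  fin_cases i <;> simp [EW, D1, mkDerivation_X, Derivation.leibniz, der_num] <;> ring_nf

theorem brWD2 : ⁅EW, D2⁆ = D2 := by
  apply MvPolynomial.derivation_ext
  intro i
  rw [Derivation.commutator_apply]
  fin_cases i <;> simp [EW, D2, mkDerivation_X, Derivation.leibniz, der_num] <;> ring_nf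

theorem brND1 : ⁅EN, D1⁆ = 0 := by
  apply MvPolynomial.derivation_ext
  intro i
  rw [Derivation.commutator_apply]
  fin_cases i <;> simp [EN, D1, mkDerivation_X, Derivation.leibniz, der_num]

theorem brND2 : ⁅EN, D2⁆ = 0 := by
  apply MvPolynomial.derivation_ext
  intro i
  rw [Derivation.commutator_apply]
  fin_cases i <;> simp [EN, D2, mkDerivation_X, Derivation.leibniz, der_num]

theorem brD1D2 : ⁅D1, D2⁆ = (7 : ℂ) • EN - (2 : ℂ) • EW := by
  apply MvPolynomial.derivation_ext
  intro i
  rw [Derivation.commutator_apply]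
  fin_cases i <;> simp [EN, EW, D1, D2, mkDerivation_X, Derivation.leibniz, smul_eq_C_mul,
    der_num] <;> simp only [map_ofNat] <;> ring_nf

/-- Exponents of degree `n` and weight `w`. -/
def SS (n w : ℕ) : Set (Fin 8 →₀ ℕ) :=
  {s | ∑ i, s i = n ∧ ∑ i : Fin 8, (i : ℕ) * s i = w}

theorem mem_MM (n w : ℕ) (u : RR) :
    u ∈ restrictSupport ℂ (SS n w) ↔ EN u = (n : ℂ) • u ∧ EW u = (w : ℂ) • u := by
  rw [mem_restrictSupport_iff]
  constructor
  · intro h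
    constructor
    · ext s
      rw [coeff_EN, coeff_smul, smul_eq_mul]
      by_cases hs : coeff s u = 0
      · simp [hs]
      · rw [(h (by simpa using hs)).1]
    · ext s
      rw [coeff_EW, coeff_smul, smul_eq_mul]
      by_cases hs : coeff s u = 0
      · simp [hs]
      · rw [(h (by simpa using hs)).2]
  · rintro ⟨h1, h2⟩ s hs
    have hs : coeff s u ≠ 0 := by simpa using hs
    have h1 := congrArg (coeff s) h1
    have h2 := congrArg (coeff s) h2
    rw [coeff_EN, coeff_smul, smul_eq_mul] at h1
    rw [coeff_EW, coeff_smul, smul_eq_mul] at h2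
    exact ⟨by exact_mod_cast mul_right_cancel₀ hs h1, by exact_mod_cast mul_right_cancel₀ hs h2⟩

theorem D1_eig {n w : ℂ} {u : RR} (h1 : EN u = n • u) (h2 : EW u = w • u) :
    EN (D1 u) = n • D1 u ∧ EW (D1 u) = (w - 1) • D1 u := by
  have a := congrArg (fun D => D u) brND1
  have b := congrArg (fun D => D u) brWD1
  simp only [Derivation.commutator_apply, h1, h2, Derivation.map_smul, Derivation.zero_apply,
    Derivation.neg_apply] at a b
  constructor
  · linear_combination (exp := 1) a
  · rw [sub_smul, one_smul]; linear_combination (exp := 1) b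

theorem D2_eig {n w : ℂ} {u : RR} (h1 : EN u = n • u) (h2 : EW u = w • u) :
    EN (D2 u) = n • D2 u ∧ EW (D2 u) = (w + 1) • D2 u := by
  have a := congrArg (fun D => D u) brND2
  have b := congrArg (fun D => D u) brWD2
  simp only [Derivation.commutator_apply, h1, h2, Derivation.map_smul, Derivation.zero_apply] at a b
  constructor
  · linear_combination (exp := 1) a
  · rw [add_smul, one_smul]; linear_combination (exp := 1) b

theorem comm12 {n w : ℂ} {u : RR} (h1 : EN u = n • u) (h2 : EW u = w • u) :
    D1 (D2 u) = D2 (D1 u) + (7 * n - 2 * w) • u := by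
  have a := congrArg (fun D => D u) brD1D2
  simp only [Derivation.commutator_apply, Derivation.sub_apply, Derivation.smul_apply, h1, h2,
    smul_smul, ← sub_smul] at a
  linear_combination (exp := 1) a

theorem inj_aux (n : ℕ) (w : ℕ) : ∀ c : ℕ, ∀ u : RR, 2 * w < 7 * n → EN u = (n : ℂ) • u →
    EW u = (w : ℂ) • u → D1 (D2 u) + (c : ℂ) • u = 0 → u = 0 := by
  induction w with
  | zero =>
    intro c u hw h1 h2 h
    have hz : D1 u = 0 := by
      have := (D1_eig h1 h2).2
      ext s
      have := congrArg (coeff s) this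
      rw [coeff_EW, coeff_smul, smul_eq_mul] at this
      rw [coeff_zero]
      by_contra hne
      have := mul_right_cancel₀ hne this
      rw [Nat.cast_zero, zero_sub, eq_neg_iff_add_eq_zero] at this
      norm_cast at this
    rw [comm12 h1 h2, hz, map_zero, zero_add, ← add_smul, smul_eq_zero] at h
    rcases h with h | h
    · exfalso
      rw [Nat.cast_zero, mul_zero, sub_zero] at h
      norm_cast at h
      omega
    · exact h
  | succ w ih =>
    intro c u hw h1 h2 h
    have hz : D1 u = 0 := by
      obtain ⟨k1, k2⟩ := D1_eig h1 h2
      refine ih (c + (7 * n - 2 * (w + 1))) (D1 u) (by omega) k1 (by rw [k2]; push_cast; ring_nf) ?_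
      have := congrArg D1 h
      rw [map_add, comm12 h1 h2, map_add, map_zero] at this
      simp only [Derivation.map_smul] at this
      rw [← this, add_assoc, ← add_smul]
      congr 2
      rw [Nat.cast_add, Nat.cast_sub (by omega)]
      push_cast; ring
    rw [comm12 h1 h2, hz, map_zero, zero_add, ← add_smul, smul_eq_zero] at h
    rcases h with h | h
    · exfalso
      have h' : (((7 * n - 2 * (w + 1)) + c : ℕ) : ℂ) = 0 := by
        rw [← h, Nat.cast_add, Nat.cast_sub (by omega)]
        push_cast; ring
      norm_cast at h'
      omega
    · exact h

theorem mem_V {n : ℕ} {u : RR} : u ∈ V n ↔ u.IsHomogeneous n ∧ D1 u = 0 ∧ D2 u = 0 := by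
  simp [V, and_assoc]

theorem V_eig {n : ℕ} {u : RR} (hu : u ∈ V n) : EN u = (n : ℂ) • u := by
  obtain ⟨h, -, -⟩ := mem_V.1 hu
  ext s
  rw [coeff_EN, coeff_smul, smul_eq_mul]
  by_cases hs : coeff s u = 0
  · simp [hs]
  · have := h hs
    rw [← this, Finsupp.weight_apply, Finsupp.sum_fintype _ _ (by simp)]
    simp

theorem V_eigW {n : ℕ} {u : RR} (hu : u ∈ V n) : (7 * n : ℂ) • u = (2 : ℂ) • EW u := by
  have a := congrArg (fun D => D u) brD1D2
  obtain ⟨-, h1, h2⟩ := mem_V.1 hu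
  simp only [Derivation.commutator_apply, Derivation.sub_apply, Derivation.smul_apply, h1, h2,
    V_eig hu, map_zero, smul_smul] at a
  linear_combination (exp := 1) -a

theorem V_odd {n : ℕ} (hn : n % 2 = 1) {u : RR} (hu : u ∈ V n) : u = 0 := by
  ext s
  have := congrArg (coeff s) (V_eigW hu)
  rw [coeff_smul, coeff_smul, coeff_EW, smul_eq_mul, smul_eq_mul, ← mul_assoc] at this
  by_contra h
  have := mul_right_cancel₀ (by simpa using h) this
  norm_cast at this
  omega

theorem V_mem {n w : ℕ} (hn : 7 * n = 2 * w) {u : RR} (hu : u ∈ V n) :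
    u ∈ restrictSupport ℂ (SS n w) := by
  rw [mem_MM]
  refine ⟨V_eig hu, ?_⟩
  have := V_eigW hu
  have h : (7 * n : ℂ) = 2 * w := by exact_mod_cast hn
  rw [h, mul_smul] at this
  exact (smul_right_injective RR (two_ne_zero (α := ℂ)) this).symm

theorem V_bound (n w : ℕ) (hn : 7 * n = 2 * (w + 1)) (hf : (SS n (w + 1)).Finite)
    (hf' : (SS n w).Finite) :
    FiniteDimensional ℂ (V n) ∧ Module.finrank ℂ (V n) + (SS n w).ncard ≤ (SS n (w + 1)).ncard := by
  have := hf.fintype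
  have := hf'.fintype
  have fd := Module.Finite.of_basis (basisRestrictSupport ℂ (SS n (w + 1)))
  have fd' := Module.Finite.of_basis (basisRestrictSupport ℂ (SS n w))
  have r1 := Module.finrank_eq_card_basis (basisRestrictSupport ℂ (SS n (w + 1)))
  have r2 := Module.finrank_eq_card_basis (basisRestrictSupport ℂ (SS n w))
  have hle : V n ≤ restrictSupport ℂ (SS n (w + 1)) := fun u hu => V_mem hn hu
  have fV : FiniteDimensional ℂ (V n) := Submodule.finiteDimensional_of_le hle
  refine ⟨fV, ?_⟩
  set A := (restrictSupport ℂ (SS n w)).map D2.toLinearMap with hA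
  have hAle : A ≤ restrictSupport ℂ (SS n (w + 1)) := by
    rintro _ ⟨u, hu, rfl⟩
    have := (mem_MM _ _ _).1 hu
    have := D2_eig this.1 this.2
    rw [mem_MM]; push_cast
    exact this
  have hinj : ∀ u ∈ restrictSupport ℂ (SS n w), D1 (D2 u) = 0 → u = 0 := by
    intro u hu h
    have hu := (mem_MM _ _ _).1 hu
    exact inj_aux n w 0 u (by omega) hu.1 hu.2 (by simp [h])
  have hdis : Disjoint (V n) A := by
    rw [Submodule.disjoint_def]
    rintro _ hx ⟨u, hu, rfl⟩
    have : u = 0 := hinj u hu (mem_V.1 hx).2.1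
    rw [this, map_zero]
  have hAr : Module.finrank ℂ A = Module.finrank ℂ (restrictSupport ℂ (SS n w)) := by
    rw [hA, ← LinearMap.range_domRestrict]
    refine LinearMap.finrank_range_of_inj ?_
    rw [← LinearMap.ker_eq_bot, LinearMap.ker_eq_bot']
    intro u hu
    have hu' : D2 (u : RR) = 0 := hu
    exact Subtype.ext (hinj u u.2 (by rw [hu', map_zero]))
  have h3 := Submodule.finrank_sup_add_finrank_inf_eq (V n) A
  rw [hdis.eq_bot, finrank_bot, add_zero, hAr, r2] at h3
  have h4 := Submodule.finrank_mono (sup_le hle hAle)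
  rw [r1, h3] at h4
  rwa [← Nat.card_eq_fintype_card, ← Nat.card_eq_fintype_card, Nat.card_coe_set_eq,
    Nat.card_coe_set_eq] at h4

/-- Pascal-type recursion step for the counting function. -/
def cstep (g : ℕ → ℕ → ℕ) (a : ℕ) : ℕ → ℕ → ℕ
  | 0, w => g 0 w
  | n + 1, w => g (n + 1) w + if a ≤ w then cstep g a n (w - a) else 0

/-- Number of exponent tuples `(s_0, …, s_{k+1})` of degree `n` and weight `w`. -/
def cnt : ℕ → ℕ → ℕ → ℕ
  | 0 => fun n w => if w ≤ n then 1 else 0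
  | k + 1 => cstep (cnt k) (k + 2)

/-- Recursion step for the exponent tuples. -/
def TFstep (k : ℕ) (G : ℕ → ℕ → Finset (Fin (k + 2) → ℕ)) :
    ℕ → ℕ → Finset (Fin (k + 3) → ℕ)
  | 0, w => (G 0 w).image (fun s => Fin.snoc (α := fun _ => ℕ) s 0)
  | n + 1, w => (G (n + 1) w).image (fun s => Fin.snoc (α := fun _ => ℕ) s 0) ∪
      if k + 2 ≤ w then (TFstep k G n (w - (k + 2))).image
        (fun s => Fin.snoc (α := fun _ => ℕ) (fun i => s i.castSucc) (s (Fin.last _) + 1)) else ∅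

/-- The exponent tuples themselves. -/
def TF : (k : ℕ) → ℕ → ℕ → Finset (Fin (k + 2) → ℕ)
  | 0 => fun n w => if w ≤ n then {![n - w, w]} else ∅
  | k + 1 => TFstep k (TF k)

theorem snoc_inj {k : ℕ} {s t : Fin k → ℕ} {a b : ℕ}
    (h : (Fin.snoc (α := fun _ => ℕ) s a : Fin (k + 1) → ℕ) = Fin.snoc (α := fun _ => ℕ) t b) :
    s = t ∧ a = b := Fin.snoc_injective2 (α := fun _ => ℕ) h

theorem snoc_sums {k : ℕ} (s : Fin (k + 2) → ℕ) (a : ℕ) :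
    ∑ i, (Fin.snoc (α := fun _ => ℕ) s a : Fin (k + 3) → ℕ) i = ∑ i, s i + a ∧
    ∑ i : Fin (k + 3), (i : ℕ) * (Fin.snoc (α := fun _ => ℕ) s a : Fin (k + 3) → ℕ) i =
      ∑ i : Fin (k + 2), (i : ℕ) * s i + (k + 2) * a := by
  rw [Fin.sum_univ_castSucc (n := k + 2), Fin.sum_univ_castSucc (n := k + 2)]
  simp only [Fin.snoc_castSucc, Fin.snoc_last, Fin.val_castSucc, Fin.val_last, and_self]

theorem mem_TF (k : ℕ) : ∀ n w (s : Fin (k + 2) → ℕ),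
    s ∈ TF k n w ↔ ∑ i, s i = n ∧ ∑ i : Fin (k + 2), (i : ℕ) * s i = w := by
  induction k with
  | zero =>
    intro n w s
    have e1 : ∑ i : Fin (0 + 2), s i = s 0 + s 1 := Fin.sum_univ_two s
    have e2 : ∑ i : Fin (0 + 2), (i : ℕ) * s i = s 1 := by
      refine (Fin.sum_univ_two _).trans ?_
      simp
    rw [e1, e2]
    simp only [TF]
    constructor
    · intro h
      split_ifs at h with h1
      · rw [mem_singleton] at h; subst h
        refine ⟨?_, rfl⟩
        change n - w + w = n
        omega
      · simp at h
    · rintro ⟨h1, h2⟩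
      rw [if_pos (by omega), mem_singleton]
      ext i
      fin_cases i
      · change s 0 = n - w
        omega
      · exact h2
  | succ k ih =>
    intro n
    induction n with
    | zero =>
      intro w s
      obtain ⟨t, a, rfl⟩ : ∃ t a, s = Fin.snoc (α := fun _ => ℕ) t a :=
        ⟨_, _, (Fin.snoc_init_self (α := fun _ => ℕ) s).symm⟩
      rw [(snoc_sums t a).1, (snoc_sums t a).2, TF, TFstep, mem_image]
      constructor
      · rintro ⟨t', h, e⟩
        obtain ⟨rfl, rfl⟩ := snoc_inj e
        rw [ih] at h
        rw [h.1, h.2]; simp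
      · rintro ⟨h1, h2⟩
        have ha : a = 0 := by omega
        subst ha
        exact ⟨t, by rw [ih]; constructor <;> omega, rfl⟩
    | succ n ihn =>
      intro w s
      obtain ⟨t, a, rfl⟩ : ∃ t a, s = Fin.snoc (α := fun _ => ℕ) t a :=
        ⟨_, _, (Fin.snoc_init_self (α := fun _ => ℕ) s).symm⟩
      rw [(snoc_sums t a).1, (snoc_sums t a).2, TF, TFstep, mem_union, mem_image]
      constructor
      · rintro (⟨t', h, e⟩ | h)
        · obtain ⟨rfl, rfl⟩ := snoc_inj e
          rw [ih] at h
          rw [h.1, h.2]; simp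
        · split_ifs at h with hw
          · rw [mem_image] at h
            obtain ⟨s', h, e⟩ := h
            obtain ⟨rfl, rfl⟩ := snoc_inj e
            have h := (ihn _ _).1 h
            rw [Fin.sum_univ_castSucc (n := k + 2), Fin.sum_univ_castSucc (n := k + 2)] at h
            simp only [Fin.val_castSucc, Fin.val_last] at h
            rw [mul_add]
            beta_reduce
            constructor <;> omega
          · simp at h
      · rintro ⟨h1, h2⟩
        rcases a with _ | a
        · left
          exact ⟨t, by rw [ih]; constructor <;> omega, rfl⟩
        · right
          rw [mul_add] at h2
          rw [if_pos (by omega), mem_image]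
          refine ⟨Fin.snoc (α := fun _ => ℕ) t a, (ihn _ _).2 ?_, by simp⟩
          rw [(snoc_sums t a).1, (snoc_sums t a).2]
          constructor <;> omega

theorem card_TF (k : ℕ) : ∀ n w, (TF k n w).card = cnt k n w := by
  induction k with
  | zero =>
    intro n w
    simp only [TF, cnt]
    split_ifs <;> simp
  | succ k ih =>
    intro n
    have inj0 : Function.Injective (fun s : Fin (k + 2) → ℕ =>
        (Fin.snoc (α := fun _ => ℕ) s 0 : Fin (k + 3) → ℕ)) := fun s t h => (snoc_inj h).1
    induction n with
    | zero =>
      intro w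
      rw [TF, TFstep, cnt, cstep, card_image_of_injective _ inj0, ih]
    | succ n ihn =>
      intro w
      rw [TF, TFstep, cnt, cstep, card_union_of_disjoint, card_image_of_injective _ inj0, ih]
      · congr 1
        split_ifs with hw
        · rw [card_image_of_injective]
          · exact ihn _
          · intro s t h
            obtain ⟨h1, h2⟩ := snoc_inj h
            ext i
            refine Fin.lastCases ?_ (fun j => ?_) i
            · omega
            · exact congrFun h1 j
        · rfl
      · rw [disjoint_left]
        intro s hs ht
        split_ifs at ht
        · rw [mem_image] at hs ht
          obtain ⟨a, -, rfl⟩ := hs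
          obtain ⟨b, -, hb⟩ := ht
          have := (snoc_inj hb).2
          omega
        · simp at ht

/-- Pointwise sum of lists. -/
def addL : List ℕ → List ℕ → List ℕ
  | [], m => m
  | a :: l, [] => a :: l
  | a :: l, b :: m => (a + b) :: addL l m

theorem addL_getD (l m : List ℕ) (w : ℕ) : (addL l m).getD w 0 = l.getD w 0 + m.getD w 0 := by
  induction l generalizing m w with
  | nil => simp [addL]
  | cons a l ih =>
    cases m with
    | nil => simp [addL]
    | cons b m =>
      cases w with
      | zero => simp [addL]
      | succ w => simpa [addL] using ih m w

/-- Shift a list by prepending zeros. -/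
def shiftL : ℕ → List ℕ → List ℕ
  | 0, l => l
  | a + 1, l => 0 :: shiftL a l

theorem shiftL_getD (a : ℕ) (l : List ℕ) (w : ℕ) :
    (shiftL a l).getD w 0 = if a ≤ w then l.getD (w - a) 0 else 0 := by
  induction a generalizing w with
  | zero => simp [shiftL]
  | succ a ih =>
    cases w with
    | zero => simp [shiftL]
    | succ w =>
      have := ih w
      simp only [List.getD_eq_getElem?_getD] at this
      simp [shiftL, this]

/-- One column of the table of counts from the previous one. -/
def build (a : ℕ) : List ℕ → List (List ℕ) → List (List ℕ)
  | _, [] => []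
  | sh, r :: rs => addL r sh :: build a (shiftL a (addL r sh)) rs

theorem build_spec (g : ℕ → ℕ → ℕ) (a : ℕ) (rs : List (List ℕ)) : ∀ (m : ℕ) (sh : List ℕ),
    (∀ i < rs.length, ∀ w, (rs.getD i []).getD w 0 = g (m + i) w) →
    (∀ w, g m w + sh.getD w 0 = cstep g a m w) →
    (build a sh rs).length = rs.length ∧
    ∀ i < rs.length, ∀ w, ((build a sh rs).getD i []).getD w 0 = cstep g a (m + i) w := by
  induction rs with
  | nil => intro m sh _ _; simp [build]
  | cons r rs ih =>
    intro m sh h1 h2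
    have hx : ∀ w, (addL r sh).getD w 0 = cstep g a m w := by
      intro w
      rw [addL_getD, ← h2]
      have := h1 0 (by simp) w
      simp only [List.getD_cons_zero, add_zero] at this
      rw [this]
    obtain ⟨k1, k2⟩ := ih (m + 1) (shiftL a (addL r sh)) (by
      intro i hi w
      have := h1 (i + 1) (by simpa using hi) w
      rw [List.getD_cons_succ] at this
      rw [this]; congr 1; omega) (by
      intro w
      rw [shiftL_getD, cstep, hx])
    refine ⟨by simp [build, k1], ?_⟩
    intro i hi w
    cases i with
    | zero => exact hx w
    | succ i =>
      rw [build, List.getD_cons_succ, k2 i (by simpa using hi)]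
      congr 1; omega

/-- The table of counts. -/
def tabl : ℕ → List (List ℕ)
  | 0 => (List.range 23).map (fun n => List.replicate (n + 1) 1)
  | k + 1 => build (k + 2) [] (tabl k)

theorem tabl_spec (k : ℕ) : (tabl k).length = 23 ∧
    ∀ n < 23, ∀ w, ((tabl k).getD n []).getD w 0 = cnt k n w := by
  induction k with
  | zero =>
    refine ⟨by simp [tabl], ?_⟩
    intro n hn w
    simp only [tabl, cnt]
    have e : ((List.range 23).map (fun n => List.replicate (n + 1) 1)).getD n [] =
        List.replicate (n + 1) 1 := by
      rw [List.getD_eq_getElem _ _ (by simpa using hn)]; simp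
    rw [e]
    by_cases h : w ≤ n
    · rw [if_pos h, List.getD_eq_getElem _ _ (by simp; omega)]; simp
    · rw [if_neg h, List.getD_eq_default _ _ (by simp; omega)]
  | succ k ih =>
    have := build_spec (cnt k) (k + 2) (tabl k) 0 [] (by
      intro i hi w; rw [zero_add]; exact ih.2 i (by omega) w) (by
      intro w; simp [cstep])
    refine ⟨by rw [tabl, this.1, ih.1], ?_⟩
    intro n hn w
    rw [tabl, this.2 n (by omega) w, zero_add]; rfl

/-- The two entries of the table relevant to degree `n` differ by at most `d`. -/
def tchk (T : List (List ℕ)) (n w d : ℕ) : Bool :=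
  Nat.ble ((T.getD n []).getD (w + 1) 0) ((T.getD n []).getD w 0 + d)

theorem tchk_all : (fun T => tchk T 2 6 0 && tchk T 6 20 0 && tchk T 10 34 0 && tchk T 4 13 1 &&
    tchk T 8 27 4 && tchk T 14 48 4 && tchk T 18 62 13 && tchk T 22 76 26) (tabl 6) = true := by
  decide +kernel

theorem tchk_spec {n w d : ℕ} (hn : n < 23) (h : tchk (tabl 6) n w d = true) :
    cnt 6 n (w + 1) ≤ cnt 6 n w + d := by
  rw [← (tabl_spec 6).2 n hn, ← (tabl_spec 6).2 n hn]
  exact Nat.le_of_ble_eq_true h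

theorem cnt_all : cnt 6 2 7 ≤ cnt 6 2 6 + 0 ∧ cnt 6 6 21 ≤ cnt 6 6 20 + 0 ∧
    cnt 6 10 35 ≤ cnt 6 10 34 + 0 ∧ cnt 6 4 14 ≤ cnt 6 4 13 + 1 ∧ cnt 6 8 28 ≤ cnt 6 8 27 + 4 ∧
    cnt 6 14 49 ≤ cnt 6 14 48 + 4 ∧ cnt 6 18 63 ≤ cnt 6 18 62 + 13 ∧
    cnt 6 22 77 ≤ cnt 6 22 76 + 26 := by
  have h := tchk_all
  simp only [Bool.and_eq_true] at h
  obtain ⟨⟨⟨⟨⟨⟨⟨h1, h2⟩, h3⟩, h4⟩, h5⟩, h6⟩, h7⟩, h8⟩ := h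
  exact ⟨tchk_spec (by norm_num) h1, tchk_spec (by norm_num) h2, tchk_spec (by norm_num) h3,
    tchk_spec (by norm_num) h4, tchk_spec (by norm_num) h5, tchk_spec (by norm_num) h6,
    tchk_spec (by norm_num) h7, tchk_spec (by norm_num) h8⟩

theorem SS_card (n w : ℕ) : (SS n w).Finite ∧ (SS n w).ncard = cnt 6 n w := by
  have : SS n w = (((TF 6 n w).map Finsupp.equivFunOnFinite.symm.toEmbedding :
      Finset (Fin 8 →₀ ℕ)) : Set (Fin 8 →₀ ℕ)) := by
    ext s
    simp only [SS, Set.mem_ofPred_eq, coe_map, Set.mem_image, mem_coe, mem_TF]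
    constructor
    · intro h
      exact ⟨s, h, by ext; simp⟩
    · rintro ⟨t, ht, rfl⟩
      simpa using ht
  rw [this]
  refine ⟨Finset.finite_toSet _, ?_⟩
  rw [Set.ncard_coe_finset, card_map, card_TF]

theorem V_dim (n w d : ℕ) (hn : 7 * n = 2 * (w + 1)) (h : cnt 6 n (w + 1) ≤ cnt 6 n w + d) :
    FiniteDimensional ℂ (V n) ∧ Module.finrank ℂ (V n) ≤ d := by
  have h1 := SS_card n (w + 1)
  have h2 := SS_card n w
  obtain ⟨a, b⟩ := V_bound n w hn h1.1 h2.1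
  refine ⟨a, ?_⟩
  rw [h1.2, h2.2] at b
  omega

theorem dim4 : FiniteDimensional ℂ (V 4) ∧ Module.finrank ℂ (V 4) ≤ 1 :=
  V_dim 4 13 _ (by norm_num) cnt_all.2.2.2.1
theorem dim8 : FiniteDimensional ℂ (V 8) ∧ Module.finrank ℂ (V 8) ≤ 4 :=
  V_dim 8 27 _ (by norm_num) cnt_all.2.2.2.2.1
theorem dim14 : FiniteDimensional ℂ (V 14) ∧ Module.finrank ℂ (V 14) ≤ 4 :=
  V_dim 14 48 _ (by norm_num) cnt_all.2.2.2.2.2.1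
theorem dim18 : FiniteDimensional ℂ (V 18) ∧ Module.finrank ℂ (V 18) ≤ 13 :=
  V_dim 18 62 _ (by norm_num) cnt_all.2.2.2.2.2.2.1
theorem dim22 : FiniteDimensional ℂ (V 22) ∧ Module.finrank ℂ (V 22) ≤ 26 :=
  V_dim 22 76 _ (by norm_num) cnt_all.2.2.2.2.2.2.2

theorem V_zero {n w : ℕ} (hn : 7 * n = 2 * (w + 1)) (h : cnt 6 n (w + 1) ≤ cnt 6 n w + 0)
    {u : RR} (hu : u ∈ V n) : u = 0 := by
  obtain ⟨a, b⟩ := V_dim n w 0 hn h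
  have := Submodule.finrank_eq_zero.1 (Nat.le_zero.1 b)
  rw [this] at hu
  simpa using hu

theorem V2_zero {u : RR} (hu : u ∈ V 2) : u = 0 :=
  V_zero (w := 6) (by norm_num) cnt_all.1 hu
theorem V6_zero {u : RR} (hu : u ∈ V 6) : u = 0 :=
  V_zero (w := 20) (by norm_num) cnt_all.2.1 hu
theorem V10_zero {u : RR} (hu : u ∈ V 10) : u = 0 :=
  V_zero (w := 34) (by norm_num) cnt_all.2.2.1 hu

/-! ### Forms as coefficient lists and transvectants -/

section lists
variable {R : Type*} [Zero R] [Add R] [Sub R] [Mul R] [NatCast R]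

/-- `X`-derivative of a form of order `m`. -/
def lX : ℕ → List R → List R
  | 0, _ => []
  | _ + 1, [] => []
  | m + 1, c :: L => (((m + 1 : ℕ) : R) * c) :: lX m L

/-- Auxiliary function for the `Y`-derivative. -/
def lYa : ℕ → List R → List R
  | _, [] => []
  | i, c :: L => ((i : R) * c) :: lYa (i + 1) L

/-- `Y`-derivative of a form. -/
def lY : List R → List R
  | [] => []
  | _ :: L => lYa 1 L

/-- Sum of lists. -/
def lA : List R → List R → List R
  | [], M => M
  | c :: L, [] => c :: L
  | c :: L, d :: M => (c + d) :: lA L M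

/-- Difference of lists. -/
def lS : List R → List R → List R
  | L, [] => L
  | [], d :: M => (0 - d) :: lS [] M
  | c :: L, d :: M => (c - d) :: lS L M

/-- Scaling a list. -/
def lC (a : R) : List R → List R
  | [] => []
  | c :: L => (a * c) :: lC a L

/-- Product of forms. -/
def lM : List R → List R → List R
  | [], _ => []
  | [a], M => lC a M
  | a :: b :: L, M => lA (lC a M) (0 :: lM (b :: L) M)

/-- Transvectant. -/
def tv : ℕ → ℕ → ℕ → List R → List R → List R
  | 0, _, _, F, G => lM F G
  | k + 1, m, n, F, G =>
    lS (tv k (m - 1) (n - 1) (lX m F) (lY G)) (tv k (m - 1) (n - 1) (lY F) (lX n G))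

/-- One step of a program. -/
def pstep (T : List (ℕ × ℕ × List R)) (q : ℕ × ℕ × ℕ) : List (ℕ × ℕ × List R) :=
  match q with
  | (k, a, b) => match T.getD a (0, 0, []), T.getD b (0, 0, []) with
    | (d, m, F), (e, n, G) =>
      (bif Nat.ble k m && Nat.ble k n then (d + e, m + n - 2 * k, tv k m n F G)
        else (0, 0, [])) :: T

/-- Run a program. -/
def prun (T : List (ℕ × ℕ × List R)) : List (ℕ × ℕ × ℕ) → List (ℕ × ℕ × List R)
  | [] => T
  | q :: Q => prun (pstep T q) Q

end lists

section nat
variable {R S : Type*} [CommRing R] [CommRing S] (φ : R →+* S)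

theorem map_lX (m : ℕ) (L : List R) : (lX m L).map φ = lX m (L.map φ) := by
  induction L generalizing m with
  | nil => cases m <;> rfl
  | cons c L ih => cases m <;> simp [lX, ih]

theorem map_lYa (m : ℕ) (L : List R) : (lYa m L).map φ = lYa m (L.map φ) := by
  induction L generalizing m with
  | nil => rfl
  | cons c L ih => simp [lYa, ih]

theorem map_lY (L : List R) : (lY L).map φ = lY (L.map φ) := by
  cases L with
  | nil => rfl
  | cons c L => simp [lY, map_lYa]

theorem map_lA (L M : List R) : (lA L M).map φ = lA (L.map φ) (M.map φ) := by
  induction L generalizing M with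
  | nil => simp [lA]
  | cons c L ih => cases M <;> simp [lA, ih]

theorem map_lS (L M : List R) : (lS L M).map φ = lS (L.map φ) (M.map φ) := by
  induction M generalizing L with
  | nil => simp [lS]
  | cons c M ih => cases L <;> simp [lS, ih]

theorem map_lC (a : R) (L : List R) : (lC a L).map φ = lC (φ a) (L.map φ) := by
  induction L with
  | nil => simp [lC]
  | cons c M ih => simp [lC, ih]

theorem map_lM (L M : List R) : (lM L M).map φ = lM (L.map φ) (M.map φ) := by
  induction L with
  | nil => simp [lM]
  | cons c L ih =>
    cases L with
    | nil => simp [lM, map_lC]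
    | cons d L => simp only [lM, map_lA, map_lC, List.map_cons, map_zero] at ih ⊢; rw [ih]

theorem map_tv (k m n : ℕ) (F G : List R) : (tv k m n F G).map φ = tv k m n (F.map φ) (G.map φ) := by
  induction k generalizing m n F G with
  | zero => simp [tv, map_lM]
  | succ k ih => simp [tv, map_lS, ih, map_lX, map_lY]

/-- Map an entry. -/
def mapE (φ : R →+* S) (e : ℕ × ℕ × List R) : ℕ × ℕ × List S := (e.1, e.2.1, e.2.2.map φ)

theorem mapE_getD (T : List (ℕ × ℕ × List R)) (a : ℕ) :
    (T.map (mapE φ)).getD a (0, 0, []) = mapE φ (T.getD a (0, 0, [])) := by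
  exact List.getD_map T (0, 0, []) (mapE φ)

theorem map_pstep (T : List (ℕ × ℕ × List R)) (q) :
    (pstep T q).map (mapE φ) = pstep (T.map (mapE φ)) q := by
  obtain ⟨k, a, b⟩ := q
  simp only [pstep, mapE_getD]
  generalize T.getD a (0, 0, []) = x
  generalize T.getD b (0, 0, []) = y
  obtain ⟨d, m, F⟩ := x
  obtain ⟨e, n, G⟩ := y
  simp only [mapE, List.map_cons]
  cases Nat.ble k m && Nat.ble k n <;> simp [map_tv]

theorem map_prun (T : List (ℕ × ℕ × List R)) (Q) :
    (prun T Q).map (mapE φ) = prun (T.map (mapE φ)) Q := by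
  induction Q generalizing T with
  | nil => rfl
  | cons q Q ih => rw [prun, ih, map_pstep]; rfl

end nat

/-! ### Covariance -/

/-- Polynomial ring with an extra variable. -/
abbrev AA := MvPolynomial (Option (Fin 8)) ℂ

/-- The extra variable. -/
noncomputable abbrev YY : AA := X none

/-- The embedding. -/
noncomputable def io : RR →ₐ[ℂ] AA := rename some

/-- Derivative in the extra variable. -/
noncomputable def DY : Derivation ℂ AA AA := mkDerivation ℂ (fun o => o.elim 1 (fun _ => 0))

/-- Extension of a derivation. -/
noncomputable def exD (D : Derivation ℂ RR RR) : Derivation ℂ AA AA :=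
  mkDerivation ℂ (fun o => o.elim 0 (fun i => io (D (X i))))

theorem exD_io (D : Derivation ℂ RR RR) (u : RR) : exD D (io u) = io (D u) := by
  induction u using MvPolynomial.induction_on with
  | C a => simp [io, algHom_C]
  | add p q hp hq => simp [hp, hq]
  | mul_X p i hp =>
    rw [map_mul, Derivation.leibniz, Derivation.leibniz, hp, map_add, smul_eq_mul, smul_eq_mul,
      smul_eq_mul, smul_eq_mul, map_mul, map_mul]
    congr 2
    simp [io, exD, mkDerivation_X]

theorem DY_io (u : RR) : DY (io u) = 0 := by
  induction u using MvPolynomial.induction_on with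
  | C a => simp [io]
  | add p q hp hq => simp [hp, hq]
  | mul_X p i hp =>
    rw [map_mul, Derivation.leibniz, hp]
    simp [io, DY, mkDerivation_X]

theorem DY_YY : DY YY = 1 := by simp [DY, mkDerivation_X]
theorem exD_YY (D : Derivation ℂ RR RR) : exD D YY = 0 := by simp [exD, mkDerivation_X]

theorem exD_DY (D : Derivation ℂ RR RR) (u : AA) : exD D (DY u) = DY (exD D u) := by
  have : ⁅exD D, DY⁆ = 0 := by
    apply MvPolynomial.derivation_ext
    intro i
    rw [Derivation.commutator_apply]
    cases i with
    | none => rw [DY_YY, exD_YY]; simp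
    | some i =>
      have : (X (some i) : AA) = io (X i) := by simp [io]
      rw [this, DY_io, exD_io, DY_io]; simp
  have := congrArg (fun D => D u) this
  simp only [Derivation.commutator_apply, Derivation.zero_apply] at this
  exact sub_eq_zero.1 this

/-- Homogeneous `X`-derivative of a dehomogenised form. -/
noncomputable def dX (m : ℂ) (F : AA) : AA := C m * F - YY * DY F

/-- Transvectant on polynomials. -/
noncomputable def Om : ℕ → ℂ → ℂ → AA → AA → AA
  | 0, _, _, F, G => F * G
  | k + 1, m, n, F, G =>
    Om k (m - 1) (n - 1) (dX m F) (DY G) - Om k (m - 1) (n - 1) (DY F) (dX n G)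

theorem dX_add (m F G) : dX m (F + G) = dX m F + dX m G := by
  simp only [dX, map_add]; ring

theorem Om_add_left (k : ℕ) (m n F F' G) : Om k m n (F + F') G = Om k m n F G + Om k m n F' G := by
  induction k generalizing m n F F' G with
  | zero => simp only [Om]; ring
  | succ k ih => simp only [Om, dX_add, map_add, ih]; ring

theorem Om_add_right (k : ℕ) (m n F G G') : Om k m n F (G + G') = Om k m n F G + Om k m n F G' := by
  induction k generalizing m n F G G' with
  | zero => simp only [Om]; ring
  | succ k ih => simp only [Om, dX_add, map_add, ih]; ring

/-- First covariance operator. -/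
noncomputable def E1 (m : ℂ) (F : AA) : AA := exD D1 F - YY * dX m F
/-- Second covariance operator. -/
noncomputable def E2 (F : AA) : AA := exD D2 F - DY F

theorem der_C (D : Derivation ℂ AA AA) (c : ℂ) : D (C c) = 0 := by
  have := D.map_algebraMap c
  simpa [MvPolynomial.algebraMap_eq] using this

theorem E1_dX (m F) : E1 (m - 1) (dX m F) = dX m (E1 m F) := by
  simp only [E1, dX, map_sub, Derivation.leibniz, exD_YY, DY_YY, exD_DY, der_C, smul_eq_mul, map_one]
  ring

theorem E1_DY (m F) : E1 (m - 1) (DY F) = DY (E1 m F) + dX m F := by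
  simp only [E1, dX, map_sub, Derivation.leibniz, exD_YY, DY_YY, exD_DY, der_C, smul_eq_mul, map_one]
  ring

theorem E2_dX (m F) : E2 (dX m F) = dX m (E2 F) + DY F := by
  simp only [E2, dX, map_sub, Derivation.leibniz, exD_YY, DY_YY, exD_DY, der_C, smul_eq_mul, map_one]
  ring

theorem E2_DY (F) : E2 (DY F) = DY (E2 F) := by
  simp only [E2, map_sub, exD_DY]

theorem E1_sub (m F G) : E1 m (F - G) = E1 m F - E1 m G := by
  simp only [E1, dX, map_sub]; ring

theorem E2_sub (F G) : E2 (F - G) = E2 F - E2 G := by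
  simp only [E2, map_sub]; ring

theorem E1_Om (k : ℕ) (m n F G) :
    E1 (m + n - 2 * k) (Om k m n F G) = Om k m n (E1 m F) G + Om k m n F (E1 n G) := by
  induction k generalizing m n F G with
  | zero =>
    simp only [Om, E1, dX, Derivation.leibniz, smul_eq_mul, Nat.cast_zero, mul_zero, sub_zero,
      map_add]
    ring
  | succ k ih =>
    have e : m + n - 2 * ((k + 1 : ℕ) : ℂ) = (m - 1) + (n - 1) - 2 * k := by push_cast; ring
    simp only [Om]
    rw [e, E1_sub, ih, ih, E1_dX, E1_dX, E1_DY, E1_DY, Om_add_left, Om_add_right]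
    ring

theorem E2_Om (k : ℕ) (m n F G) :
    E2 (Om k m n F G) = Om k m n (E2 F) G + Om k m n F (E2 G) := by
  induction k generalizing m n F G with
  | zero =>
    simp only [Om, E2, Derivation.leibniz, smul_eq_mul]
    ring
  | succ k ih =>
    simp only [Om]
    rw [E2_sub, ih, ih, E2_dX, E2_dX, E2_DY, E2_DY, Om_add_left, Om_add_right]
    ring

theorem dX_zero (m) : dX m 0 = 0 := by simp [dX]

theorem Om_zero_left (k : ℕ) (m n G) : Om k m n 0 G = 0 := by
  induction k generalizing m n G with
  | zero => simp [Om]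
  | succ k ih => simp [Om, dX_zero, ih]

theorem Om_zero_right (k : ℕ) (m n F) : Om k m n F 0 = 0 := by
  induction k generalizing m n F with
  | zero => simp [Om]
  | succ k ih => simp [Om, dX_zero, ih]

/-- Polynomial of a list. -/
noncomputable def hm : List RR → AA
  | [] => 0
  | c :: L => io c + YY * hm L

theorem hm_lX (m : ℕ) (L : List RR) (h : L.length ≤ m + 1) : hm (lX m L) = dX m (hm L) := by
  induction L generalizing m with
  | nil => cases m <;> simp [lX, hm, dX_zero]
  | cons c L ih =>
    cases m with
    | zero =>
      have : L = [] := by simpa using h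
      subst this
      simp [lX, hm, dX, DY_io]
    | succ m =>
      rw [lX, hm, ih m (by simpa using h), hm]
      simp only [dX, map_add, map_mul, Derivation.leibniz, DY_io, DY_YY, smul_eq_mul, map_natCast,
        Nat.cast_add, Nat.cast_one, map_one]
      ring

theorem hm_lYa (i : ℕ) (L : List RR) : hm (lYa i L) = i * hm L + YY * DY (hm L) := by
  induction L generalizing i with
  | nil => simp [lYa, hm]
  | cons c L ih =>
    rw [lYa, hm, ih, hm]
    simp only [map_add, map_mul, Derivation.leibniz, DY_io, DY_YY, smul_eq_mul, map_natCast,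
        Nat.cast_add, Nat.cast_one]
    ring

theorem hm_lY (L : List RR) : hm (lY L) = DY (hm L) := by
  cases L with
  | nil => simp [lY, hm]
  | cons c L =>
    rw [lY, hm_lYa, hm]
    simp only [map_add, Derivation.leibniz, DY_io, DY_YY, smul_eq_mul]
    push_cast; ring

theorem hm_lA (L M : List RR) : hm (lA L M) = hm L + hm M := by
  induction L generalizing M with
  | nil => simp [lA, hm]
  | cons c L ih =>
    cases M with
    | nil => simp [lA, hm]
    | cons d M => simp only [lA, hm, ih, map_add]; ring

theorem hm_lS (L M : List RR) : hm (lS L M) = hm L - hm M := by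
  induction M generalizing L with
  | nil => simp [lS, hm]
  | cons c M ih =>
    cases L with
    | nil => simp only [lS, hm, ih, map_sub, map_zero]; ring
    | cons d M => simp only [lS, hm, ih, map_sub]; ring

theorem hm_lC (a : RR) (L : List RR) : hm (lC a L) = io a * hm L := by
  induction L with
  | nil => simp [lC, hm]
  | cons c L ih => simp only [lC, hm, ih, map_mul]; ring

theorem hm_lM (L M : List RR) : hm (lM L M) = hm L * hm M := by
  induction L with
  | nil => simp [lM, hm]
  | cons c L ih =>
    cases L with
    | nil => simp [lM, hm, hm_lC]
    | cons d L => rw [lM, hm_lA, hm, ih, hm_lC, hm.eq_def (c :: _)]; simp only [map_zero]; ring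

theorem len_lX {R : Type*} [Mul R] [NatCast R] (m : ℕ) (L : List R) : (lX m L).length ≤ m := by
  induction m generalizing L with
  | zero => simp [lX]
  | succ m ih => cases L <;> simp [lX, ih]

theorem len_lYa {R : Type*} [Mul R] [NatCast R] (m : ℕ) (L : List R) :
    (lYa m L).length = L.length := by
  induction L generalizing m with
  | nil => simp [lYa]
  | cons c L ih => simp [lYa, ih]

theorem len_lY {R : Type*} [Mul R] [NatCast R] (L : List R) :
    (lY L).length = L.length - 1 := by
  cases L <;> simp [lY, len_lYa]

theorem len_lA {R : Type*} [Add R] (L M : List R) :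
    (lA L M).length = max L.length M.length := by
  induction L generalizing M with
  | nil => simp [lA]
  | cons c L ih => cases M <;> simp [lA, ih]

theorem len_lS {R : Type*} [Zero R] [Sub R] (L M : List R) :
    (lS L M).length = max L.length M.length := by
  induction M generalizing L with
  | nil => simp [lS]
  | cons c L ih => cases L <;> simp [lS, ih]

theorem len_lC {R : Type*} [Mul R] (a : R) (L : List R) :
    (lC a L).length = L.length := by
  induction L with
  | nil => simp [lC]
  | cons c L ih => simp [lC, ih]

theorem len_lM {R : Type*} [Zero R] [Add R] [Mul R] (L M : List R) :
    (lM L M).length ≤ L.length + M.length - 1 := by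
  induction L with
  | nil => simp [lM]
  | cons c L ih =>
    cases L with
    | nil => simp [lM, len_lC]
    | cons d L =>
      rw [lM, len_lA, len_lC]
      simp only [List.length_cons] at ih ⊢
      omega

theorem tv_spec (k m n : ℕ) (F G : List RR) (hF : F.length ≤ m + 1) (hG : G.length ≤ n + 1)
    (hm' : k ≤ m) (hn : k ≤ n) :
    hm (tv k m n F G) = Om k m n (hm F) (hm G) ∧ (tv k m n F G).length ≤ m + n - 2 * k + 1 := by
  induction k generalizing m n F G with
  | zero =>
    refine ⟨hm_lM F G, (len_lM F G).trans ?_⟩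
    omega
  | succ k ih =>
    obtain ⟨m, rfl⟩ : ∃ m', m = m' + 1 := ⟨m - 1, by omega⟩
    obtain ⟨n, rfl⟩ : ∃ m', n = m' + 1 := ⟨n - 1, by omega⟩
    have a1 := len_lX (m + 1) F
    have a2 := len_lX (n + 1) G
    have a3 := len_lY F
    have a4 := len_lY G
    have i1 := ih m n (lX (m + 1) F) (lY G) (by omega) (by omega) (by omega) (by omega)
    have i2 := ih m n (lY F) (lX (n + 1) G) (by omega) (by omega) (by omega) (by omega)
    rw [tv, len_lS, Nat.add_sub_cancel, Nat.add_sub_cancel, hm_lS, i1.1, i2.1, hm_lX _ _ hF,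
      hm_lX _ _ hG, hm_lY, hm_lY, Om]
    push_cast
    rw [add_sub_cancel_right, add_sub_cancel_right]
    exact ⟨rfl, by omega⟩

/-! ### Homogeneity -/

/-- All coefficients homogeneous of degree `d`. -/
def hg (d : ℕ) (L : List RR) : Prop := ∀ c ∈ L, c.IsHomogeneous d

theorem hom_nat (n : ℕ) {c : RR} {d} (h : c.IsHomogeneous d) : ((n : RR) * c).IsHomogeneous d := by
  have := (isHomogeneous_C (Fin 8) (n : ℂ)).mul h
  simpa using this

theorem hg_nil (d) : hg d [] := by intro c hc; simp at hc
theorem hg_cons {d c L} : hg d (c :: L) ↔ c.IsHomogeneous d ∧ hg d L := by simp [hg]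

theorem hg_lX {d} (m : ℕ) {L} (h : hg d L) : hg d (lX m L) := by
  induction L generalizing m with
  | nil => cases m <;> exact hg_nil d
  | cons c L ih =>
    cases m with
    | zero => exact hg_nil d
    | succ m =>
      rw [hg_cons] at h
      exact hg_cons.2 ⟨hom_nat _ h.1, ih m h.2⟩

theorem hg_lYa {d} (m : ℕ) {L} (h : hg d L) : hg d (lYa m L) := by
  induction L generalizing m with
  | nil => exact hg_nil d
  | cons c L ih =>
    rw [hg_cons] at h
    exact hg_cons.2 ⟨hom_nat _ h.1, ih _ h.2⟩

theorem hg_lY {d} {L} (h : hg d L) : hg d (lY L) := by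
  cases L with
  | nil => exact hg_nil d
  | cons c L => exact hg_lYa 1 (hg_cons.1 h).2

theorem hg_lA {d} {L M} (h : hg d L) (h' : hg d M) : hg d (lA L M) := by
  induction L generalizing M with
  | nil => exact h'
  | cons c L ih =>
    cases M with
    | nil => exact h
    | cons e M =>
      rw [hg_cons] at h h'
      exact hg_cons.2 ⟨h.1.add h'.1, ih h.2 h'.2⟩

theorem hg_lS {d} {L M} (h : hg d L) (h' : hg d M) : hg d (lS L M) := by
  induction M generalizing L with
  | nil => rw [lS]; exact h
  | cons c M ih =>
    rw [hg_cons] at h'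
    cases L with
    | nil => exact hg_cons.2 ⟨(isHomogeneous_zero _ _ _).sub h'.1, ih h h'.2⟩
    | cons e L =>
      rw [hg_cons] at h
      exact hg_cons.2 ⟨h.1.sub h'.1, ih h.2 h'.2⟩

theorem hg_lC {d e a L} (h : a.IsHomogeneous d) (h' : hg e L) : hg (d + e) (lC a L) := by
  induction L with
  | nil => exact hg_nil _
  | cons c L ih =>
    rw [hg_cons] at h'
    exact hg_cons.2 ⟨h.mul h'.1, ih h'.2⟩

theorem hg_lM {d e L M} (h : hg d L) (h' : hg e M) : hg (d + e) (lM L M) := by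
  induction L with
  | nil => exact hg_nil _
  | cons c L ih =>
    rw [hg_cons] at h
    cases L with
    | nil => exact hg_lC h.1 h'
    | cons f L => exact hg_lA (hg_lC h.1 h') (hg_cons.2 ⟨isHomogeneous_zero _ _ _, ih h.2⟩)

theorem hg_tv {d e} (k m n : ℕ) {F G} (h : hg d F) (h' : hg e G) : hg (d + e) (tv k m n F G) := by
  induction k generalizing m n F G with
  | zero => exact hg_lM h h'
  | succ k ih =>
    exact hg_lS (ih _ _ (hg_lX _ h) (hg_lY h')) (ih _ _ (hg_lY h) (hg_lX _ h'))

/-- A covariant. -/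
def Cov (e : ℕ × ℕ × List RR) : Prop :=
  hg e.1 e.2.2 ∧ e.2.2.length ≤ e.2.1 + 1 ∧ E1 e.2.1 (hm e.2.2) = 0 ∧ E2 (hm e.2.2) = 0

theorem Cov_zero : Cov (0, 0, []) := by
  refine ⟨hg_nil _, by simp, ?_, ?_⟩ <;> simp [hm, E1, E2, dX]

theorem Cov_pstep (T : List (ℕ × ℕ × List RR)) (hT : ∀ e ∈ T, Cov e) (q) :
    ∀ e ∈ pstep T q, Cov e := by
  have hD : ∀ a, Cov (T.getD a (0, 0, [])) := by
    intro a
    by_cases h : a < T.length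
    · rw [List.getD_eq_getElem _ _ h]; exact hT _ (List.getElem_mem h)
    · rw [List.getD_eq_default _ _ (by omega)]; exact Cov_zero
  obtain ⟨k, a, b⟩ := q
  have ha := hD a
  have hb := hD b
  simp only [pstep]
  generalize T.getD a (0, 0, []) = x at ha
  generalize T.getD b (0, 0, []) = y at hb
  obtain ⟨d, m, F⟩ := x
  obtain ⟨e, n, G⟩ := y
  intro z hz
  rw [List.mem_cons] at hz
  rcases hz with rfl | hz
  · by_cases hk : k ≤ m ∧ k ≤ n
    · have : (Nat.ble k m && Nat.ble k n) = true := by simp [hk]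
      simp only [this, cond_true]
      obtain ⟨a1, a2, a3, a4⟩ := ha
      obtain ⟨b1, b2, b3, b4⟩ := hb
      simp only at a1 a2 a3 a4 b1 b2 b3 b4
      have := tv_spec k m n F G a2 b2 hk.1 hk.2
      have e1 : ((m + n - 2 * k : ℕ) : ℂ) = m + n - 2 * k := by
        rw [Nat.cast_sub (by omega)]; push_cast; rfl
      refine ⟨hg_tv k m n a1 b1, this.2, ?_, ?_⟩
      · simp only
        rw [this.1, e1, E1_Om, a3, b3, Om_zero_left, Om_zero_right, add_zero]
      · simp only
        rw [this.1, E2_Om, a4, b4, Om_zero_left, Om_zero_right, add_zero]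
    · have : (Nat.ble k m && Nat.ble k n) = false := by
        by_contra h; simp at h; exact hk h
      simp only [this, cond_false]
      exact Cov_zero
  · exact hT z hz

theorem Cov_prun (T : List (ℕ × ℕ × List RR)) (hT : ∀ e ∈ T, Cov e) (Q) :
    ∀ e ∈ prun T Q, Cov e := by
  induction Q generalizing T with
  | nil => exact hT
  | cons q Q ih => exact ih _ (Cov_pstep T hT q)

theorem Cov_inv {d : ℕ} {L : List RR} (h : Cov (d, 0, L)) : L.headD 0 ∈ V d := by
  obtain ⟨a1, a2, a3, a4⟩ := h
  simp only at a1 a2 a3 a4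
  rw [mem_V]
  have inj : Function.Injective io := rename_injective _ (Option.some_injective _)
  rcases L with _ | ⟨c, _ | ⟨e, L⟩⟩
  · exact ⟨isHomogeneous_zero _ _ _, map_zero D1, map_zero D2⟩
  · simp only [hm, E1, E2, dX, mul_zero, add_zero, DY_io, exD_io, Nat.cast_zero, map_zero, zero_mul,
      sub_zero] at a3 a4
    have b3 : D1 c = 0 := inj (by rw [a3, map_zero])
    have b4 : D2 c = 0 := inj (by rw [a4, map_zero])
    exact ⟨(hg_cons.1 a1).1, b3, b4⟩
  · simp at a2

/-- The septimic. -/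
def base {R : Type*} [Mul R] [NatCast R] (x : Fin 8 → R) : List (ℕ × ℕ × List R) :=
  [(1, 7, [x 0, (7 : ℕ) * x 1, (21 : ℕ) * x 2, (35 : ℕ) * x 3, (35 : ℕ) * x 4, (21 : ℕ) * x 5,
    (7 : ℕ) * x 6, x 7])]

theorem Cov_base : ∀ e ∈ base (fun i => (X i : RR)), Cov e := by
  intro e he
  simp only [base, List.mem_singleton] at he
  subst he
  have hh : ∀ i : Fin 8, (X i : RR).IsHomogeneous 1 := fun i => isHomogeneous_X _ _
  refine ⟨?_, by simp, ?_, ?_⟩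
  · simp only [hg_cons]
    exact ⟨hh _, hom_nat _ (hh _), hom_nat _ (hh _), hom_nat _ (hh _), hom_nat _ (hh _),
      hom_nat _ (hh _), hom_nat _ (hh _), hh _, hg_nil _⟩
  · simp only [hm, E1, dX, map_add, map_mul, Derivation.leibniz, exD_io, exD_YY, DY_io, DY_YY,
      smul_eq_mul, map_zero, map_natCast, Derivation.map_natCast]
    simp only [D1, mkDerivation_X]
    simp [map_ofNat]
    ring
  · simp only [hm, E2, map_add, map_mul, Derivation.leibniz, exD_io, exD_YY, DY_io, DY_YY,
      smul_eq_mul, map_zero, map_natCast, Derivation.map_natCast]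
    simp only [D2, mkDerivation_X]
    simp [map_ofNat]
    ring

/-! ### Explicit invariants -/

/-- The program computing the invariants. -/
def prog : List (ℕ × ℕ × ℕ) := [
  (4, 0, 0), (6, 1, 1), (5, 1, 2), (2, 1, 3), (4, 3, 3), (3, 2, 4), (2, 3, 4), (3, 2, 7),
  (2, 4, 6), (2, 6, 6), (4, 5, 9), (4, 7, 7), (3, 7, 9), (5, 5, 12), (2, 5, 12), (1, 3, 13),
  (1, 9, 13), (4, 9, 12), (1, 3, 16), (2, 8, 16), (2, 9, 15), (2, 12, 12), (1, 9, 17),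
  (2, 11, 14), (1, 6, 23), (2, 15, 19), (1, 16, 20), (1, 16, 19), (2, 26, 26), (2, 17, 27),
  (4, 25, 25), (2, 20, 29), (2, 16, 21), (2, 17, 23), (1, 14, 27), (1, 17, 28), (1, 16, 18),
  (2, 16, 21), (2, 17, 21), (2, 17, 23), (2, 18, 23), (1, 22, 23), (1, 18, 29), (1, 19, 29),
  (1, 18, 31), (3, 18, 22), (5, 18, 21)]

/-- The contents, with the degrees (last invariant first). -/
def cont : List (ℕ × ℕ) := [

  (22, 6177271637188547415124920928942236528661333135997044268936980517093376000000000000000000000000),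
  (22, 10858485299745493503149275070406275148037499653119804378990786065203200000000000000000000000000),
  (18, 175297559113990876910399011916044639332927280620314296320000000000000000000000),
  (18, 17313339171752185373866569078127865613128620308179189760000000000000000000),
  (18, 51940017515256556121599707234383596839385860924537569280000000000000000000),
  (18, 207760070061026224486398828937534387357543443698150277120000000000000000000),
  (18, 64925021894070695151999634042979496049232326155671961600000000000000000000),
  (18, 1154222611450145691591104605208524374208574687211945984000000000000000000),
  (18, 311640105091539336729598243406301581036315165547225415680000000000000000000000),
  (18, 16620805604882097958911906315002750988603475495852022169600000000000000000000),
  (18, 299174500887877763260414313670049517794862558925336399052800000000000000000000),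
  (14, 1811183545877044065269290591085937675447828480000000000000000),
  (14, 18866495269552542346555110323811850785914880000000000000000000),
  (14, 125776635130350282310367402158745671906099200000000000000000),
  (14, 201242616208560451696587843453993075049758720000000000000000),
  (8, 1278985152674837791191859200000000), (8, 10231881221398702329534873600000000),
  (8, 53291048028118241299660800000000), (4, 5161930260480000)]

/-- Points and the reduced values of the invariants there (last invariant first). -/
def pts : List (List ℤ × List ℤ) := [
  ([0, 0, -1, 1, 0, -1, 0, -1], [
    32088036042063, -5486207543184, 571730018, 238511716, 257493524, -1340353272, 340657612,
    102296224, -895691418, -6077384, 2118120678, -3379942, -267618, -363222, -549118, -311801,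
    871281, -3973, 519]),
  ([1, 0, 0, 1, 0, -1, 0, 1], [
    166631277025490, -524516371776, 1996604352, -616887646, -210572834, -16055731946, -76399252,
    -34907484, 431539016, 26918404, 6301528934, 7533644, 31624, 55880, 88940, 16349, 943801, 5815,
    599]),
  ([0, 1, -1, 1, 0, 1, -1, 1], [
    592510634086400, -17155728015360, -2351124480, -25532629760, -8323421440, -5579432960,
    -3218449920, -2344845440, 12820684800, 3955335680, -7589698560, -25813760, -1300992, -2190720,
    -2240640, -661376, 71056, -14768, -656]),
  ([-1, 0, 0, -1, 0, 1, 0, 0], [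
    103512304687500, -587460937500, 1357031250, -1466015625, -432421875, -11010937500, 17578125,
    -63281250, 147656250, 240468750, 3923437500, 5343750, -22500, -84375, -168750, 52500, 810000,
    7500, 600]),
  ([0, 1, -1, 0, 0, -1, 1, -1], [
    18674376679224, -246501981273, 713780421, 259333852, 24981308, 189950528, -21758166, -106017,
    -290308524, -9049230, 89914218, 1419478, 36552, -36609, -93556, 95864, 516976, 4226, 104]),
  ([-1, -1, 1, -1, 0, 0, 0, 1], [
    73292907834, -20414272860, 9180000, -26205930, -647190, -16843734, -2130570, 2517210,
    -2394252, -2840616, 13737546, 105426, 11970, 18972, 15678, 32619, -67599, 2508, 39]),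
  ([1, 0, -1, -1, 1, 0, 0, 0], [
    -335938992187500, 11108039062500, -1333437500, -6624687500, -2364062500, 12742031250,
    -957578125, -432968750, 7736062500, 2311734375, -12742031250, 4356250, 348500, 435625, 435625,
    108125, 1895625, 21250, 975]),
  ([0, 1, -1, 0, 1, 0, 0, -1], [
    37667426591520, -1238702263200, 1479575040, -1778610720, -261258720, -7421984640, 161445600,
    84868080, -133783056, -291529584, 4435734960, 109104, -116736, -188904, -165576, 151920,
    670140, 12804, 660]),
  ([1, 0, 0, 1, 0, 1, 1, 0], [
    -496221872993280, -2605250511360, -4900234752, 639933696, 162082944, -21888195840, 148070592,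
    -629856, -7377735312, -199536048, 5521037760, -13846896, -72576, 119448, 198072, -105120,
    836460, 2916, -540]),
  ([1, 0, 0, 1, 1, 0, -1, 1], [
    6310076389256, -170529107457, 155922054, -205323752, -16792888, -2039541788, 17283871,
    22030912, -22612098, -82076268, 1024074822, 523252, -16086, -27141, 29286, -168196, 380836,
    -3014, 424]),
  ([0, 1, 0, 0, -1, 1, 0, 0], [
    -50305452586200, 169774280100, -1441060620, 894692160, 274299840, 2454883200, 63513920,
    21411840, -1474413300, -216617760, -480438000, -4132800, -68880, -75768, -96432, 163320,
    543240, 3024, 240]),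
  ([1, 0, -1, 1, 0, 1, 0, 0], [
    -1123599006368820, 4820364583416, 4488099768, -30351725784, -9131477976, -795236454,
    -3281017563, -1822690026, 24653961522, 10232385831, -28672661394, -33382134, -1356192,
    -1873557, -1750653, 939549, 2241081, 28722, -681]),
  ([-1, 0, 0, 1, 0, 0, 0, -1], [
    354002000, -12001300, 200, 4000400, -4000400, -400, 100, -2000400, 70, -1600090, 100, -200,
    -16, -20, -60, 39999, -89999, 2000, -1]),
  ([1, 0, 0, -1, 0, -1, 0, 0], [
    91893867187500, -584085937500, -1379531250, 1655859375, 495703125, 13289062500, -4921875,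
    63281250, -103781250, -144281250, -4784062500, 5906250, -13500, -50625, -101250, 7500, 675000,
    7500, -600]),
  ([1, 0, -1, 1, 1, 0, 1, -1], [
    -100047139473959424, 8099612467242624, 81736685376, 1059991267712, 298373742208,
    -1092679886976, 52678412544, 22385575808, -1409873477760, -367211159744, 1303835664384,
    -546077728, -38756064, -35678112, -27470208, 3873536, 325584, 103888, 348]),
  ([0, 0, 1, 1, 0, 1, 0, 0], [
    -884108795956470, 11097937592874, 4562315082, 30846468654, 8519753286, -53469771516,
    2699894718, 985385736, -31487536404, -8186780727, 36446420934, 2749824, 1007622, 1400679,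
    1583631, 734799, 2416581, 22647, -681]),
  ([1, 1, 0, 0, -1, 0, -1, 1], [
    -147034305792000, 0, -946178922, 1140266906, 315392974, 0, 36391497, 12130499, -1746791856,
    -194087984, 0, 5044820, 0, 0, 0, -202400, -910800, -2530, 0]),
  ([-1, 0, 0, 0, 1, 1, 1, 0], [
    112430849420, -29546749095, 13801569, -21405912, -4363488, -14583840, -1859754, 61887,
    -3074834, -4081406, 13540510, 138846, 13888, 18767, 17248, 33360, -81380, 2222, 40]),
  ([1, 0, 1, 1, 1, 0, 0, 0], [
    -12985382812500, 864773437500, 45937500, 1017187500, 321562500, -1210781250, 104453125,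
    49218750, -980437500, -268734375, 1210781250, 1793750, 143500, 179375, 179375, -71875, 275625,
    -2750, -225]),
  ([1, 0, 1, -1, 0, 0, 1, 0], [
    48899853981000, 154378328895, 3001567590, -813913920, -262090080, -2483907120, -81588465,
    -11951955, 3472744590, 253662840, 387405180, 5625720, 132678, 152145, 237870, 159444, 656856,
    1620, 216]),
  ([0, 1, -1, -1, 1, 0, 0, -1], [
    1028798938743840, -38175437236800, 10189399872, -28407832656, -3905840784, -147445480800,
    4067131488, 1910330016, 13781068752, 6674761368, 70159101600, 24383232, -1542192, -3109008,
    -3973752, -986295, 2878585, -4919, 1075]),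
  ([0, 1, -1, 1, 0, 0, 1, -1], [
    -12783550781250, 105046875000, -1409062500, 531640625, 143359375, 2588203125, -4218750,
    7343750, -965671875, -30406250, -1657968750, 984375, -93375, -78750, -101250, 15625, -174375,
    1625, -225]),
  ([0, 1, 0, 0, 0, 0, 1, 1], [
    -631250, 0, 0, -1850, -550, -4550, 0, -50, 0, 0, 1050, -28, 0, 0, 0, 625, 625, 125, -25]),
  ([-1, -1, 0, 0, 0, 0, 0, -1], [
    26, 0, 0, 0, 0, 14, 0, 0, 0, 0, -6, 4, 0, 0, 0, -1, 1, 0, -1]),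
  ([1, 0, 0, 0, -1, -1, 0, 1], [
    223716958833, -41525121035, -34508975, -4301210, 3669410, 60157222, 315920, 2210410, 34462937,
    15101087, -50339593, 113837, 15403, 18914, 21151, 54949, -32399, 2300, -1]),
  ([-1, 0, -1, 1, 1, 1, 1, 1], [
    -1497651855192796, 140039556433424, -2803517152, 69445425456, 23699445264, -4270040500,
    9198752992, 4294263864, -72580489152, -21819982272, 69879195780, 48799720, 2233536, 2892384,
    2973696, 192959, 4582801, 31944, -1369])]

/-- Transposed inverse modulo 13 of the evaluation matrix. -/
def NT : List (List ℕ) := [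
  [1, 4, 9, 3, 6, 10, 5, 12, 6, 10, 11, 6, 12, 10, 11, 0, 12, 0, 4, 11, 3, 1, 10, 0, 7, 0],
  [12, 6, 4, 10, 6, 6, 4, 0, 3, 8, 8, 1, 9, 5, 5, 9, 1, 4, 7, 7, 8, 9, 5, 9, 3, 3],
  [10, 2, 3, 12, 2, 5, 5, 6, 1, 2, 11, 12, 10, 7, 0, 9, 11, 3, 3, 5, 2, 10, 0, 8, 8, 0],
  [7, 1, 9, 3, 1, 4, 4, 1, 0, 9, 11, 7, 8, 7, 6, 7, 5, 10, 2, 11, 10, 1, 7, 6, 0, 1],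
  [8, 7, 2, 1, 2, 7, 0, 11, 4, 6, 8, 3, 12, 2, 3, 10, 7, 5, 7, 10, 11, 4, 3, 12, 8, 5],
  [4, 8, 5, 1, 6, 10, 8, 12, 2, 12, 3, 12, 1, 6, 11, 10, 5, 4, 11, 4, 9, 9, 6, 0, 2, 1],
  [10, 8, 8, 1, 9, 3, 4, 10, 11, 7, 12, 10, 2, 5, 0, 12, 1, 6, 12, 2, 0, 3, 3, 6, 4, 5],
  [11, 9, 1, 5, 10, 8, 0, 2, 3, 0, 0, 6, 3, 7, 5, 7, 6, 10, 1, 12, 2, 3, 0, 7, 7, 11],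
  [10, 3, 9, 10, 10, 9, 1, 9, 0, 9, 12, 10, 1, 11, 12, 1, 11, 9, 2, 0, 12, 2, 3, 3, 1, 2],
  [6, 4, 5, 0, 8, 11, 0, 7, 1, 8, 6, 4, 3, 3, 2, 3, 6, 5, 6, 8, 6, 4, 12, 9, 3, 0],
  [4, 12, 3, 7, 0, 1, 8, 3, 10, 11, 6, 12, 0, 0, 4, 8, 10, 0, 10, 3, 3, 1, 6, 7, 12, 11],
  [7, 8, 4, 7, 8, 1, 9, 10, 0, 10, 5, 10, 0, 1, 1, 3, 12, 1, 6, 2, 3, 1, 1, 11, 2, 10],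
  [12, 12, 10, 4, 2, 4, 2, 9, 10, 2, 4, 9, 6, 9, 2, 0, 1, 11, 12, 5, 12, 6, 7, 7, 5, 4],
  [9, 12, 12, 12, 0, 8, 0, 0, 10, 12, 3, 6, 11, 1, 5, 3, 6, 3, 10, 6, 4, 11, 3, 12, 6, 8],
  [3, 8, 9, 0, 4, 5, 10, 0, 3, 6, 2, 8, 1, 1, 9, 0, 8, 6, 5, 4, 3, 5, 8, 6, 10, 1],
  [11, 12, 12, 10, 12, 5, 9, 0, 10, 8, 1, 5, 10, 7, 5, 11, 6, 4, 5, 2, 3, 10, 5, 5, 5, 0],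
  [6, 2, 9, 9, 8, 6, 4, 6, 10, 8, 11, 9, 8, 0, 10, 8, 0, 3, 8, 9, 4, 0, 7, 0, 10, 5],
  [3, 0, 12, 8, 10, 9, 7, 4, 7, 0, 1, 6, 5, 2, 11, 12, 8, 10, 9, 2, 9, 6, 10, 7, 9, 10],
  [8, 5, 2, 0, 0, 10, 9, 5, 12, 1, 9, 12, 1, 2, 10, 3, 0, 0, 1, 11, 0, 5, 4, 7, 10, 5],
  [7, 11, 0, 12, 2, 10, 7, 1, 0, 2, 10, 6, 10, 5, 12, 10, 4, 11, 4, 0, 10, 11, 6, 1, 9, 12],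
  [1, 0, 5, 0, 6, 11, 3, 1, 1, 3, 2, 5, 12, 6, 5, 7, 12, 8, 11, 2, 2, 6, 10, 2, 1, 2],
  [2, 8, 8, 3, 3, 8, 10, 11, 0, 9, 3, 7, 9, 5, 8, 12, 6, 7, 0, 7, 10, 4, 10, 12, 8, 6],
  [4, 0, 9, 8, 12, 4, 7, 0, 8, 2, 12, 1, 12, 1, 11, 10, 1, 9, 4, 12, 6, 3, 7, 0, 7, 6],
  [9, 1, 2, 1, 12, 1, 1, 12, 9, 1, 3, 9, 7, 3, 12, 6, 7, 7, 2, 5, 12, 7, 0, 12, 1, 4],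
  [2, 5, 3, 2, 2, 2, 7, 9, 6, 11, 12, 3, 5, 2, 8, 2, 5, 2, 3, 8, 1, 9, 9, 8, 5, 12],
  [4, 7, 3, 3, 11, 3, 4, 1, 12, 7, 7, 3, 5, 4, 7, 2, 7, 3, 9, 6, 0, 1, 11, 6, 8, 9]]

/-- The 24 products and the two new invariants. -/
def Bl {S : Type*} [Mul S] (v : ℕ → S) : List S := [
  v 18 * v 18 * v 14, v 18 * v 18 * v 13, v 18 * v 18 * v 12, v 18 * v 18 * v 11, v 18 * v 10,
  v 18 * v 9, v 18 * v 8, v 18 * v 7, v 18 * v 6, v 18 * v 5, v 18 * v 4, v 18 * v 3, v 18 * v 2,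
  v 17 * v 14, v 16 * v 14, v 15 * v 14, v 17 * v 13, v 16 * v 13, v 15 * v 13, v 16 * v 12,
  v 15 * v 12, v 17 * v 11, v 16 * v 11, v 15 * v 11, v 1, v 0]

/-- The same as a function. -/
def Bf {S : Type*} [Mul S] (v : ℕ → S) : Fin 26 → S := ![
  v 18 * v 18 * v 14, v 18 * v 18 * v 13, v 18 * v 18 * v 12, v 18 * v 18 * v 11, v 18 * v 10,
  v 18 * v 9, v 18 * v 8, v 18 * v 7, v 18 * v 6, v 18 * v 5, v 18 * v 4, v 18 * v 3, v 18 * v 2,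
  v 17 * v 14, v 16 * v 14, v 15 * v 14, v 17 * v 13, v 16 * v 13, v 15 * v 13, v 16 * v 12,
  v 15 * v 12, v 17 * v 11, v 16 * v 11, v 15 * v 11, v 1, v 0]

theorem Bl_Bf {S : Type*} [CommRing S] (v : ℕ → S) (j : Fin 26) : (Bl v).getD j 0 = Bf v j := by
  fin_cases j <;> rfl

theorem map_Bf {S T : Type*} [CommRing S] [CommRing T] (φ : S →+* T) (v : ℕ → S) (j : Fin 26) :
    φ (Bf v j) = Bf (fun i => φ (v i)) j := by
  fin_cases j <;> simp [Bf]

/-- The linear relation. -/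
def rel {S : Type*} [CommRing S] (v : ℕ → S) : S :=
  37 * (v 18 * v 18 * v 14) - 175 * (v 18 * v 18 * v 12) + 3 * (v 18 * v 18 * v 11)
    - 2 * (v 18 * v 10) - 90 * (v 17 * v 14) + 2 * (v 16 * v 14) + 9 * (v 15 * v 14)
    - 30 * (v 15 * v 13) + 750 * (v 17 * v 12)

/-- The linear relation over the integers. -/
def relZ (v : ℕ → ℤ) : ℤ :=
  37 * (v 18 * v 18 * v 14) - 175 * (v 18 * v 18 * v 12) + 3 * (v 18 * v 18 * v 11)
    - 2 * (v 18 * v 10) - 90 * (v 17 * v 14) + 2 * (v 16 * v 14) + 9 * (v 15 * v 14)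
    - 30 * (v 15 * v 13) + 750 * (v 17 * v 12)

theorem rel_map {S T : Type*} [CommRing S] [CommRing T] (φ : S →+* T) (v : ℕ → S) :
    φ (rel v) = rel (fun i => φ (v i)) := by
  simp only [rel, map_add, map_sub, map_mul, map_ofNat]

/-- A point from a list. -/
def px (p : List ℤ) : Fin 8 → ℤ := fun i => p.getD i 0

/-- Compare the computed values with the tables. -/
def ck : List (ℕ × ℕ × List ℤ) → List (ℕ × ℕ) → List ℤ → Bool
  | _, [], _ => true
  | (d, m, L) :: T, (d', c) :: K, r :: S =>
    (Nat.beq d d' && Nat.beq m 0 && decide (L.headD 0 = (c : ℤ) * r)) && ck T K S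
  | _, _, _ => false

theorem ck_spec (T : List (ℕ × ℕ × List ℤ)) (K : List (ℕ × ℕ)) (S : List ℤ)
    (h : ck T K S = true) (a : ℕ) (ha : a < K.length) :
    (T.getD a (0, 0, [])).1 = (K.getD a (0, 0)).1 ∧ (T.getD a (0, 0, [])).2.1 = 0 ∧
      (T.getD a (0, 0, [])).2.2.headD 0 = ((K.getD a (0, 0)).2 : ℤ) * S.getD a 0 := by
  induction K generalizing T S a with
  | nil => simp at ha
  | cons k K ih =>
    obtain ⟨d', c⟩ := k
    cases T with
    | nil => simp [ck] at h
    | cons t T =>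
      obtain ⟨d, m, L⟩ := t
      cases S with
      | nil => simp [ck] at h
      | cons r S =>
        simp only [ck, Bool.and_eq_true, decide_eq_true_eq] at h
        cases a with
        | zero => exact ⟨Nat.eq_of_beq_eq_true h.1.1.1, Nat.eq_of_beq_eq_true h.1.1.2, h.1.2⟩
        | succ a =>
          simp only [List.getD_cons_succ]
          exact ih T S h.2 a (by simpa using ha)

/-- Check all points. -/
def ckall : List (List ℤ × List ℤ) → Bool
  | [] => true
  | (p, r) :: Q => ck (prun (base (px p)) prog) cont r && (decide (relZ (fun a => r.getD a 0) = 0) &&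
      ckall Q)

set_option maxRecDepth 100000 in
theorem ckall_pts : ckall pts = true := by decide +kernel

theorem ckall_spec (Q : List (List ℤ × List ℤ)) (h : ckall Q = true) (i : ℕ) (hi : i < Q.length) :
    ck (prun (base (px (Q.getD i ([], [])).1)) prog) cont (Q.getD i ([], [])).2 = true ∧
    rel (fun a => (Q.getD i ([], [])).2.getD a 0) = 0 := by
  induction Q generalizing i with
  | nil => simp at hi
  | cons q Q ih =>
    obtain ⟨p, r⟩ := q
    simp only [ckall, Bool.and_eq_true, decide_eq_true_eq] at h
    cases i with
    | zero => exact ⟨h.1, h.2.1⟩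
    | succ i =>
      simp only [List.getD_cons_succ]
      exact ih h.2.2 i (by simpa using hi)

/-- Dot product. -/
def dot : List ℕ → List ℕ → ℕ
  | [], _ => 0
  | _ :: _, [] => 0
  | a :: L, b :: M => a * b + dot L M

theorem dot_spec (n : ℕ) (L M : List ℕ) (h : L.length = n) :
    dot L M = ∑ k : Fin n, L.getD k 0 * M.getD k 0 := by
  induction n generalizing L M with
  | zero =>
    have : L = [] := by simpa using h
    subst this; simp [dot]
  | succ n ih =>
    cases L with
    | nil => simp at h
    | cons a L =>
      rw [Fin.sum_univ_succ]
      cases M with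
      | nil => simp [dot]
      | cons b M =>
        rw [dot, ih L M (by simpa using h)]
        simp

/-- Reduced rows of the evaluation matrix. -/
def rows13 : List (List ℕ) :=
  pts.map (fun q => (Bl (fun a => q.2.getD a 0)).map (fun z => (z % 13).toNat))

theorem inv13 : ((List.range 26).all fun i => (List.range 26).all fun j =>
    Nat.beq (dot (rows13.getD i []) (NT.getD j []) % 13) (bif Nat.beq i j then 1 else 0)) = true := by
  decide +kernel

theorem V_mul {a b n : ℕ} {u v : RR} (hu : u ∈ V a) (hv : v ∈ V b) (h : a + b = n) :
    u * v ∈ V n := by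
  subst h
  rw [mem_V] at *
  refine ⟨hu.1.mul hv.1, ?_, ?_⟩
  · rw [Derivation.leibniz, hu.2.1, hv.2.1]; simp
  · rw [Derivation.leibniz, hu.2.2, hv.2.2]; simp

/-- The table of covariants. -/
noncomputable def TT : List (ℕ × ℕ × List RR) := prun (base (fun i => (X i : RR))) prog

/-- The values at the points. -/
def rv (i : Fin 26) (a : ℕ) : ℤ := (pts.getD i ([], [])).2.getD a 0

/-- The points. -/
def pt (i : Fin 26) : Fin 8 → ℂ := fun k => (px (pts.getD i ([], [])).1 k : ℂ)

theorem map_base {R S : Type*} [CommRing R] [CommRing S] (φ : R →+* S) (x : Fin 8 → R) :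
    (base x).map (mapE φ) = base (fun i => φ (x i)) := by
  simp only [base, mapE, List.map_cons, List.map_nil, map_mul, map_natCast]

theorem TT_eval (i : Fin 26) : TT.map (mapE (eval (pt i))) =
    (prun (base (px (pts.getD i ([], [])).1)) prog).map (mapE (Int.castRingHom ℂ)) := by
  have h := map_prun (Int.castRingHom ℂ) (base (px (pts.getD i ([], [])).1)) prog
  rw [map_base] at h
  have h' := map_prun (eval (pt i)) (base (fun i => (X i : RR))) prog
  rw [map_base] at h'
  rw [TT, h']
  refine Eq.trans ?_ h.symm
  simp only [eval_X]
  rfl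

theorem headD_map {R S : Type*} [CommRing R] [CommRing S] (φ : R →+* S) (L : List R) :
    (L.map φ).headD 0 = φ (L.headD 0) := by
  cases L <;> simp

/-- Entry `a` of the table. -/
noncomputable def tt (a : ℕ) : ℕ × ℕ × List RR := TT.getD a (0, 0, [])

theorem pts_length : pts.length = 26 := rfl
theorem cont_length : cont.length = 19 := rfl

theorem tt_spec (i : Fin 26) (a : ℕ) (ha : a < 19) :
    (tt a).1 = (cont.getD a (0, 0)).1 ∧ (tt a).2.1 = 0 ∧
      eval (pt i) ((tt a).2.2.headD 0) = ((cont.getD a (0, 0)).2 : ℂ) * rv i a := by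
  have h := ck_spec _ _ _ (ckall_spec pts ckall_pts i (by rw [pts_length]; exact i.2)).1 a
    (by rw [cont_length]; exact ha)
  have e := congrArg (fun T => T.getD a (0, 0, [])) (TT_eval i)
  simp only [mapE_getD] at e
  change mapE _ (tt a) = _ at e
  generalize (prun (base (px (pts.getD i ([], [])).1)) prog).getD a (0, 0, []) = w at h e
  have e1 := congrArg Prod.fst e
  have e2 := congrArg (fun z => z.2.1) e
  have e3 := congrArg (fun z => z.2.2.headD 0) e
  simp only [mapE] at e1 e2 e3
  rw [headD_map, headD_map, h.2.2] at e3
  refine ⟨e1.trans h.1, e2.trans h.2.1, e3.trans ?_⟩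
  simp [rv]

theorem cont_pos : (cont.all fun q => Nat.ble 1 q.2) = true := by decide +kernel

theorem cont_ne (a : ℕ) (ha : a < 19) : ((cont.getD a (0, 0)).2 : ℂ) ≠ 0 := by
  have h := List.all_eq_true.1 cont_pos (cont.getD a (0, 0)) (by
    rw [List.getD_eq_getElem _ _ (by rw [cont_length]; exact ha)]; exact List.getElem_mem _)
  have := Nat.le_of_ble_eq_true h
  exact_mod_cast (by omega : (cont.getD a (0, 0)).2 ≠ 0)

/-- The normalised invariants. -/
noncomputable def Jp (a : ℕ) : RR := C (((cont.getD a (0, 0)).2 : ℂ)⁻¹) * (tt a).2.2.headD 0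

theorem Jp_mem (a : ℕ) (ha : a < 19) : Jp a ∈ V (cont.getD a (0, 0)).1 := by
  have h := tt_spec 0 a ha
  have hc : Cov (tt a) := by
    rw [tt]
    by_cases h : a < TT.length
    · rw [List.getD_eq_getElem _ _ h]; exact Cov_prun _ Cov_base prog _ (List.getElem_mem h)
    · rw [List.getD_eq_default _ _ (by omega)]; exact Cov_zero
  rw [Jp, ← h.1, ← smul_eq_C_mul]
  apply Submodule.smul_mem
  apply Cov_inv
  have : ((tt a).1, 0, (tt a).2.2) = tt a := by rw [← h.2.1]
  rw [this]; exact hc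

theorem Jp_eval (i : Fin 26) (a : ℕ) (ha : a < 19) : eval (pt i) (Jp a) = rv i a := by
  rw [Jp, map_mul, eval_C, (tt_spec i a ha).2.2, inv_mul_cancel_left₀ (cont_ne a ha)]

theorem Bf_congr {S : Type*} [CommRing S] {v w : ℕ → S} (h : ∀ a < 19, v a = w a) : Bf v = Bf w := by
  simp [Bf, h]

/-- The basis. -/
noncomputable def B : Fin 26 → RR := Bf Jp

theorem B_eval (i j : Fin 26) : eval (pt i) (B j) = ((Bf (rv i) j : ℤ) : ℂ) := by
  rw [B, map_Bf, Bf_congr (w := fun a => ((rv i a : ℤ) : ℂ)) (fun a ha => Jp_eval i a ha)]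
  exact (map_Bf (Int.castRingHom ℂ) (rv i) j).symm

theorem rel_eval (i : Fin 26) : eval (pt i) (rel Jp) = 0 := by
  have h := (ckall_spec pts ckall_pts i (by rw [pts_length]; exact i.2)).2
  have h2 := rel_map (Int.castRingHom ℂ) (rv i)
  change rel (rv i) = 0 at h
  rw [h, map_zero] at h2
  rw [rel_map, h2]
  simp only [rel, Jp_eval i _ (by norm_num : 10 < 19), Jp_eval i _ (by norm_num : 11 < 19),
    Jp_eval i _ (by norm_num : 12 < 19), Jp_eval i _ (by norm_num : 13 < 19),
    Jp_eval i _ (by norm_num : 14 < 19), Jp_eval i _ (by norm_num : 15 < 19),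
    Jp_eval i _ (by norm_num : 16 < 19), Jp_eval i _ (by norm_num : 17 < 19),
    Jp_eval i _ (by norm_num : 18 < 19), Int.coe_castRingHom]

/-- The evaluation matrix. -/
def MZ : Matrix (Fin 26) (Fin 26) ℤ := fun i j => Bf (rv i) j

/-- The inverse modulo 13. -/
def NZ : Matrix (Fin 26) (Fin 26) (ZMod 13) := fun k j => (((NT.getD j []).getD k 0 : ℕ) : ZMod 13)

theorem rows_spec (i k : Fin 26) : (((rows13.getD i []).getD k 0 : ℕ) : ZMod 13) = (MZ i k : ZMod 13) := by
  have e : rows13.getD i [] = (Bl (rv i)).map (fun z => (z % 13).toNat) := by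
    rw [rows13, List.getD_eq_getElem _ _ (by simp [pts_length]), List.getElem_map]
    unfold rv
    rw [List.getD_eq_getElem pts _ (by simp [pts_length])]
    rfl
  have e2 := List.getD_map (n := (k : ℕ)) (Bl (rv i)) 0 (fun z : ℤ => (z % 13).toNat)
  change _ = ((Bl (rv i)).getD k 0 % 13).toNat at e2
  rw [e]
  rw [show (0 : ℕ) = ((0 : ℤ) % 13).toNat from rfl] 
  rw [e2, Bl_Bf, MZ]
  have h1 : 0 ≤ Bf (rv i) k % 13 := Int.emod_nonneg _ (by norm_num)
  have h2 : (((Bf (rv i) k % 13).toNat : ℤ) : ZMod 13) = ((Bf (rv i) k % 13 : ℤ) : ZMod 13) := by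
    rw [Int.toNat_of_nonneg h1]
  rw [Int.cast_natCast] at h2
  rw [h2]
  exact (ZMod.intCast_eq_intCast_iff' _ _ 13).2 (by simp)

theorem rows_len (i : Fin 26) : (rows13.getD i []).length = 26 := by
  rw [rows13, List.getD_eq_getElem _ _ (by simp [pts_length]), List.getElem_map]
  rfl

theorem MN : MZ.map (Int.castRingHom (ZMod 13)) * NZ = 1 := by
  ext i j
  have h := List.all_eq_true.1 (List.all_eq_true.1 inv13 i (by simp)) j (by simp)
  have h := Nat.eq_of_beq_eq_true h
  rw [dot_spec 26 _ _ (rows_len i)] at h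
  have h2 := congrArg (fun n : ℕ => (n : ZMod 13)) h
  simp only [ZMod.natCast_mod] at h2
  rw [Matrix.mul_apply, Matrix.one_apply]
  push_cast at h2
  simp only [rows_spec] at h2
  refine Eq.trans ?_ (h2.trans ?_)
  · rfl
  · by_cases hij : i = j
    · subst hij; simp
    · have : Nat.beq i j = false := by
        rw [← Bool.not_eq_true, Nat.beq_eq]; exact fun h => hij (Fin.ext h)
      rw [this, if_neg hij]; simp

theorem MZ_det : MZ.det ≠ 0 := by
  intro h
  have h1 := congrArg Matrix.det MN
  rw [Matrix.det_mul, Matrix.det_one, ← RingHom.mapMatrix_apply, ← RingHom.map_det, h, map_zero,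
    zero_mul] at h1
  exact absurd h1 (by decide)

/-- The complex evaluation matrix. -/
noncomputable def MC : Matrix (Fin 26) (Fin 26) ℂ := MZ.map (Int.castRingHom ℂ)

theorem MC_det : MC.det ≠ 0 := by
  rw [MC, ← RingHom.mapMatrix_apply, ← RingHom.map_det]
  simpa using MZ_det

theorem B_inj (c : Fin 26 → ℂ) (h : ∀ i, eval (pt i) (∑ j, c j • B j) = 0) : c = 0 := by
  apply Matrix.eq_zero_of_mulVec_eq_zero MC_det
  ext i
  have := h i
  simp only [map_sum, smul_eval, B_eval] at this
  rw [Matrix.mulVec, dotProduct, Pi.zero_apply, ← this]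
  exact Finset.sum_congr rfl fun j _ => mul_comm _ _

theorem B_li : LinearIndependent ℂ B := by
  rw [Fintype.linearIndependent_iff]
  intro c hc
  have := B_inj c (fun i => by rw [hc, map_zero])
  intro i; rw [this]; rfl

theorem mI : Jp 18 ∈ V 4 := Jp_mem 18 (by norm_num)
theorem m17 : Jp 17 ∈ V 8 := Jp_mem 17 (by norm_num)
theorem m16 : Jp 16 ∈ V 8 := Jp_mem 16 (by norm_num)
theorem m15 : Jp 15 ∈ V 8 := Jp_mem 15 (by norm_num)
theorem m14 : Jp 14 ∈ V 14 := Jp_mem 14 (by norm_num)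
theorem m13 : Jp 13 ∈ V 14 := Jp_mem 13 (by norm_num)
theorem m12 : Jp 12 ∈ V 14 := Jp_mem 12 (by norm_num)
theorem m11 : Jp 11 ∈ V 14 := Jp_mem 11 (by norm_num)
theorem m10 : Jp 10 ∈ V 18 := Jp_mem 10 (by norm_num)
theorem m9 : Jp 9 ∈ V 18 := Jp_mem 9 (by norm_num)
theorem m8 : Jp 8 ∈ V 18 := Jp_mem 8 (by norm_num)
theorem m7 : Jp 7 ∈ V 18 := Jp_mem 7 (by norm_num)
theorem m6 : Jp 6 ∈ V 18 := Jp_mem 6 (by norm_num)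
theorem m5 : Jp 5 ∈ V 18 := Jp_mem 5 (by norm_num)
theorem m4 : Jp 4 ∈ V 18 := Jp_mem 4 (by norm_num)
theorem m3 : Jp 3 ∈ V 18 := Jp_mem 3 (by norm_num)
theorem m2 : Jp 2 ∈ V 18 := Jp_mem 2 (by norm_num)
theorem m1 : Jp 1 ∈ V 22 := Jp_mem 1 (by norm_num)
theorem m0 : Jp 0 ∈ V 22 := Jp_mem 0 (by norm_num)
theorem mI2 : Jp 18 * Jp 18 ∈ V 8 := V_mul mI mI rfl

theorem mIj {u : RR} (h : u ∈ V 14) : Jp 18 * Jp 18 * u ∈ V 22 := V_mul mI2 h rfl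
theorem mIo {u : RR} (h : u ∈ V 18) : Jp 18 * u ∈ V 22 := V_mul mI h rfl
theorem mej {u v : RR} (h : u ∈ V 8) (h' : v ∈ V 14) : u * v ∈ V 22 := V_mul h h' rfl

theorem B_mem (k : Fin 26) : B k ∈ V 22 := by
  fin_cases k
  · exact mIj m14
  · exact mIj m13
  · exact mIj m12
  · exact mIj m11
  · exact mIo m10
  · exact mIo m9
  · exact mIo m8
  · exact mIo m7
  · exact mIo m6
  · exact mIo m5
  · exact mIo m4
  · exact mIo m3
  · exact mIo m2
  · exact mej m17 m14
  · exact mej m16 m14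
  · exact mej m15 m14
  · exact mej m17 m13
  · exact mej m16 m13
  · exact mej m15 m13
  · exact mej m16 m12
  · exact mej m15 m12
  · exact mej m17 m11
  · exact mej m16 m11
  · exact mej m15 m11
  · exact m1
  · exact m0

theorem span_eq {n d : ℕ} (F : Fin n → RR) (hF : ∀ k, F k ∈ V d) (li : LinearIndependent ℂ F)
    (hd : FiniteDimensional ℂ (V d) ∧ Module.finrank ℂ (V d) ≤ n) :
    Submodule.span ℂ (Set.range F) = V d := by
  haveI := hd.1
  apply Submodule.eq_of_le_of_finrank_le
  · rw [Submodule.span_le]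
    rintro _ ⟨k, rfl⟩
    exact hF k
  · rw [finrank_span_eq_card li]
    simpa using hd.2

theorem li_of {n : ℕ} (F : Fin n → RR) (x : RR) (σ : Fin n → Fin 26) (hσ : Function.Injective σ)
    (h : ∀ k, x * F k = B (σ k)) : LinearIndependent ℂ F := by
  apply LinearIndependent.of_comp (LinearMap.mulLeft ℂ x)
  have : (LinearMap.mulLeft ℂ x) ∘ F = B ∘ σ := by
    funext k; simpa using h k
  rw [this]
  exact B_li.comp σ hσ

theorem span22 : Submodule.span ℂ (Set.range B) = V 22 := span_eq B B_mem B_li dim22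

theorem eval_inj {u : RR} (hu : u ∈ V 22) (h : ∀ i, eval (pt i) u = 0) : u = 0 := by
  rw [← span22, Submodule.mem_span_range_iff_exists_fun] at hu
  obtain ⟨c, rfl⟩ := hu
  rw [B_inj c h]; simp

theorem num_mem {u : RR} (n : ℕ) [n.AtLeastTwo] (h : u ∈ V 22) : (OfNat.ofNat n : RR) * u ∈ V 22 := by
  have : (OfNat.ofNat n : RR) * u = n • u := by rw [nsmul_eq_mul]; rfl
  rw [this]
  exact Submodule.smul_of_tower_mem _ n h

theorem rel_zero : rel Jp = 0 := by
  apply eval_inj _ rel_eval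
  unfold rel
  refine Submodule.add_mem _ (Submodule.sub_mem _ (Submodule.add_mem _ (Submodule.add_mem _
    (Submodule.sub_mem _ (Submodule.sub_mem _ (Submodule.add_mem _ (Submodule.sub_mem _ ?_ ?_) ?_)
    ?_) ?_) ?_) ?_) ?_) ?_ <;> apply num_mem
  · exact mIj m14
  · exact mIj m12
  · exact mIj m11
  · exact mIo m10
  · exact mej m17 m14
  · exact mej m16 m14
  · exact mej m15 m14
  · exact mej m15 m13
  · exact mej m17 m12

/-- Basis in degree 4. -/
noncomputable def F4 : Fin 1 → RR := ![Jp 18]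
/-- Basis in degree 8. -/
noncomputable def F8 : Fin 4 → RR := ![Jp 18 * Jp 18, Jp 17, Jp 16, Jp 15]
/-- Basis in degree 14. -/
noncomputable def F14 : Fin 4 → RR := ![Jp 14, Jp 13, Jp 12, Jp 11]
/-- Basis in degree 18. -/
noncomputable def F18 : Fin 13 → RR := ![Jp 18 * Jp 14, Jp 18 * Jp 13, Jp 18 * Jp 12, Jp 18 * Jp 11,
  Jp 10, Jp 9, Jp 8, Jp 7, Jp 6, Jp 5, Jp 4, Jp 3, Jp 2]

theorem span4 : Submodule.span ℂ (Set.range F4) = V 4 := by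
  refine span_eq F4 ?_ (li_of F4 (Jp 18 * Jp 14) ![0] (by decide) ?_) dim4
  · intro k; fin_cases k; exact mI
  · intro k; fin_cases k
    change Jp 18 * Jp 14 * Jp 18 = Jp 18 * Jp 18 * Jp 14
    ring

theorem span8 : Submodule.span ℂ (Set.range F8) = V 8 := by
  refine span_eq F8 ?_ (li_of F8 (Jp 14) ![0, 13, 14, 15] (by decide) ?_) dim8
  · intro k; fin_cases k
    · exact mI2
    · exact m17
    · exact m16
    · exact m15
  · intro k; fin_cases k <;> exact mul_comm _ _

theorem span14 : Submodule.span ℂ (Set.range F14) = V 14 := by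
  refine span_eq F14 ?_ (li_of F14 (Jp 18 * Jp 18) ![0, 1, 2, 3] (by decide) ?_) dim14
  · intro k; fin_cases k
    · exact m14
    · exact m13
    · exact m12
    · exact m11
  · intro k; fin_cases k <;> rfl

/-- Inclusion of indices. -/
def s18 : Fin 13 → Fin 26 := Fin.castLE (by norm_num)

theorem F18_mul (k : Fin 13) : Jp 18 * F18 k = B (s18 k) := by
  fin_cases k
  · exact (mul_assoc _ _ _).symm
  · exact (mul_assoc _ _ _).symm
  · exact (mul_assoc _ _ _).symm
  · exact (mul_assoc _ _ _).symm
  · rfl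
  · rfl
  · rfl
  · rfl
  · rfl
  · rfl
  · rfl
  · rfl
  · rfl

theorem span18 : Submodule.span ℂ (Set.range F18) = V 18 := by
  refine span_eq F18 ?_ (li_of F18 (Jp 18) s18 (Fin.castLE_injective _) F18_mul) dim18
  intro k; fin_cases k
  · exact V_mul mI m14 rfl
  · exact V_mul mI m13 rfl
  · exact V_mul mI m12 rfl
  · exact V_mul mI m11 rfl
  · exact m10
  · exact m9
  · exact m8
  · exact m7
  · exact m6
  · exact m5
  · exact m4
  · exact m3
  · exact m2

/-- The reducible basis elements. -/
noncomputable def B24 : Fin 24 → RR := fun k => B (Fin.castLE (by norm_num) k)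

theorem B24_li : LinearIndependent ℂ B24 := B_li.comp _ (Fin.castLE_injective _)

/-- Their span. -/
noncomputable def SW : Submodule ℂ RR := Submodule.span ℂ (Set.range B24)

theorem SW_B (k : Fin 24) : B24 k ∈ SW := Submodule.subset_span ⟨k, rfl⟩

theorem num_memS {u : RR} (n : ℕ) [n.AtLeastTwo] (h : u ∈ SW) : (OfNat.ofNat n : RR) * u ∈ SW := by
  have : (OfNat.ofNat n : RR) * u = n • u := by rw [nsmul_eq_mul]; rfl
  rw [this]
  exact Submodule.smul_of_tower_mem _ n h

theorem e0j2 : Jp 17 * Jp 12 ∈ SW := by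
  have h : Jp 17 * Jp 12 = (-(1 / 750 : ℂ)) • (37 * B24 0 - 175 * B24 2 + 3 * B24 3
    - 2 * B24 4 - 90 * B24 13 + 2 * B24 14 + 9 * B24 15 - 30 * B24 18) := by
    have h0 := rel_zero
    have h1 : (750 : RR) * (Jp 17 * Jp 12) = -(37 * B24 0 - 175 * B24 2 + 3 * B24 3
      - 2 * B24 4 - 90 * B24 13 + 2 * B24 14 + 9 * B24 15 - 30 * B24 18) :=
      eq_neg_of_add_eq_zero_right h0
    have h2 : (C (750 : ℂ) : RR) = 750 := map_ofNat C 750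
    rw [neg_smul, ← smul_neg, ← h1, ← h2, smul_eq_C_mul, ← mul_assoc, ← C_mul]
    norm_num
  rw [h]
  apply Submodule.smul_mem
  refine Submodule.sub_mem _ (Submodule.add_mem _ (Submodule.add_mem _
    (Submodule.sub_mem _ (Submodule.sub_mem _ (Submodule.add_mem _ (Submodule.sub_mem _ ?_ ?_) ?_)
    ?_) ?_) ?_) ?_) ?_ <;> exact num_memS _ (SW_B _)

theorem F8_F14 (a b : Fin 4) : F8 a * F14 b ∈ SW := by
  fin_cases a <;> fin_cases b
  · exact SW_B 0
  · exact SW_B 1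
  · exact SW_B 2
  · exact SW_B 3
  · exact SW_B 13
  · exact SW_B 16
  · exact e0j2
  · exact SW_B 21
  · exact SW_B 14
  · exact SW_B 17
  · exact SW_B 19
  · exact SW_B 22
  · exact SW_B 15
  · exact SW_B 18
  · exact SW_B 20
  · exact SW_B 23

theorem F4_F18 (a : Fin 1) (b : Fin 13) : F4 a * F18 b ∈ SW := by
  have : F4 a = Jp 18 := by fin_cases a; rfl
  rw [this, F18_mul]
  exact SW_B (Fin.castLE (by norm_num) b)

theorem mul_span {m n : ℕ} (F : Fin m → RR) (G : Fin n → RR) (h : ∀ a b, F a * G b ∈ SW) {u v : RR}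
    (hu : u ∈ Submodule.span ℂ (Set.range F)) (hv : v ∈ Submodule.span ℂ (Set.range G)) :
    u * v ∈ SW := by
  have := Submodule.mul_mem_mul hu hv
  rw [Submodule.span_mul_span] at this
  refine (Submodule.span_le.2 ?_) this
  rintro _ ⟨_, ⟨a, rfl⟩, _, ⟨b, rfl⟩, rfl⟩
  exact h a b

theorem mul48 {u v : RR} (hu : u ∈ V 4) (hv : v ∈ V 18) : u * v ∈ SW :=
  mul_span F4 F18 F4_F18 (by rwa [span4]) (by rwa [span18])

theorem mul814 {u v : RR} (hu : u ∈ V 8) (hv : v ∈ V 14) : u * v ∈ SW :=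
  mul_span F8 F14 F8_F14 (by rwa [span8]) (by rwa [span14])

theorem W_le : W 22 ≤ SW := by
  rw [W, Submodule.span_le]
  rintro _ ⟨g, h, a, b, ha, hb, hab, g1, h1, g2, g3, h2, h3, rfl⟩
  have hg : g ∈ V a := mem_V.2 ⟨g1, g2, g3⟩
  have hh : h ∈ V b := mem_V.2 ⟨h1, h2, h3⟩
  have zl : g = 0 → g * h ∈ SW := by rintro rfl; rw [zero_mul]; exact SW.zero_mem
  have zr : h = 0 → g * h ∈ SW := by rintro rfl; rw [mul_zero]; exact SW.zero_mem
  by_cases ho : a % 2 = 1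
  · exact zl (V_odd ho hg)
  have : a = 2 ∨ a = 4 ∨ a = 6 ∨ a = 8 ∨ a = 10 ∨ a = 12 ∨ a = 14 ∨ a = 16 ∨ a = 18 ∨ a = 20 := by
    omega
  rcases this with rfl | rfl | rfl | rfl | rfl | rfl | rfl | rfl | rfl | rfl
  · exact zl (V2_zero hg)
  · obtain rfl : b = 18 := by omega
    exact mul48 hg hh
  · exact zl (V6_zero hg)
  · obtain rfl : b = 14 := by omega
    exact mul814 hg hh
  · exact zl (V10_zero hg)
  · obtain rfl : b = 10 := by omega
    exact zr (V10_zero hh)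
  · obtain rfl : b = 8 := by omega
    change g * h ∈ SW
    rw [mul_comm]; exact mul814 hh hg
  · obtain rfl : b = 6 := by omega
    exact zr (V6_zero hh)
  · obtain rfl : b = 4 := by omega
    change g * h ∈ SW
    rw [mul_comm]; exact mul48 hh hg
  · obtain rfl : b = 2 := by omega
    exact zr (V2_zero hh)

theorem W_mem {a b : ℕ} {u v : RR} (ha : 0 < a) (hb : 0 < b) (hab : a + b = 22) (hu : u ∈ V a)
    (hv : v ∈ V b) : u * v ∈ W 22 := by
  rw [mem_V] at hu hv
  exact Submodule.subset_span ⟨u, v, a, b, ha, hb, hab, hu.1, hv.1, hu.2.1, hu.2.2, hv.2.1, hv.2.2, rfl⟩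

theorem SW_le : SW ≤ W 22 := by
  rw [SW, Submodule.span_le]
  have p1 : 0 < 4 := by norm_num
  have p2 : 0 < 18 := by norm_num
  have p3 : 0 < 8 := by norm_num
  have p4 : 0 < 14 := by norm_num
  rintro _ ⟨k, rfl⟩
  fin_cases k
  · exact W_mem p3 p4 rfl mI2 m14
  · exact W_mem p3 p4 rfl mI2 m13
  · exact W_mem p3 p4 rfl mI2 m12
  · exact W_mem p3 p4 rfl mI2 m11
  · exact W_mem p1 p2 rfl mI m10
  · exact W_mem p1 p2 rfl mI m9
  · exact W_mem p1 p2 rfl mI m8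
  · exact W_mem p1 p2 rfl mI m7
  · exact W_mem p1 p2 rfl mI m6
  · exact W_mem p1 p2 rfl mI m5
  · exact W_mem p1 p2 rfl mI m4
  · exact W_mem p1 p2 rfl mI m3
  · exact W_mem p1 p2 rfl mI m2
  · exact W_mem p3 p4 rfl m17 m14
  · exact W_mem p3 p4 rfl m16 m14
  · exact W_mem p3 p4 rfl m15 m14
  · exact W_mem p3 p4 rfl m17 m13
  · exact W_mem p3 p4 rfl m16 m13
  · exact W_mem p3 p4 rfl m15 m13
  · exact W_mem p3 p4 rfl m16 m12
  · exact W_mem p3 p4 rfl m15 m12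
  · exact W_mem p3 p4 rfl m17 m11
  · exact W_mem p3 p4 rfl m16 m11
  · exact W_mem p3 p4 rfl m15 m11

theorem final : delta 22 = 2 := by
  haveI := dim22.1
  have hW : W 22 = SW := le_antisymm W_le SW_le
  have hV : Module.finrank ℂ (V 22) = 26 := by
    rw [← span22, finrank_span_eq_card B_li]; simp
  have hWV : W 22 ≤ V 22 := by
    rw [hW, SW, Submodule.span_le]
    rintro _ ⟨k, rfl⟩
    exact B_mem _
  have hW' : Module.finrank ℂ (Submodule.comap (V 22).subtype (W 22)) = 24 := by
    rw [(Submodule.comapSubtypeEquivOfLe hWV).finrank_eq, hW, SW, finrank_span_eq_card B24_li]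
    simp
  have := Submodule.finrank_quotient_add_finrank (Submodule.comap (V 22).subtype (W 22))
  rw [hV, hW'] at this
  rw [delta]
  omega

/-- There are exactly two new irreducible invariants of the binary septimic in degree
22: `δ₂₂ = 2`. -/
theorem delta_twentytwo : delta 22 = 2 := by
  exact final
end

section
/- For the invariant algebra of the binary septimic there are no new irreducible invariants in degrees 24 and 28: every homogeneous f ∈ ℂ[t, x_1, …, x_7] of degree 24 (respectively of degree 28) with D1(f) = 0 and D2(f) = 0 lies in the ℂ-span of products g·h, where g and h are homogeneous of positive degrees annihilated by both D1 and D2 with deg g + deg h = 24 (respectively 28); i.e. δ_24 = 0 and δ_28 = 0. -/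
open MvPolynomial Finset

namespace Sept

/-- the modulus used for the rank computation -/
def PP : ℕ := 10007

/-- packing base for coefficient vectors -/
def QQ : ℕ := 16384

/-- packing base for matrix rows -/
def EE : ℕ := 1099511627776

/-- coefficients of the `k`-th transvectant of forms of orders `m` and `n` -/
def Kc (m n k u v : ℕ) : ℤ :=
  if u ≤ m ∧ v ≤ n then
    ((List.range (k + 1)).map fun j => (-1 : ℤ) ^ j *
      ((k.choose j * (m - u).descFactorial (k - j) * u.descFactorial j *
        v.descFactorial (k - j) * (n - v).descFactorial j : ℕ) : ℤ)).sum
  else 0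

/-- an instruction: compute the `k`-th transvectant of entries `i`, `j` of the environment -/
structure Instr where
  i : ℕ
  j : ℕ
  m : ℕ
  n : ℕ
  k : ℕ

def prog : List Instr :=
  [⟨0, 0, 7, 7, 6⟩, ⟨1, 1, 7, 7, 4⟩, ⟨0, 1, 6, 2, 2⟩, ⟨3, 1, 7, 6, 5⟩, ⟨4, 1, 7, 4, 4⟩,
   ⟨5, 5, 7, 7, 2⟩, ⟨0, 0, 10, 10, 8⟩, ⟨5, 4, 6, 4, 4⟩, ⟨8, 3, 7, 3, 3⟩, ⟨9, 4, 7, 3, 2⟩,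
   ⟨9, 0, 2, 6, 2⟩, ⟨11, 4, 7, 4, 3⟩, ⟨12, 0, 7, 5, 5⟩, ⟨9, 1, 3, 5, 1⟩, ⟨8, 0, 10, 6, 6⟩,
   ⟨14, 14, 2, 2, 2⟩, ⟨13, 13, 4, 4, 4⟩, ⟨13, 12, 3, 3, 3⟩, ⟨11, 11, 4, 4, 4⟩,
   ⟨11, 11, 2, 2, 2⟩, ⟨11, 11, 4, 4, 4⟩, ⟨11, 11, 6, 6, 6⟩, ⟨19, 11, 4, 4, 4⟩,
   ⟨10, 10, 2, 2, 2⟩, ⟨16, 11, 2, 2, 2⟩, ⟨16, 10, 4, 4, 4⟩, ⟨15, 15, 4, 4, 4⟩,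
   ⟨12, 12, 4, 4, 4⟩]

def mons24 : List (List ℕ) :=
  [[12,12,12,12,12,12],[12,12,12,12,11],[12,12,12,12,10],[12,12,12,12,9],[12,12,12,8],
   [12,12,12,7],[12,12,12,6],[12,12,12,5],[12,12,12,4],[12,12,12,3],[12,12,11,11],[12,12,11,10],
   [12,12,11,9],[12,12,10,10],[12,12,10,9],[12,12,9,9],[12,12,2],[12,12,1],[12,11,8],[12,11,7],
   [12,11,6],[12,11,5],[12,11,4],[12,11,3],[12,10,8],[12,10,7],[12,10,6],[12,10,5],[12,10,4],
   [12,10,3],[12,9,8],[12,9,7],[12,9,6],[12,9,5],[12,0],[11,11,11],[11,11,10],[11,11,9],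
   [11,10,10],[11,10,9],[11,9,9],[11,2],[11,1],[10,10,10],[10,10,9],[10,9,9],[10,2],[10,1],
   [9,9,9],[9,2],[9,1],[8,8],[8,7],[8,6],[8,5],[8,4],[8,3],[7,7],[7,6],[6,6],[4,4],[4,3]]

def mons28 : List (List ℕ) :=
  mons24.map (12 :: ·) ++
  [[11,11,8],[11,11,7],[11,11,6],[11,11,5],[11,11,4],[11,11,3],[11,10,8],[11,10,7],[11,10,6],
   [11,10,5],[11,10,4],[11,10,3],[11,9,8],[11,9,7],[11,9,6],[11,9,5],[11,0],[10,10,8],[10,10,7],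
   [10,10,6],[10,10,5],[10,10,4],[10,10,3],[10,9,8],[10,9,7],[10,9,6],[10,9,5],[10,0],[9,9,8],
   [9,9,7],[9,9,6],[9,9,5],[9,0],[6,2],[4,2]]

/-- the sample points -/
def pt (j i : ℕ) : ℕ := (j + 2) ^ (i * i + i + 1) % 1009

/-! ### Evaluation-forcing combinators -/

noncomputable def fN (n : ℕ) (k : ℕ → Bool) : Bool :=
  Nat.rec (motive := fun _ => Bool) (k 0) (fun m _ => k (Nat.succ m)) n

noncomputable def mapK {α β : Type} (g : α → (β → Bool) → Bool) (l : List α) :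
    (List β → Bool) → Bool :=
  List.rec (motive := fun _ => (List β → Bool) → Bool) (fun k => k [])
    (fun x _ ih k => g x fun y => ih fun ys => k (y :: ys)) l

/-- `foldr` through the recursor -/
noncomputable def fld {α : Type} (f : α → ℕ → ℕ) (b : ℕ) (l : List α) : ℕ :=
  List.rec (motive := fun _ => ℕ) b (fun x _ ih => f x ih) l

/-! ### Elimination -/

/-- scale the first `n` digits of `r` by `c` modulo `PP` -/
noncomputable def red (c n : ℕ) : ℕ → ℕ :=
  Nat.rec (motive := fun _ => ℕ → ℕ) (fun _ => 0)
    (fun _ ih r => Nat.add (Nat.mod (Nat.mul c (Nat.mod r EE)) PP)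
      (Nat.mul EE (ih (Nat.div r EE)))) n

/-- one row operation, dropping the leading entry -/
def rowOp (R S : ℕ) : ℕ :=
  Nat.div (Nat.add S (Nat.mul (Nat.sub PP (Nat.mod (Nat.mod S EE) PP)) R)) EE

noncomputable def elimK (n : ℕ) : List ℕ → Bool :=
  Nat.rec (motive := fun _ => List ℕ → Bool)
    (fun l => List.rec (motive := fun _ => Bool) true (fun _ _ _ => false) l)
    (fun n ih l => List.rec (motive := fun _ => Bool) false
      (fun r rs _ =>
        fN (Nat.mod (Nat.pow (Nat.mod r EE) 10005) PP) fun c =>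
        fN (red c (Nat.succ n) r) fun R =>
          Bool.rec (motive := fun _ => Bool) false
            (mapK (fun S => fN (rowOp R S)) rs ih) (Nat.beq (Nat.mod R EE) 1)) l) n

/-! ### Evaluation of the program -/

/-- an entry of a compiled transvectant -/
structure Ent where
  u : ℕ
  v : ℕ
  c : ℕ

/-- a compiled instruction -/
structure CI where
  i : ℕ
  j : ℕ
  tbl : List (List Ent)

def tblRow (m n k s : ℕ) : List Ent :=
  ((List.Nat.antidiagonal (s + k)).filter fun q => Nat.ble q.1 m && Nat.ble q.2 n).map
    fun q => ⟨QQ ^ q.1, QQ ^ q.2, (Kc m n k q.1 q.2 % (PP : ℤ)).toNat⟩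

def tblOf (m n k : ℕ) : List (List Ent) :=
  (List.range (m + n - 2 * k + 1)).map (tblRow m n k)

noncomputable def fT (t : Ent) (k : Ent → Bool) : Bool :=
  fN t.1 fun a => fN t.2 fun b => fN t.3 fun c => k ⟨a, b, c⟩

noncomputable def compileK (I : Instr) (k : CI → Bool) : Bool :=
  mapK (mapK fT) (tblOf I.m I.n I.k) fun t => k ⟨I.i, I.j, t⟩

/-- digit extraction -/
def dg (a q : ℕ) : ℕ := Nat.mod (Nat.div a q) QQ

noncomputable def evalTbl (a b : ℕ) (t : List (List Ent)) : ℕ :=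
  fld (fun row acc => Nat.add (Nat.mod (fld (fun t acc => Ent.rec (motive := fun _ => ℕ)
    (fun u v c => Nat.add (Nat.mul c (Nat.mul (dg a u) (dg b v))) acc) t) 0 row) PP)
      (Nat.mul QQ acc)) 0 t

noncomputable def nth (l : List ℕ) : ℕ → ℕ :=
  List.rec (motive := fun _ => ℕ → ℕ) (fun _ => 0)
    (fun x _ ih n => Nat.rec (motive := fun _ => ℕ) x (fun m _ => ih m) n) l

noncomputable def runK (cs : List CI) : List ℕ → (List ℕ → Bool) → Bool :=
  List.rec (motive := fun _ => List ℕ → (List ℕ → Bool) → Bool) (fun env k => k env)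
    (fun c _ ih env k => CI.rec (motive := fun _ => Bool)
      (fun i j tbl => fN (nth env i) fun a => fN (nth env j) fun b =>
        fN (evalTbl a b tbl) fun t => ih (t :: env) k) c) cs

noncomputable def start (j : ℕ) : ℕ :=
  fld (fun i acc => Nat.add (Nat.mod (Nat.mul (Nat.choose 7 i) (pt j i)) PP) (Nat.mul QQ acc)) 0
    (List.range 8)

noncomputable def packInv (env : List ℕ) : ℕ :=
  fld (fun e acc => Nat.add (Nat.mod e QQ) (Nat.mul QQ acc)) 0 env

noncomputable def monN (iv : ℕ) (l : List ℕ) : ℕ :=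
  fld (fun q acc => Nat.mod (Nat.mul (dg iv q) acc) PP) 1 l

noncomputable def rowK (cs : List CI) (mons : List (List ℕ)) (j : ℕ) (k : ℕ → Bool) : Bool :=
  fN (start j) fun s => runK cs [s] fun env => fN (packInv env) fun iv =>
    fN (fld (fun l acc => Nat.add (monN iv l) (Nat.mul EE acc)) 0 mons) k

noncomputable def checkK (mons : List (List ℕ)) (N : ℕ) : Bool :=
  mapK compileK prog fun cs => mapK (mapK fun i => fN (QQ ^ i)) mons fun ms =>
    mapK (rowK cs ms) (List.range N) fun rows => elimK N rows
/-! ### Correctness of the forcing combinators and of the elimination -/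

theorem fN_eq (n : ℕ) (k : ℕ → Bool) : fN n k = k n := by cases n <;> rfl

theorem mapK_eq {α β : Type} {g : α → (β → Bool) → Bool} {f : α → β}
    (h : ∀ x k, g x k = k (f x)) (l : List α) (k : List β → Bool) :
    mapK g l k = k (l.map f) := by
  induction l generalizing k with
  | nil => rfl
  | cons x xs ih =>
    change g x (fun y => mapK g xs fun ys => k (y :: ys)) = _
    rw [h, ih]; rfl

theorem fld_nil {α : Type} (f : α → ℕ → ℕ) (b : ℕ) : fld f b [] = b := rfl
theorem fld_cons {α : Type} (f : α → ℕ → ℕ) (b : ℕ) (x : α) (l : List α) :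
    fld f b (x :: l) = f x (fld f b l) := rfl

/-- digits -/
def dig (E S i : ℕ) : ℕ := S / E ^ i % E

theorem dig_zero (E S : ℕ) : dig E S 0 = S % E := by simp [dig]
theorem dig_succ (E S i : ℕ) : dig E S (i + 1) = dig E (S / E) i := by
  simp [dig, pow_succ', Nat.div_div_eq_div_mul]

theorem dig_zero_left (E i : ℕ) : dig E 0 i = 0 := by simp [dig]

theorem dig_cons_zero {E a : ℕ} (S : ℕ) (h : a < E) : dig E (a + E * S) 0 = a := by
  rw [dig_zero, Nat.add_mul_mod_self_left, Nat.mod_eq_of_lt h]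

theorem dig_cons_succ {E a : ℕ} (S i : ℕ) (h : a < E) :
    dig E (a + E * S) (i + 1) = dig E S i := by
  rw [dig_succ, Nat.add_mul_div_left _ _ (by omega), Nat.div_eq_of_lt h, zero_add]

theorem dig_lin {E b : ℕ} (S R : ℕ) (h : ∀ i, dig E S i + b * dig E R i < E) (i : ℕ) :
    dig E (S + b * R) i = dig E S i + b * dig E R i := by
  have hE : 0 < E := by have := h 0; omega
  have key : ∀ S R, dig E S 0 + b * dig E R 0 < E →
      S + b * R = (dig E S 0 + b * dig E R 0) + E * (S / E + b * (R / E)) := by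
    intro S R _
    rw [dig_zero, dig_zero]
    conv_lhs => rw [← Nat.mod_add_div S E, ← Nat.mod_add_div R E]
    ring
  induction i generalizing S R with
  | zero => rw [key S R (h 0), dig_cons_zero _ (h 0)]
  | succ i ih =>
    rw [key S R (h 0), dig_cons_succ _ _ (h 0), ih, dig_succ, dig_succ]
    intro j
    have := h (j + 1)
    rwa [dig_succ, dig_succ] at this

theorem PP_pos : 0 < PP := by decide
theorem PP_lt_EE : PP < EE := by decide

theorem red_zero (c r : ℕ) : red c 0 r = 0 := rfl
theorem red_succ (c n r : ℕ) : red c (n + 1) r =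
    (c * (r % EE)) % PP + EE * red c n (r / EE) := rfl

theorem red_lt (c n r i : ℕ) : dig EE (red c n r) i < PP := by
  induction n generalizing r i with
  | zero => rw [red_zero, dig_zero_left]; exact PP_pos
  | succ n ih =>
    have h : (c * (r % EE)) % PP < PP := Nat.mod_lt _ PP_pos
    have h' := h.trans PP_lt_EE
    rw [red_succ]
    cases i with
    | zero => rw [dig_cons_zero _ h']; exact h
    | succ i => rw [dig_cons_succ _ _ h']; exact ih _ _

theorem red_dig (c n r i : ℕ) (hi : i < n) :
    ((dig EE (red c n r) i : ℕ) : ZMod PP) = c * (dig EE r i : ℕ) := by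
  induction n generalizing r i with
  | zero => omega
  | succ n ih =>
    have h' : (c * (r % EE)) % PP < EE := (Nat.mod_lt _ PP_pos).trans PP_lt_EE
    rw [red_succ]
    cases i with
    | zero => rw [dig_cons_zero _ h', dig_zero, ZMod.natCast_mod, Nat.cast_mul]
    | succ i => rw [dig_cons_succ _ _ h', dig_succ]; exact ih _ _ (by omega)

/-- digit bound after `t` row operations -/
def Bd (t S : ℕ) : Prop := ∀ i, dig EE S i ≤ PP + t * (PP * PP)

theorem rowOp_dig {t R S : ℕ} (ht : t < 1000) (hS : Bd t S) (hR : ∀ i, dig EE R i < PP) (i : ℕ) :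
    dig EE (rowOp R S) i = dig EE S (i + 1) + (PP - dig EE S 0 % PP) * dig EE R (i + 1) := by
  have : rowOp R S = (S + (PP - dig EE S 0 % PP) * R) / EE := by rw [dig_zero]; rfl
  rw [this, ← dig_succ, dig_lin]
  intro j
  have h1 := hS j
  have h2 := hR j
  have h3 : (PP - dig EE S 0 % PP) * dig EE R j ≤ PP * PP :=
    Nat.mul_le_mul (Nat.sub_le _ _) h2.le
  have h4 : PP + 1000 * (PP * PP) + PP * PP < EE := by decide
  have h5 : t * (PP * PP) ≤ 1000 * (PP * PP) := Nat.mul_le_mul_right _ ht.le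
  omega

theorem rowOp_bd {t R S : ℕ} (ht : t < 1000) (hS : Bd t S) (hR : ∀ i, dig EE R i < PP) :
    Bd (t + 1) (rowOp R S) := by
  intro i
  rw [rowOp_dig ht hS hR]
  have h1 := hS (i + 1)
  have h2 := hR (i + 1)
  have h3 : (PP - dig EE S 0 % PP) * dig EE R (i + 1) ≤ PP * PP :=
    Nat.mul_le_mul (Nat.sub_le _ _) h2.le
  rw [add_mul, one_mul]
  omega

/-- linear combination of rows, one column -/
def comb : List (ZMod PP) → List ℕ → ℕ → ZMod PP
  | c :: cs, r :: rs, i => c * (dig EE r i : ℕ) + comb cs rs i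
  | _, _, _ => 0

def LI (n : ℕ) (rows : List ℕ) : Prop :=
  ∀ cs : List (ZMod PP), cs.length = rows.length → (∀ i < n, comb cs rows i = 0) →
    ∀ c ∈ cs, c = 0

theorem comb_rowOp {t R : ℕ} (ht : t < 1000) (hR : ∀ i, dig EE R i < PP)
    (cs : List (ZMod PP)) (rs : List ℕ) (hrs : ∀ S ∈ rs, Bd t S) (i : ℕ) :
    comb cs (rs.map (rowOp R)) i =
      comb cs rs (i + 1) - comb cs rs 0 * (dig EE R (i + 1) : ℕ) := by
  induction rs generalizing cs with
  | nil => cases cs <;> simp [comb]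
  | cons S rs ih =>
    cases cs with
    | nil => simp [comb]
    | cons c cs =>
      rw [List.map_cons, comb, comb, comb, ih cs (fun S hS => hrs S (List.mem_cons_of_mem _ hS)),
        rowOp_dig ht (hrs S List.mem_cons_self) hR]
      have : dig EE S 0 % PP ≤ PP := (Nat.mod_lt _ PP_pos).le
      push_cast [Nat.cast_sub this]
      rw [ZMod.natCast_self, ZMod.natCast_mod]
      ring

theorem elimK_zero (l : List ℕ) (h : elimK 0 l = true) : l = [] := by
  cases l with
  | nil => rfl
  | cons => cases h

theorem elimK_succ (n : ℕ) (l : List ℕ) (h : elimK (n + 1) l = true) :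
    ∃ r rs c R, l = r :: rs ∧ R = red c (n + 1) r ∧ R % EE = 1 ∧
      elimK n (rs.map (rowOp R)) = true := by
  cases l with
  | nil => cases h
  | cons r rs =>
    change fN _ (fun c => fN (red c (Nat.succ n) r) fun R => Bool.rec (motive := fun _ => Bool)
      false (mapK (fun S => fN (rowOp R S)) rs (elimK n)) (Nat.beq (Nat.mod R EE) 1)) = true at h
    rw [fN_eq, fN_eq] at h
    refine ⟨r, rs, Nat.mod (Nat.pow (Nat.mod r EE) 10005) PP,
      red (Nat.mod (Nat.pow (Nat.mod r EE) 10005) PP) (n + 1) r, rfl, rfl, ?_⟩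
    change Bool.rec (motive := fun _ => Bool) false (mapK (fun S => fN (rowOp
      (red (Nat.mod (Nat.pow (Nat.mod r EE) 10005) PP) (n + 1) r) S)) rs (elimK n))
      (Nat.beq (Nat.mod (red (Nat.mod (Nat.pow (Nat.mod r EE) 10005) PP) (n + 1) r) EE) 1) = true at h
    generalize red _ _ _ = R at h ⊢
    rw [mapK_eq (f := rowOp R) (fun x k => fN_eq _ _)] at h
    cases hb : Nat.beq (Nat.mod R EE) 1 with
    | false => rw [hb] at h; cases h
    | true => rw [hb] at h; exact ⟨Nat.eq_of_beq_eq_true hb, h⟩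

theorem elimK_LI (n t : ℕ) (ht : t + n < 1000) (rows : List ℕ) (hb : ∀ S ∈ rows, Bd t S)
    (h : elimK n rows = true) : LI n rows := by
  induction n generalizing t rows with
  | zero =>
    rw [elimK_zero _ h]
    intro cs hl _ c hc
    rw [List.length_nil, List.length_eq_zero_iff] at hl
    rw [hl] at hc; cases hc
  | succ n ih =>
    obtain ⟨r, rs, c, R, rfl, hR, hR1, he⟩ := elimK_succ n rows h
    have hRlt : ∀ i, dig EE R i < PP := fun i => by rw [hR]; exact red_lt _ _ _ _
    have hrs : ∀ S ∈ rs, Bd t S := fun S hS => hb S (List.mem_cons_of_mem _ hS)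
    have hLI := ih (t + 1) (by omega) (rs.map (rowOp R)) (by
      intro S hS
      obtain ⟨S', hS', rfl⟩ := List.mem_map.1 hS
      exact rowOp_bd (by omega) (hrs _ hS') hRlt) he
    have hcr : (c : ZMod PP) * (dig EE r 0 : ℕ) = 1 := by
      rw [← red_dig c (n + 1) r 0 (by omega), ← hR, dig_zero, hR1, Nat.cast_one]
    intro cs hl hz
    cases cs with
    | nil => intro _ hc; cases hc
    | cons c0 cs =>
      have h0 := hz 0 (by omega)
      rw [comb] at h0
      have hcs : ∀ d ∈ cs, d = 0 := by
        apply hLI cs (by simpa using hl)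
        intro i hi
        rw [comb_rowOp (by omega) hRlt cs rs hrs]
        have h1 := hz (i + 1) (by omega)
        rw [comb] at h1
        rw [hR, red_dig c (n + 1) r (i + 1) (by omega)]
        linear_combination h1 - (c : ZMod PP) * (dig EE r (i + 1) : ℕ) * h0 +
          c0 * (dig EE r (i + 1) : ℕ) * hcr
      have hc0 : comb cs rs 0 = 0 := by
        clear hl h0 hz
        clear hLI he hrs hb h
        induction cs generalizing rs with
        | nil => simp [comb]
        | cons d cs ih2 =>
          cases rs with
          | nil => simp [comb]
          | cons s rs =>
            rw [comb, hcs d List.mem_cons_self, ih2 _ (fun e he => hcs e (List.mem_cons_of_mem _ he))]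
            simp
      rw [hc0, add_zero] at h0
      intro d hd
      rcases List.mem_cons.1 hd with rfl | hd
      · linear_combination (c : ZMod PP) * h0 - d * hcr
      · exact hcs d hd

instance factPP : Fact (Nat.Prime PP) := ⟨by norm_num [PP]⟩

/-- the elimination certifies a nonvanishing determinant -/
theorem det_ne_zero_of_elim (N : ℕ) (hN : N < 1000) (f : ℕ → ℕ)
    (hb : ∀ j, Bd 0 (f j)) (h : elimK N ((List.range N).map f) = true)
    (M : Matrix (Fin N) (Fin N) (ZMod PP))
    (hM : ∀ j i : Fin N, M j i = ((dig EE (f j) i : ℕ) : ZMod PP)) : M.det ≠ 0 := by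
  intro hdet
  obtain ⟨v, hv, hv0⟩ := Matrix.exists_vecMul_eq_zero_iff.2 hdet
  have hLI := elimK_LI N 0 (by omega) _ (by
    intro S hS
    obtain ⟨j, _, rfl⟩ := List.mem_map.1 hS
    exact hb j) h
  have key : ∀ (L : ℕ) (w : Fin L → ZMod PP) (g : Fin L → ℕ) (i : ℕ),
      comb (List.ofFn w) (List.ofFn g) i = ∑ j, w j * (dig EE (g j) i : ℕ) := by
    intro L
    induction L with
    | zero => intro w g i; simp [comb]
    | succ L ih => intro w g i; rw [List.ofFn_succ, List.ofFn_succ, comb, ih, Fin.sum_univ_succ]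
  have hr : (List.range N).map f = List.ofFn (fun j : Fin N => f j) := by
    apply List.ext_getElem <;> simp
  apply hv
  funext j
  refine hLI (List.ofFn v) (by simp) ?_ (v j) (by simp [List.mem_ofFn])
  intro i hi
  rw [hr, key]
  have := congrFun hv0 ⟨i, hi⟩
  simpa [Matrix.vecMul, dotProduct, hM] using this
/-! ### Generic evaluation of the program -/

/-- `k`-th transvectant of coefficient sequences of forms of orders `m` and `n` -/
def tv {A : Type*} [CommRing A] (m n k : ℕ) (a b : ℕ → A) (s : ℕ) : A :=
  if s < m + n - 2 * k + 1 then
    ∑ q ∈ Finset.HasAntidiagonal.antidiagonal (s + k), ((Kc m n k q.1 q.2 : ℤ) : A) * (a q.1 * b q.2)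
  else 0

def step {A : Type*} [CommRing A] (env : List (ℕ → A)) (I : Instr) : List (ℕ → A) :=
  tv I.m I.n I.k (env.getD I.i 0) (env.getD I.j 0) :: env

/-- coefficients of the generic form -/
def form {A : Type*} [CommRing A] (x : Fin 8 → A) (i : ℕ) : A :=
  if h : i < 8 then (Nat.choose 7 i : A) * x ⟨i, h⟩ else 0

def run {A : Type*} [CommRing A] (P : List Instr) (x : Fin 8 → A) : List (ℕ → A) :=
  P.foldl step [form x]

def inv {A : Type*} [CommRing A] (x : Fin 8 → A) (i : ℕ) : A := (run prog x).getD i 0 0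

def mon {A : Type*} [CommRing A] (x : Fin 8 → A) (l : List ℕ) : A := (l.map (inv x)).prod

/-! ### Naturality -/

section natur
variable {A B : Type*} [CommRing A] [CommRing B] (φ : A →+* B)

theorem map_tv (m n k : ℕ) (a b : ℕ → A) (s : ℕ) :
    φ (tv m n k a b s) = tv m n k (fun i => φ (a i)) (fun i => φ (b i)) s := by
  unfold tv
  split_ifs <;> simp [map_sum]

theorem map_env_getD (env : List (ℕ → A)) (i : ℕ) :
    (env.map fun f s => φ (f s)).getD i (0 : ℕ → B) = fun s => φ (env.getD i 0 s) := by
  rw [List.getD_eq_getElem?_getD, List.getD_eq_getElem?_getD, List.getElem?_map]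
  cases env[i]? with
  | none => funext s; simp
  | some f => simp

theorem map_run_aux (P : List Instr) (env : List (ℕ → A)) :
    (P.foldl step env).map (fun f s => φ (f s)) = P.foldl step (env.map fun f s => φ (f s)) := by
  induction P generalizing env with
  | nil => rfl
  | cons I P ih =>
    rw [List.foldl_cons, List.foldl_cons, ih]
    congr 1
    simp only [step, List.map_cons, map_env_getD]
    congr 1
    funext s
    exact map_tv φ _ _ _ _ _ _

theorem map_inv (x : Fin 8 → A) (i : ℕ) : φ (inv x i) = inv (fun c => φ (x c)) i := by
  have h := map_run_aux φ prog [form x]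
  have hf : (fun s => φ (form x s)) = form (fun c => φ (x c)) := by
    funext s; unfold form; split_ifs <;> simp
  rw [List.map_cons, List.map_nil, hf] at h
  unfold inv run
  rw [← h, map_env_getD]

theorem map_mon (x : Fin 8 → A) (l : List ℕ) : φ (mon x l) = mon (fun c => φ (x c)) l := by
  unfold mon
  rw [map_list_prod, List.map_map]
  congr 2
  funext i
  exact map_inv φ x i

end natur

/-! ### Correctness of the packed evaluation -/

def Rel (a : ℕ) (f : ℕ → ZMod PP) : Prop := ∀ i, ((dig QQ a i : ℕ) : ZMod PP) = f i

theorem PP_lt_QQ : PP < QQ := by decide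

theorem dig_pack {α : Type} (E : ℕ) (g : α → ℕ) (l : List α) (hg : ∀ x ∈ l, g x < E) (i : ℕ) :
    dig E (fld (fun x acc => g x + E * acc) 0 l) i = (l.map g).getD i 0 := by
  induction l generalizing i with
  | nil => simp [fld_nil, dig_zero_left]
  | cons x l ih =>
    rw [fld_cons]
    have hx := hg x List.mem_cons_self
    cases i with
    | zero => rw [dig_cons_zero _ hx]; simp
    | succ i =>
      rw [dig_cons_succ _ _ hx, ih (fun y hy => hg y (List.mem_cons_of_mem _ hy))]; simp

noncomputable def evalRow (a b : ℕ) (row : List Ent) : ℕ :=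
  fld (fun t acc => t.c * (dg a t.u * dg b t.v) + acc) 0 row

theorem evalTbl_eq (a b : ℕ) (t : List (List Ent)) :
    evalTbl a b t = fld (fun row acc => evalRow a b row % PP + QQ * acc) 0 t := rfl

theorem Kc_cast (m n k u v : ℕ) :
    (((Kc m n k u v % (PP : ℤ)).toNat : ℕ) : ZMod PP) = ((Kc m n k u v : ℤ) : ZMod PP) := by
  generalize Kc m n k u v = x
  have h : 0 ≤ x % (PP : ℤ) := Int.emod_nonneg _ (by decide)
  have : (((x % (PP : ℤ)).toNat : ℤ) : ZMod PP) = (x : ZMod PP) := by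
    rw [Int.toNat_of_nonneg h, ZMod.intCast_mod]
  rw [← this, Int.cast_natCast]

theorem evalRow_aux (m n k a b : ℕ) (f g : ℕ → ZMod PP) (hf : Rel a f) (hg : Rel b g)
    (L : List (ℕ × ℕ)) :
    ((evalRow a b ((L.filter fun q => Nat.ble q.1 m && Nat.ble q.2 n).map
      fun q => ⟨QQ ^ q.1, QQ ^ q.2, (Kc m n k q.1 q.2 % (PP : ℤ)).toNat⟩) : ℕ) : ZMod PP) =
      (L.map fun q => ((Kc m n k q.1 q.2 : ℤ) : ZMod PP) * (f q.1 * g q.2)).sum := by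
  induction L with
  | nil => simp [evalRow, fld_nil]
  | cons q L ih =>
    rw [List.filter_cons]
    split_ifs with hq
    · rw [List.map_cons, List.map_cons, List.sum_cons, ← ih]
      unfold evalRow
      rw [fld_cons, Nat.cast_add, Nat.cast_mul, Nat.cast_mul, Kc_cast, ← hf, ← hg]
      rfl
    · rw [ih, List.map_cons, List.sum_cons]
      have : Kc m n k q.1 q.2 = 0 := by
        unfold Kc
        rw [if_neg]
        rintro ⟨h1, h2⟩
        apply hq
        rw [Nat.ble_eq_true_of_le h1, Nat.ble_eq_true_of_le h2]; rfl
      simp [this]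

theorem evalRow_eq (m n k s a b : ℕ) (f g : ℕ → ZMod PP) (hf : Rel a f) (hg : Rel b g) :
    ((evalRow a b (tblRow m n k s) : ℕ) : ZMod PP) =
      ∑ q ∈ Finset.HasAntidiagonal.antidiagonal (s + k), ((Kc m n k q.1 q.2 : ℤ) : ZMod PP) * (f q.1 * g q.2) := by
  unfold tblRow
  rw [evalRow_aux m n k a b f g hf hg]
  rfl

theorem evalTbl_rel (m n k a b : ℕ) (f g : ℕ → ZMod PP) (hf : Rel a f) (hg : Rel b g) :
    Rel (evalTbl a b (tblOf m n k)) (tv m n k f g) := by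
  intro i
  rw [evalTbl_eq, dig_pack QQ (fun row => evalRow a b row % PP) _
    (fun _ _ => (Nat.mod_lt _ PP_pos).trans PP_lt_QQ)]
  unfold tv tblOf
  rw [List.getD_eq_getElem?_getD, List.getElem?_map, List.getElem?_map]
  split_ifs with h
  · rw [List.getElem?_range h]
    simp only [Option.map_some, Option.getD_some]
    rw [ZMod.natCast_mod, evalRow_eq m n k i a b f g hf hg]
  · rw [List.getElem?_eq_none (by simpa using h)]
    simp

theorem nth_eq (l : List ℕ) (i : ℕ) : nth l i = l.getD i 0 := by
  induction l generalizing i with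
  | nil => rfl
  | cons x l ih =>
    cases i with
    | zero => rfl
    | succ i => rw [List.getD_cons_succ, ← ih]; rfl

noncomputable def stepN (env : List ℕ) (I : Instr) : List ℕ :=
  evalTbl (nth env I.i) (nth env I.j) (tblOf I.m I.n I.k) :: env

def cmp (I : Instr) : CI := ⟨I.i, I.j, tblOf I.m I.n I.k⟩

theorem fT_eq (t : Ent) (k : Ent → Bool) : fT t k = k t := by
  unfold fT; rw [fN_eq, fN_eq, fN_eq]

theorem compileK_eq (I : Instr) (k : CI → Bool) : compileK I k = k (cmp I) := by
  unfold compileK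
  rw [mapK_eq (f := id) (fun x k => by
    rw [mapK_eq (f := id) (fun x k => fT_eq x k)]; simp)]
  simp [cmp]

theorem runK_eq (P : List Instr) (env : List ℕ) (k : List ℕ → Bool) :
    runK (P.map cmp) env k = k (P.foldl stepN env) := by
  induction P generalizing env with
  | nil => rfl
  | cons I P ih =>
    change fN (nth env I.i) (fun a => fN (nth env I.j) fun b =>
        fN (evalTbl a b (tblOf I.m I.n I.k)) fun t => runK (P.map cmp) (t :: env) k) = _
    rw [fN_eq, fN_eq, fN_eq, ih]
    rfl

def RelEnv (e : List ℕ) (env : List (ℕ → ZMod PP)) : Prop := ∀ i, Rel (e.getD i 0) (env.getD i 0)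

theorem rel_zero : Rel 0 0 := fun i => by simp [dig_zero_left]

theorem relEnv_cons {a : ℕ} {f : ℕ → ZMod PP} {e env} (h : Rel a f) (he : RelEnv e env) :
    RelEnv (a :: e) (f :: env) := by
  intro i
  cases i with
  | zero => exact h
  | succ i => exact he i

theorem run_rel (P : List Instr) (e : List ℕ) (env : List (ℕ → ZMod PP)) (h : RelEnv e env) :
    RelEnv (P.foldl stepN e) (P.foldl step env) := by
  induction P generalizing e env with
  | nil => exact h
  | cons I P ih =>
    apply ih
    apply relEnv_cons _ h
    rw [nth_eq, nth_eq]
    exact evalTbl_rel _ _ _ _ _ _ _ (h _) (h _)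

theorem start_rel (j : ℕ) : Rel (start j) (form fun c => ((pt j c : ℕ) : ZMod PP)) := by
  intro i
  have : start j = fld (fun i acc => Nat.choose 7 i * pt j i % PP + QQ * acc) 0 (List.range 8) :=
    rfl
  rw [this, dig_pack QQ (fun i => Nat.choose 7 i * pt j i % PP) _
    (fun _ _ => (Nat.mod_lt _ PP_pos).trans PP_lt_QQ)]
  rw [List.getD_eq_getElem?_getD, List.getElem?_map]
  unfold form
  split_ifs with h
  · rw [List.getElem?_range h]
    simp only [Option.map_some, Option.getD_some]
    rw [ZMod.natCast_mod, Nat.cast_mul]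
  · rw [List.getElem?_eq_none (by simpa using h)]
    simp

noncomputable def envN (j : ℕ) : List ℕ := prog.foldl stepN [start j]

noncomputable def rowN (mons : List (List ℕ)) (j : ℕ) : ℕ :=
  fld (fun l acc => monN (packInv (envN j)) (l.map (QQ ^ ·)) + EE * acc) 0 mons

theorem fld_map {α β : Type} (f : β → ℕ → ℕ) (b : ℕ) (g : α → β) (l : List α) :
    fld f b (l.map g) = fld (fun x => f (g x)) b l := by
  induction l with
  | nil => rfl
  | cons x l ih => rw [List.map_cons, fld_cons, fld_cons, ih]

theorem rowK_eq (mons : List (List ℕ)) (j : ℕ) (k : ℕ → Bool) :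
    rowK (prog.map cmp) (mons.map fun l => l.map (QQ ^ ·)) j k = k (rowN mons j) := by
  unfold rowK
  rw [fN_eq, runK_eq, fN_eq, fN_eq, fld_map]
  rfl

theorem checkK_eq (mons : List (List ℕ)) (N : ℕ) :
    checkK mons N = elimK N ((List.range N).map (rowN mons)) := by
  unfold checkK
  rw [mapK_eq (f := cmp) compileK_eq, mapK_eq (f := fun l => l.map (QQ ^ ·)) (fun l k => by
    rw [mapK_eq (f := (QQ ^ ·)) (fun x k => fN_eq _ _)]),
    mapK_eq (f := rowN mons) (fun x k => rowK_eq mons x k)]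

theorem monN_le (iv : ℕ) (l : List ℕ) : monN iv l < PP := by
  cases l with
  | nil => exact (by decide : 1 < PP)
  | cons q l => exact Nat.mod_lt _ PP_pos

theorem inv_rel (j i : ℕ) : ((dg (packInv (envN j)) (QQ ^ i) : ℕ) : ZMod PP) =
    inv (fun c => ((pt j c : ℕ) : ZMod PP)) i := by
  have h1 : RelEnv (envN j) (run prog fun c => ((pt j c : ℕ) : ZMod PP)) :=
    run_rel _ _ _ (relEnv_cons (start_rel j) (fun i => by simpa using rel_zero))
  have h2 : dg (packInv (envN j)) (QQ ^ i) = dig QQ ((envN j).getD i 0) 0 := by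
    have := dig_pack QQ (fun e => e % QQ) (envN j) (fun _ _ => Nat.mod_lt _ (by decide)) i
    refine Eq.trans this ?_
    rw [dig_zero, List.getD_eq_getElem?_getD, List.getD_eq_getElem?_getD, List.getElem?_map]
    cases (envN j)[i]? <;> simp
  rw [h2, h1 i 0]
  rfl

theorem monN_rel (j : ℕ) (l : List ℕ) :
    ((monN (packInv (envN j)) (l.map (QQ ^ ·)) : ℕ) : ZMod PP) =
      mon (fun c => ((pt j c : ℕ) : ZMod PP)) l := by
  unfold mon
  induction l with
  | nil => exact Nat.cast_one
  | cons i l ih =>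
    rw [List.map_cons, List.map_cons, List.prod_cons, ← ih, ← inv_rel, ← Nat.cast_mul,
      ← ZMod.natCast_mod (_ * _)]
    rfl

theorem det_mod (mons : List (List ℕ)) (N : ℕ) (hN : N < 1000) (hl : mons.length = N)
    (h : checkK mons N = true) :
    (Matrix.of fun j i : Fin N =>
      mon (fun c => ((pt j c : ℕ) : ZMod PP)) (mons.getD i [])).det ≠ 0 := by
  have hdig : ∀ j i, dig EE (rowN mons j) i =
      (mons.map fun l => monN (packInv (envN j)) (l.map (QQ ^ ·))).getD i 0 := fun j i =>
    dig_pack EE _ _ (fun _ _ => (monN_le _ _).trans PP_lt_EE) i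
  rw [checkK_eq] at h
  refine det_ne_zero_of_elim N hN (rowN mons) ?_ h _ ?_
  · intro j i
    rw [hdig, List.getD_eq_getElem?_getD, List.getElem?_map]
    cases mons[i]? with
    | none => simp
    | some l => simpa using (monN_le _ _).le
  · intro j i
    have hi : (i : ℕ) < mons.length := by rw [hl]; exact i.2
    have e1 : mons.getD i [] = mons[(i : ℕ)] := List.getD_eq_getElem _ _ hi
    have e2 := hdig j i
    rw [List.getD_eq_getElem _ _ (by simpa using hi), List.getElem_map] at e2
    rw [e2, Matrix.of_apply, monN_rel, e1]

open MvPolynomial in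
/-- the certified products are linearly independent -/
theorem mon_linInd (mons : List (List ℕ)) (N : ℕ) (hN : N < 1000) (hl : mons.length = N)
    (h : checkK mons N = true) :
    LinearIndependent ℂ fun i : Fin N =>
      mon (X : Fin 8 → MvPolynomial (Fin 8) ℂ) (mons.getD i []) := by
  have h1 := det_mod mons N hN hl h
  set MZ : Matrix (Fin N) (Fin N) ℤ := Matrix.of fun j i : Fin N =>
      mon (fun c => ((pt j c : ℕ) : ℤ)) (mons.getD i []) with hMZ
  have h2 : MZ.det ≠ 0 := by
    intro h0
    apply h1
    have := (Int.castRingHom (ZMod PP)).map_det MZ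
    rw [h0, map_zero] at this
    rw [this]
    refine congrArg Matrix.det ?_
    refine Matrix.ext fun j i => ?_
    rw [RingHom.mapMatrix_apply, Matrix.map_apply, hMZ, Matrix.of_apply, Matrix.of_apply, map_mon]
    have e : (fun c : Fin 8 => ((pt j c : ℕ) : ZMod PP)) =
        fun c : Fin 8 => (Int.castRingHom (ZMod PP)) ((pt j c : ℕ) : ℤ) := by
      funext c; rw [eq_intCast, Int.cast_natCast]
    rw [e]
  have h3 : ((Int.castRingHom ℂ).mapMatrix MZ).det ≠ 0 := by
    rw [← RingHom.map_det]
    simpa using h2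
  have h4 := Matrix.linearIndependent_cols_of_det_ne_zero h3
  let L : MvPolynomial (Fin 8) ℂ →ₗ[ℂ] (Fin N → ℂ) :=
    LinearMap.pi fun j => (aeval (fun c : Fin 8 => ((pt j c : ℕ) : ℂ))).toLinearMap
  refine LinearIndependent.of_comp L ?_
  have e0 : (L ∘ fun i : Fin N => mon (X : Fin 8 → MvPolynomial (Fin 8) ℂ) (mons.getD i [])) =
      ((Int.castRingHom ℂ).mapMatrix MZ).col := by
    funext i j
    have e1 := map_mon (aeval (R := ℂ) (fun c : Fin 8 => ((pt j c : ℕ) : ℂ))).toRingHom X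
      (mons.getD i [])
    refine Eq.trans e1 ?_
    rw [Matrix.col_apply, RingHom.mapMatrix_apply, Matrix.map_apply, hMZ, Matrix.of_apply, map_mon]
    have e : (fun c : Fin 8 =>
          (aeval (R := ℂ) (fun c : Fin 8 => ((pt j c : ℕ) : ℂ))).toRingHom (X c)) =
        fun c : Fin 8 => (Int.castRingHom ℂ) ((pt j c : ℕ) : ℤ) := by
      funext c
      rw [eq_intCast, Int.cast_natCast]
      exact aeval_X _ _
    rw [e]
  rw [e0]
  exact h4
/-! ### Covariants -/

structure IsCov (m d : ℕ) (f : ℕ → MvPolynomial (Fin 8) ℂ) : Prop where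
  zero : ∀ i, m < i → f i = 0
  d1z : D1 (f 0) = 0
  d1s : ∀ i, D1 (f (i + 1)) = ((m : ℤ) - i) • f i
  d2 : ∀ i, D2 (f i) = ((i : ℤ) + 1) • f (i + 1)
  hom : ∀ i, (f i).IsHomogeneous d

/-- the identities which make the transvectant coefficients equivariant -/
def OkK (m n k : ℕ) : Prop :=
  2 * k ≤ m + n ∧ ∀ u < m + 1, ∀ v < n + 1,
    ((m : ℤ) - u) * Kc m n k (u + 1) v + ((n : ℤ) - v) * Kc m n k u (v + 1) =
      ((m : ℤ) + n - k - u - v) * Kc m n k u v ∧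
    (u : ℤ) * Kc m n k (u - 1) v + (v : ℤ) * Kc m n k u (v - 1) =
      ((u : ℤ) + v - k) * Kc m n k u v ∧
    (u + v < k → Kc m n k u v = 0) ∧ (m + n - k < u + v → Kc m n k u v = 0)

instance (m n k : ℕ) : Decidable (OkK m n k) := by unfold OkK; infer_instance

section cov
variable {m n k d e : ℕ} {a b : ℕ → MvPolynomial (Fin 8) ℂ}

noncomputable def SK (m n k : ℕ) (a b : ℕ → MvPolynomial (Fin 8) ℂ) (w : ℕ) :
    MvPolynomial (Fin 8) ℂ :=
  ∑ q ∈ Finset.HasAntidiagonal.antidiagonal w, Kc m n k q.1 q.2 • (a q.1 * b q.2)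

theorem SK_zero (h : OkK m n k) (ha : IsCov m d a) (hb : IsCov n e b) (w : ℕ)
    (hw : w < k ∨ m + n - k < w) : SK m n k a b w = 0 := by
  refine Finset.sum_eq_zero fun q hq => ?_
  rw [Finset.HasAntidiagonal.mem_antidiagonal] at hq
  by_cases h1 : m < q.1
  · rw [ha.zero _ h1]; simp
  by_cases h2 : n < q.2
  · rw [hb.zero _ h2]; simp
  obtain ⟨-, -, h3, h4⟩ := h.2 q.1 (by omega) q.2 (by omega)
  rcases hw with hw | hw
  · rw [h3 (by omega), zero_smul]
  · rw [h4 (by omega), zero_smul]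

theorem D1_SK_zero (ha : IsCov m d a) (hb : IsCov n e b) : D1 (SK m n k a b 0) = 0 := by
  simp [SK, ha.d1z, hb.d1z]

theorem D1_SK (h : OkK m n k) (ha : IsCov m d a) (hb : IsCov n e b) (w : ℕ) :
    D1 (SK m n k a b (w + 1)) = ((m : ℤ) + n - k - w) • SK m n k a b w := by
  have e1 : D1 (SK m n k a b (w + 1)) =
      ∑ q ∈ Finset.HasAntidiagonal.antidiagonal (w + 1),
        Kc m n k q.1 q.2 • (D1 (a q.1) * b q.2) +
      ∑ q ∈ Finset.HasAntidiagonal.antidiagonal (w + 1),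
        Kc m n k q.1 q.2 • (a q.1 * D1 (b q.2)) := by
    rw [← Finset.sum_add_distrib, SK, map_sum]
    refine Finset.sum_congr rfl fun q _ => ?_
    rw [map_zsmul, Derivation.leibniz, ← smul_add, smul_eq_mul, smul_eq_mul]
    ring_nf
  rw [e1, Finset.Nat.sum_antidiagonal_succ, Finset.Nat.sum_antidiagonal_succ', ha.d1z, hb.d1z,
    zero_mul, mul_zero, smul_zero, smul_zero, zero_add, zero_add, ← Finset.sum_add_distrib, SK,
    Finset.smul_sum]
  refine Finset.sum_congr rfl fun q hq => ?_
  rw [Finset.HasAntidiagonal.mem_antidiagonal] at hq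
  rw [ha.d1s, hb.d1s]
  by_cases h1 : m < q.1
  · rw [ha.zero _ h1]; simp
  by_cases h2 : n < q.2
  · rw [hb.zero _ h2]; simp
  obtain ⟨h3, -⟩ := h.2 q.1 (by omega) q.2 (by omega)
  rw [smul_mul_assoc, mul_smul_comm, smul_smul, smul_smul, smul_smul, ← add_smul, ← hq]
  congr 1
  push_cast
  linarith

theorem D2_SK (h : OkK m n k) (ha : IsCov m d a) (hb : IsCov n e b) (w : ℕ) :
    D2 (SK m n k a b w) = ((w : ℤ) + 1 - k) • SK m n k a b (w + 1) := by
  have e1 : D2 (SK m n k a b w) =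
      ∑ q ∈ Finset.HasAntidiagonal.antidiagonal (w + 1),
        ((q.1 : ℤ) * Kc m n k (q.1 - 1) q.2) • (a q.1 * b q.2) +
      ∑ q ∈ Finset.HasAntidiagonal.antidiagonal (w + 1),
        ((q.2 : ℤ) * Kc m n k q.1 (q.2 - 1)) • (a q.1 * b q.2) := by
    rw [Finset.Nat.sum_antidiagonal_succ, Finset.Nat.sum_antidiagonal_succ', Nat.cast_zero,
      zero_mul, zero_mul, zero_smul, zero_smul, zero_add, zero_add, ← Finset.sum_add_distrib, SK,
      map_sum]
    refine Finset.sum_congr rfl fun q _ => ?_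
    rw [map_zsmul, Derivation.leibniz, smul_eq_mul, smul_eq_mul, ha.d2, hb.d2,
      Nat.add_sub_cancel, Nat.add_sub_cancel, Nat.cast_add, Nat.cast_add, Nat.cast_one,
      mul_smul_comm, mul_smul_comm, smul_add, smul_smul, smul_smul, mul_comm (b q.2), add_comm,
      mul_comm (Kc m n k q.1 q.2), mul_comm (Kc m n k q.1 q.2)]
  rw [e1, ← Finset.sum_add_distrib, SK, Finset.smul_sum]
  refine Finset.sum_congr rfl fun q hq => ?_
  rw [Finset.HasAntidiagonal.mem_antidiagonal] at hq
  by_cases h1 : m < q.1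
  · rw [ha.zero _ h1]; simp
  by_cases h2 : n < q.2
  · rw [hb.zero _ h2]; simp
  obtain ⟨-, h3, -⟩ := h.2 q.1 (by omega) q.2 (by omega)
  rw [← add_smul, smul_smul, h3]
  congr 2
  have : (q.1 : ℤ) + q.2 = w + 1 := by exact_mod_cast hq
  rw [this]

theorem tv_eq_SK (h : OkK m n k) (ha : IsCov m d a) (hb : IsCov n e b) (s : ℕ) :
    tv m n k a b s = SK m n k a b (s + k) := by
  have h0 := h.1
  unfold tv
  split_ifs with hs
  · simp only [SK, zsmul_eq_mul]
  · rw [SK_zero h ha hb _ (Or.inr (by omega))]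

theorem isCov_tv (h : OkK m n k) (ha : IsCov m d a) (hb : IsCov n e b) :
    IsCov (m + n - 2 * k) (d + e) (tv m n k a b) := by
  have h0 := h.1
  constructor
  · intro i hi
    unfold tv
    rw [if_neg (by omega)]
  · rw [tv_eq_SK h ha hb, zero_add]
    cases hk : k with
    | zero => exact D1_SK_zero ha hb
    | succ k' =>
      rw [hk] at h
      rw [D1_SK h ha hb, SK_zero h ha hb _ (Or.inl (by omega)), smul_zero]
  · intro i
    rw [tv_eq_SK h ha hb, tv_eq_SK h ha hb, add_right_comm, D1_SK h ha hb]
    congr 1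
    push_cast [Nat.cast_sub h0]
    ring
  · intro i
    rw [tv_eq_SK h ha hb, tv_eq_SK h ha hb, add_right_comm, D2_SK h ha hb]
    congr 1
    push_cast
    ring
  · intro i
    rw [tv_eq_SK h ha hb]
    refine IsHomogeneous.sum _ _ _ fun q _ => ?_
    rw [zsmul_eq_mul]
    have h1 : ((Kc m n k q.1 q.2 : ℤ) : MvPolynomial (Fin 8) ℂ).IsHomogeneous 0 := by
      rw [← map_intCast (C : ℂ →+* MvPolynomial (Fin 8) ℂ)]
      exact isHomogeneous_C _ _
    simpa using h1.mul ((ha.hom q.1).mul (hb.hom q.2))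

end cov

theorem D1_X (i : ℕ) (h : i + 1 < 8) : D1 (X ⟨i + 1, h⟩) = (i + 1) • X ⟨i, by omega⟩ := by
  have : i < 7 := by omega
  unfold D1
  rw [mkDerivation_X]
  interval_cases i <;> simp

theorem D2_X (i : ℕ) (h : i < 8) : D2 (X ⟨i, h⟩) =
    if h' : i + 1 < 8 then (7 - i) • X ⟨i + 1, h'⟩ else 0 := by
  unfold D2
  rw [mkDerivation_X]
  interval_cases i <;> simp

theorem form_lt (i : ℕ) (hi : i < 8) : form (X : Fin 8 → MvPolynomial (Fin 8) ℂ) i =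
    Nat.choose 7 i • X ⟨i, hi⟩ := by
  unfold form
  rw [dif_pos hi, nsmul_eq_mul]

theorem form_ge (i : ℕ) (hi : ¬ i < 8) : form (X : Fin 8 → MvPolynomial (Fin 8) ℂ) i = 0 := by
  unfold form
  rw [dif_neg hi]

theorem isCov_form : IsCov 7 1 (form (X : Fin 8 → MvPolynomial (Fin 8) ℂ)) := by
  constructor
  · intro i hi
    unfold form
    rw [dif_neg (by omega)]
  · simp [form, D1]
  · intro i
    by_cases hi : i + 1 < 8
    · rw [form_lt _ hi, form_lt i (by omega), map_nsmul, D1_X, smul_smul,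
        Nat.choose_succ_right_eq, mul_comm, mul_smul, ← natCast_zsmul _ (7 - i),
        Nat.cast_sub (by omega)]
    · rw [form_ge (i + 1) hi, map_zero]
      by_cases h7 : i = 7
      · subst h7; simp
      · rw [form_ge i (by omega), smul_zero]
  · intro i
    by_cases hi : i < 8
    · rw [form_lt _ hi, map_nsmul, D2_X]
      split_ifs with h'
      · rw [form_lt _ h', smul_smul, ← Nat.choose_succ_right_eq, mul_comm, mul_smul,
          ← natCast_zsmul _ (i + 1), Nat.cast_add, Nat.cast_one]
      · rw [form_ge _ h', smul_zero, smul_zero]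
    · rw [form_ge i hi, form_ge (i + 1) (by omega), map_zero, smul_zero]
  · intro i
    unfold form
    split_ifs with h
    · have h1 : ((Nat.choose 7 i : ℕ) : MvPolynomial (Fin 8) ℂ).IsHomogeneous 0 := by
        rw [← map_natCast (C : ℂ →+* MvPolynomial (Fin 8) ℂ)]
        exact isHomogeneous_C _ _
      simpa using h1.mul (isHomogeneous_X ℂ (⟨i, h⟩ : Fin 8))
    · exact isHomogeneous_zero _ _ _

/-! ### Signatures: (degree, order) of all entries of the environment -/

def sigStep (sg : List (ℕ × ℕ)) (I : Instr) : List (ℕ × ℕ) :=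
  ((sg.getD I.i (0, 0)).1 + (sg.getD I.j (0, 0)).1, I.m + I.n - 2 * I.k) :: sg

def chk : List Instr → List (ℕ × ℕ) → Bool
  | [], _ => true
  | I :: P, sg => decide (I.i < sg.length ∧ I.j < sg.length ∧ (sg.getD I.i (0, 0)).2 = I.m ∧
      (sg.getD I.j (0, 0)).2 = I.n ∧ OkK I.m I.n I.k) && chk P (sigStep sg I)

def CovEnv (env : List (ℕ → MvPolynomial (Fin 8) ℂ)) (sg : List (ℕ × ℕ)) : Prop :=
  ∀ i < sg.length, IsCov (sg.getD i (0, 0)).2 (sg.getD i (0, 0)).1 (env.getD i 0)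

theorem cov_run (P : List Instr) (sg : List (ℕ × ℕ)) (env : List (ℕ → MvPolynomial (Fin 8) ℂ))
    (h : chk P sg = true) (he : CovEnv env sg) :
    CovEnv (P.foldl step env) (P.foldl sigStep sg) := by
  induction P generalizing sg env with
  | nil => exact he
  | cons I P ih =>
    rw [chk, Bool.and_eq_true, decide_eq_true_eq] at h
    obtain ⟨⟨h1, h2, h3, h4, h5⟩, h6⟩ := h
    refine ih _ _ h6 ?_
    intro i hi
    cases i with
    | zero =>
      have ha := he _ h1
      have hb := he _ h2
      rw [h3] at ha
      rw [h4] at hb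
      exact isCov_tv h5 ha hb
    | succ i => exact he i (by simpa [sigStep] using hi)

def sig : List (ℕ × ℕ) := prog.foldl sigStep [(1, 7)]

set_option maxRecDepth 100000 in
theorem chk_prog : chk prog [(1, 7)] = true := by decide +kernel

def dgs : List ℕ := [20, 16, 16, 12, 12, 12, 12, 12, 12, 8, 8, 8, 4]

theorem sig_dgs : ∀ i < 13, i < sig.length ∧ sig.getD i (0, 0) = (dgs.getD i 0, 0) := by
  decide +kernel

def IsInv (d : ℕ) (f : MvPolynomial (Fin 8) ℂ) : Prop := f.IsHomogeneous d ∧ D1 f = 0 ∧ D2 f = 0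

theorem isInv_inv (i : ℕ) (hi : i < 13) :
    IsInv (dgs.getD i 0) (inv (X : Fin 8 → MvPolynomial (Fin 8) ℂ) i) := by
  have h := cov_run prog [(1, 7)] [form X] chk_prog (by
    intro i hi
    have : i = 0 := by simpa using hi
    subst this
    exact isCov_form)
  obtain ⟨h1, h2⟩ := sig_dgs i hi
  have h3 := h i h1
  change IsCov (sig.getD i (0, 0)).2 (sig.getD i (0, 0)).1 _ at h3
  rw [h2] at h3
  refine ⟨h3.hom 0, h3.d1z, ?_⟩
  refine (h3.d2 0).trans ?_
  rw [h3.zero _ (by norm_num), smul_zero]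

theorem IsInv.mul {d e : ℕ} {f g : MvPolynomial (Fin 8) ℂ} (hf : IsInv d f) (hg : IsInv e g) :
    IsInv (d + e) (f * g) :=
  ⟨hf.1.mul hg.1, by rw [Derivation.leibniz, hf.2.1, hg.2.1]; simp,
    by rw [Derivation.leibniz, hf.2.2, hg.2.2]; simp⟩

def mdeg (l : List ℕ) : ℕ := (l.map fun i => dgs.getD i 0).sum

theorem isInv_mon (l : List ℕ) (hl : ∀ i ∈ l, i < 13) :
    IsInv (mdeg l) (mon (X : Fin 8 → MvPolynomial (Fin 8) ℂ) l) := by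
  induction l with
  | nil => exact ⟨isHomogeneous_one _ _, by simp [mon], by simp [mon]⟩
  | cons i l ih =>
    have h1 := (isInv_inv i (hl i List.mem_cons_self)).mul
      (ih fun j hj => hl j (List.mem_cons_of_mem _ hj))
    unfold mdeg mon at *
    rw [List.map_cons, List.map_cons, List.sum_cons, List.prod_cons]
    exact h1

def okMon (n : ℕ) : List ℕ → Bool
  | [] => false
  | i :: l => decide (i < 13 ∧ (∀ j ∈ l, j < 13) ∧ 0 < dgs.getD i 0 ∧ 0 < mdeg l ∧
      dgs.getD i 0 + mdeg l = n)

theorem mon_mem_W (n : ℕ) (l : List ℕ) (h : okMon n l = true) :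
    mon (X : Fin 8 → MvPolynomial (Fin 8) ℂ) l ∈ W n := by
  cases l with
  | nil => exact absurd h (by simp [okMon])
  | cons i l =>
    rw [okMon, decide_eq_true_eq] at h
    obtain ⟨h1, h2, h3, h4, h5⟩ := h
    have hg := isInv_inv i h1
    have hh := isInv_mon l h2
    apply Submodule.subset_span
    refine ⟨inv X i, mon X l, _, _, h3, h4, h5, hg.1, hh.1, hg.2.1, hg.2.2, hh.2.1, hh.2.2, ?_⟩
    unfold mon
    rw [List.map_cons, List.prod_cons]

theorem W_le_V (n : ℕ) : W n ≤ V n := by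
  unfold W
  rw [Submodule.span_le]
  rintro p ⟨g, h, a, b, -, -, rfl, hg, hh, h1, h2, h3, h4, rfl⟩
  obtain ⟨k1, k2, k3⟩ := IsInv.mul ⟨hg, h1, h2⟩ ⟨hh, h3, h4⟩
  exact ⟨⟨k1, k2⟩, k3⟩

theorem ok24 : ∀ l ∈ mons24, okMon 24 l = true := by decide +kernel
theorem ok28 : ∀ l ∈ mons28, okMon 28 l = true := by decide +kernel
/-! ### Counting exponent vectors -/

noncomputable def expA : (k n w : ℕ) → Finset (Fin k → ℕ)
  | 0, 0, 0 => {0}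
  | 0, 0, _ + 1 => ∅
  | 0, _ + 1, _ => ∅
  | _ + 1, 0, 0 => {0}
  | _ + 1, 0, _ + 1 => ∅
  | k + 1, n + 1, w =>
    (expA k (n + 1) w).image (fun f => Fin.snoc (α := fun _ => ℕ) f 0) ∪
      if k ≤ w then (expA (k + 1) n (w - k)).image (fun f => f + Pi.single (Fin.last k) 1) else ∅

theorem sum_inc (k : ℕ) (f : Fin (k + 1) → ℕ) :
    ∑ i, (f + Pi.single (Fin.last k) 1 : Fin (k + 1) → ℕ) i = ∑ i, f i + 1 := by
  simp only [Pi.add_apply, Finset.sum_add_distrib, Pi.single_apply]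
  simp

theorem wt_inc (k : ℕ) (f : Fin (k + 1) → ℕ) :
    ∑ i : Fin (k + 1), (i : ℕ) * (f + Pi.single (Fin.last k) 1 : Fin (k + 1) → ℕ) i =
      ∑ i : Fin (k + 1), (i : ℕ) * f i + k := by
  simp only [Pi.add_apply, mul_add, Finset.sum_add_distrib, Pi.single_apply]
  simp

theorem mem_expA (k n w : ℕ) (m : Fin k → ℕ) :
    m ∈ expA k n w ↔ ∑ i, m i = n ∧ ∑ i : Fin k, (i : ℕ) * m i = w := by
  fun_induction expA k n w with
  | case1 => simp [Subsingleton.elim m 0]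
  | case2 => simp
  | case3 => simp
  | case4 k =>
    rw [Finset.mem_singleton]
    constructor
    · rintro rfl; simp
    · rintro ⟨h, -⟩
      funext i
      exact (Finset.sum_eq_zero_iff.1 h) i (Finset.mem_univ i)
  | case5 k w =>
    simp only [Finset.notMem_empty, false_iff, not_and]
    intro h
    have : ∀ i, m i = 0 := fun i => (Finset.sum_eq_zero_iff.1 h) i (Finset.mem_univ i)
    simp [this]
  | case6 k n w ih1 ih2 =>
    rw [Finset.mem_union, Finset.mem_image]
    constructor
    · rintro (⟨f, hf, rfl⟩ | h)
      · rw [ih1] at hf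
        rw [Fin.sum_univ_castSucc, Fin.sum_univ_castSucc]
        simpa using hf
      · split_ifs at h with hk
        · rw [Finset.mem_image] at h
          obtain ⟨f, hf, rfl⟩ := h
          rw [ih2] at hf
          obtain ⟨h1, h2⟩ := hf
          rw [sum_inc, wt_inc]
          omega
        · simp at h
    · rintro ⟨h1, h2⟩
      by_cases h0 : m (Fin.last k) = 0
      · left
        refine ⟨Fin.init m, ?_, ?_⟩
        · rw [ih1]
          rw [Fin.sum_univ_castSucc] at h1 h2
          rw [h0] at h1 h2
          exact ⟨by simpa [Fin.init] using h1, by simpa [Fin.init] using h2⟩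
        · conv_rhs => rw [← Fin.snoc_init_self m]
          rw [h0]
      · right
        have hm : m = (m - Pi.single (Fin.last k) 1) + Pi.single (Fin.last k) 1 := by
          funext i
          by_cases hi : i = Fin.last k
          · subst hi; simp; omega
          · simp [hi]
        generalize m - Pi.single (Fin.last k) 1 = f at hm
        subst hm
        rw [sum_inc] at h1
        rw [wt_inc] at h2
        rw [if_pos (by omega), Finset.mem_image]
        exact ⟨f, by rw [ih2]; omega, rfl⟩

noncomputable def gG : (k n : ℕ) → Polynomial ℕ
  | 0, 0 => 1
  | 0, _ + 1 => 0
  | _ + 1, 0 => 1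
  | k + 1, n + 1 => gG k (n + 1) + Polynomial.X ^ k * gG (k + 1) n

theorem coeff_gG (k n w : ℕ) : (gG k n).coeff w = (expA k n w).card := by
  fun_induction expA k n w with
  | case1 => simp [gG]
  | case2 => simp [gG, Polynomial.coeff_one]
  | case3 => simp [gG]
  | case4 => simp [gG]
  | case5 => simp [gG, Polynomial.coeff_one]
  | case6 k n w ih1 ih2 =>
    rw [gG, Polynomial.coeff_add, Polynomial.coeff_X_pow_mul', Finset.card_union_of_disjoint]
    · congr 1
      · rw [ih1, Finset.card_image_of_injective]
        intro f g h
        have := congrArg (Fin.init (α := fun _ => ℕ)) h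
        simpa using this
      · split_ifs with hk
        · rw [ih2, Finset.card_image_of_injective _ (add_left_injective _)]
        · simp
    · rw [Finset.disjoint_left]
      intro m h1 h2
      rw [Finset.mem_image] at h1
      obtain ⟨f, -, rfl⟩ := h1
      split_ifs at h2
      · rw [Finset.mem_image] at h2
        obtain ⟨g, -, hg⟩ := h2
        have := congrFun hg (Fin.last k)
        simp at this
      · simp at h2

theorem coeff_gG_le (k n w : ℕ) : (gG k n).coeff w ≤ 2 ^ (k + n) := by
  fun_induction gG k n generalizing w with
  | case1 => rw [Polynomial.coeff_one]; split_ifs <;> simp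
  | case2 => simp
  | case3 k =>
    rw [Polynomial.coeff_one]
    split_ifs
    · exact Nat.one_le_two_pow
    · simp
  | case4 k n ih1 ih2 =>
    rw [Polynomial.coeff_add, Polynomial.coeff_X_pow_mul']
    have e : 2 ^ (k + 1 + (n + 1)) = 2 ^ (k + (n + 1)) + 2 ^ (k + 1 + n) := by
      rw [show k + 1 + (n + 1) = (k + 1 + n) + 1 by ring, show k + (n + 1) = k + 1 + n by ring]
      ring
    rw [e]
    refine Nat.add_le_add (ih1 w) ?_
    split_ifs
    · exact ih2 _
    · exact Nat.zero_le _

theorem dig_eval (p : Polynomial ℕ) (h : ∀ w, p.coeff w < EE) (w : ℕ) :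
    dig EE (p.eval EE) w = p.coeff w := by
  induction w generalizing p with
  | zero =>
    conv_lhs => rw [← Polynomial.divX_mul_X_add p]
    rw [Polynomial.eval_add, Polynomial.eval_mul, Polynomial.eval_X, Polynomial.eval_C, add_comm,
      mul_comm, dig_cons_zero _ (h 0)]
  | succ w ih =>
    conv_lhs => rw [← Polynomial.divX_mul_X_add p]
    rw [Polynomial.eval_add, Polynomial.eval_mul, Polynomial.eval_X, Polynomial.eval_C, add_comm,
      mul_comm, dig_cons_succ _ _ (h 0), ih _ (fun w => by rw [Polynomial.coeff_divX]; exact h _),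
      Polynomial.coeff_divX]

noncomputable def qN (k n : ℕ) : ℕ := (gG k n).eval EE

noncomputable def scanK (p : ℕ) (l : List ℕ) : ℕ → (List ℕ → Bool) → Bool :=
  List.rec (motive := fun _ => ℕ → (List ℕ → Bool) → Bool) (fun _ k => k [])
    (fun x _ ih acc k => fN (Nat.add x (Nat.mul p acc)) fun y => ih y fun ys => k (y :: ys)) l

theorem scanK_eq (k n N : ℕ) (c : List ℕ → Bool) :
    scanK (EE ^ k) ((List.range' (n + 1) N).map (qN k)) (qN (k + 1) n) c =
      c ((List.range' (n + 1) N).map (qN (k + 1))) := by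
  induction N generalizing n c with
  | zero => rfl
  | succ N ih =>
    rw [List.range'_succ, List.map_cons, List.map_cons]
    change fN (qN k (n + 1) + EE ^ k * qN (k + 1) n) (fun y =>
      scanK (EE ^ k) ((List.range' (n + 1 + 1) N).map (qN k)) y fun ys => c (y :: ys)) = _
    have : qN k (n + 1) + EE ^ k * qN (k + 1) n = qN (k + 1) (n + 1) := by
      simp [qN, gG, Polynomial.eval_add, Polynomial.eval_mul]
    rw [fN_eq, this, ih]

theorem qN_zero (k : ℕ) : qN k 0 = 1 := by
  cases k <;> simp [qN, gG]

theorem scanK_row (k N : ℕ) (c : List ℕ → Bool) :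
    scanK (EE ^ k) ((List.range (N + 1)).map (qN k)) 0 c =
      c ((List.range (N + 1)).map (qN (k + 1))) := by
  rw [List.range_eq_range', List.range'_succ, List.map_cons, List.map_cons]
  change fN (qN k 0 + EE ^ k * 0) (fun y =>
      scanK (EE ^ k) ((List.range' (0 + 1) N).map (qN k)) y fun ys => c (y :: ys)) = _
  have e : qN k 0 = qN (k + 1) 0 := by rw [qN_zero, qN_zero]
  rw [fN_eq, mul_zero, add_zero, e, scanK_eq]

noncomputable def cntK (N w d : ℕ) : Bool :=
  scanK (EE ^ 0) (1 :: List.replicate N 0) 0 fun r => scanK (EE ^ 1) r 0 fun r =>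
  scanK (EE ^ 2) r 0 fun r => scanK (EE ^ 3) r 0 fun r =>
  scanK (EE ^ 4) r 0 fun r => scanK (EE ^ 5) r 0 fun r =>
  scanK (EE ^ 6) r 0 fun r => scanK (EE ^ 7) r 0 fun r =>
  fN (nth r N) fun x => Nat.beq (dig EE x (w + 1)) (dig EE x w + d)

theorem cntK_spec (N w d : ℕ) (hN : N < 30) (h : cntK N w d = true) :
    (expA 8 N (w + 1)).card = (expA 8 N w).card + d := by
  have h0 : 1 :: List.replicate N 0 = (List.range (N + 1)).map (qN 0) := by
    rw [List.range_eq_range', List.range'_succ, List.map_cons, qN_zero]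
    congr 1
    symm
    rw [List.eq_replicate_iff]
    refine ⟨by simp, ?_⟩
    intro b hb
    rw [List.mem_map] at hb
    obtain ⟨a, ha, rfl⟩ := hb
    rw [List.mem_range'] at ha
    obtain ⟨i, -, rfl⟩ := ha
    rw [show 0 + 1 + 1 * i = i + 1 by ring]
    simp [qN, gG]
  unfold cntK at h
  rw [h0, scanK_row, scanK_row, scanK_row, scanK_row, scanK_row, scanK_row, scanK_row, scanK_row,
    fN_eq, nth_eq, List.getD_eq_getElem _ _ (by simp), List.getElem_map, List.getElem_range] at h
  have hb : ∀ w, (gG 8 N).coeff w < EE := fun w => by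
    refine (coeff_gG_le 8 N w).trans_lt ?_
    calc 2 ^ (8 + N) ≤ 2 ^ 38 := Nat.pow_le_pow_right (by norm_num) (by omega)
      _ < EE := by decide +kernel
  have := Nat.eq_of_beq_eq_true h
  rw [qN, dig_eval _ hb, dig_eval _ hb, coeff_gG, coeff_gG] at this
  exact this

theorem cnt24 : cntK 24 83 62 = true := by decide +kernel
theorem cnt28 : cntK 28 97 97 = true := by decide +kernel
/-! ### The upper bound for the dimension of the space of invariants -/

noncomputable def diagD (c : Fin 8 → ℂ) :
    Derivation ℂ (MvPolynomial (Fin 8) ℂ) (MvPolynomial (Fin 8) ℂ) :=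
  mkDerivation ℂ fun i => c i • X i

theorem diagD_monomial (c : Fin 8 → ℂ) (s : Fin 8 →₀ ℕ) (r : ℂ) :
    diagD c (monomial s r) = (∑ i, c i * s i) • monomial s r := by
  rw [diagD, mkDerivation_monomial, Finsupp.sum_fintype _ _ (by simp), Finset.smul_sum,
    Finset.sum_smul]
  refine Finset.sum_congr rfl fun i _ => ?_
  by_cases h : s i = 0
  · simp [h]
  · have : s - Finsupp.single i 1 + Finsupp.single i 1 = s := by
      apply tsub_add_cancel_of_le
      rw [Finsupp.single_le_iff]
      omega
    rw [smul_eq_mul, mul_smul_comm, X, monomial_mul, this, mul_one, smul_monomial, smul_monomial,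
      smul_monomial]
    congr 1
    simp only [smul_eq_mul]
    ring

theorem coeff_diagD (c : Fin 8 → ℂ) (f : MvPolynomial (Fin 8) ℂ) (m : Fin 8 →₀ ℕ) :
    coeff m (diagD c f) = (∑ i, c i * m i) * coeff m f := by
  induction f using MvPolynomial.induction_on' with
  | monomial s r =>
    rw [diagD_monomial, coeff_smul, coeff_monomial, smul_eq_mul]
    split_ifs with h
    · rw [h]
    · simp
  | add p q hp hq => rw [map_add, coeff_add, hp, hq, coeff_add, mul_add]

noncomputable def Eu := diagD fun _ => 1
noncomputable def Tw := diagD fun i => ((i : ℕ) : ℂ)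

theorem diagD_X (c : Fin 8 → ℂ) (i : Fin 8) : diagD c (X i) = c i • X i := mkDerivation_X _ _ _

theorem D1_X0 (h : 0 < 8) : D1 (X ⟨0, h⟩) = 0 := by
  unfold D1
  rw [mkDerivation_X]
  rfl

theorem D1_Xs (i : ℕ) (h : i + 1 < 8) :
    D1 (X ⟨i + 1, h⟩) = ((i : ℂ) + 1) • X ⟨i, by omega⟩ := by
  rw [D1_X, ← Nat.cast_smul_eq_nsmul ℂ]
  push_cast
  rfl

theorem D2_Xs (i : ℕ) (h : i < 8) (h' : i + 1 < 8) :
    D2 (X ⟨i, h⟩) = ((7 : ℂ) - i) • X ⟨i + 1, h'⟩ := by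
  rw [D2_X, dif_pos h', ← Nat.cast_smul_eq_nsmul ℂ, Nat.cast_sub (by omega)]
  rfl

theorem D2_X7 (i : ℕ) (h : i < 8) (h' : ¬ i + 1 < 8) : D2 (X ⟨i, h⟩) = 0 := by
  rw [D2_X, dif_neg h']

theorem comm_d1 (c : Fin 8 → ℂ) (t : ℂ) (hc : ∀ i (h : i + 1 < 8), c ⟨i, by omega⟩ -
    c ⟨i + 1, h⟩ = t) (f : MvPolynomial (Fin 8) ℂ) :
    diagD c (D1 f) = D1 (diagD c f) + t • D1 f := by
  have : ⁅diagD c, D1⁆ = t • D1 := by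
    apply derivation_ext
    rintro ⟨i, h⟩
    rw [Derivation.commutator_apply, Derivation.smul_apply, diagD_X, Derivation.map_smul]
    cases i with
    | zero => rw [D1_X0]; simp
    | succ i =>
      rw [D1_Xs, Derivation.map_smul, diagD_X, ← hc i h]
      module
  have h2 := congrArg (fun D => D f) this
  simp only [Derivation.commutator_apply, Derivation.smul_apply] at h2
  rw [← h2]
  ring

theorem comm_d2 (c : Fin 8 → ℂ) (t : ℂ) (hc : ∀ i (h : i + 1 < 8), c ⟨i + 1, h⟩ -
    c ⟨i, by omega⟩ = t) (f : MvPolynomial (Fin 8) ℂ) :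
    diagD c (D2 f) = D2 (diagD c f) + t • D2 f := by
  have : ⁅diagD c, D2⁆ = t • D2 := by
    apply derivation_ext
    rintro ⟨i, h⟩
    rw [Derivation.commutator_apply, Derivation.smul_apply, diagD_X, Derivation.map_smul]
    by_cases h' : i + 1 < 8
    · rw [D2_Xs i h h', Derivation.map_smul, diagD_X, ← hc i h']
      module
    · rw [D2_X7 i h h']; simp
  have h2 := congrArg (fun D => D f) this
  simp only [Derivation.commutator_apply, Derivation.smul_apply] at h2
  rw [← h2]
  ring

theorem comm_12 (f : MvPolynomial (Fin 8) ℂ) :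
    D1 (D2 f) = D2 (D1 f) + ((7 : ℂ) • Eu f - (2 : ℂ) • Tw f) := by
  have : ⁅D1, D2⁆ = (7 : ℂ) • Eu - (2 : ℂ) • Tw := by
    apply derivation_ext
    rintro ⟨i, h⟩
    rw [Derivation.commutator_apply, Derivation.sub_apply, Derivation.smul_apply,
      Derivation.smul_apply, Eu, Tw, diagD_X, diagD_X]
    by_cases h' : i + 1 < 8
    · rw [D2_Xs i h h', Derivation.map_smul, D1_Xs]
      cases i with
      | zero => rw [D1_X0]; simp
      | succ i =>
        rw [D1_Xs, Derivation.map_smul, D2_Xs _ _ h]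
        push_cast
        module
    · obtain rfl : i = 7 := by omega
      rw [D2_X7 7 h h', D1_Xs 6, Derivation.map_smul, D2_Xs 6 _ h]
      push_cast
      simp only [map_zero]
      module
  have h2 := congrArg (fun D => D f) this
  simp only [Derivation.commutator_apply, Derivation.sub_apply, Derivation.smul_apply] at h2
  rw [← h2]
  ring

/-- bihomogeneous polynomials of degree `n` and weight `w` -/
noncomputable def U (n : ℕ) (w : ℤ) : Submodule ℂ (MvPolynomial (Fin 8) ℂ) :=
  LinearMap.ker (Eu.toLinearMap - (n : ℂ) • LinearMap.id) ⊓
    LinearMap.ker (Tw.toLinearMap - (w : ℂ) • LinearMap.id)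

theorem mem_U {n : ℕ} {w : ℤ} {f : MvPolynomial (Fin 8) ℂ} :
    f ∈ U n w ↔ Eu f = (n : ℂ) • f ∧ Tw f = (w : ℂ) • f := by
  rw [U, Submodule.mem_inf, LinearMap.mem_ker, LinearMap.mem_ker, LinearMap.sub_apply,
    LinearMap.sub_apply, sub_eq_zero, sub_eq_zero]
  rfl

theorem D1_mem_U {n : ℕ} {w : ℤ} {f : MvPolynomial (Fin 8) ℂ} (h : f ∈ U n w) :
    D1 f ∈ U n (w - 1) := by
  rw [mem_U] at *
  obtain ⟨h1, h2⟩ := h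
  have k1 := comm_d1 (fun _ => 1) 0 (fun i h => sub_self _) f
  have k2 := comm_d1 (fun i => ((i : ℕ) : ℂ)) (-1) (fun i h => by push_cast; ring) f
  change Eu (D1 f) = D1 (Eu f) + _ at k1
  change Tw (D1 f) = D1 (Tw f) + _ at k2
  rw [k1, k2, h1, h2, Derivation.map_smul, Derivation.map_smul]
  push_cast
  constructor <;> module

theorem D2_mem_U {n : ℕ} {w : ℤ} {f : MvPolynomial (Fin 8) ℂ} (h : f ∈ U n w) :
    D2 f ∈ U n (w + 1) := by
  rw [mem_U] at *
  obtain ⟨h1, h2⟩ := h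
  have k1 := comm_d2 (fun _ => 1) 0 (fun i h => sub_self _) f
  have k2 := comm_d2 (fun i => ((i : ℕ) : ℂ)) 1 (fun i h => by push_cast; ring) f
  change Eu (D2 f) = D2 (Eu f) + _ at k1
  change Tw (D2 f) = D2 (Tw f) + _ at k2
  rw [k1, k2, h1, h2, Derivation.map_smul, Derivation.map_smul]
  push_cast
  constructor <;> module

theorem comm_U {n : ℕ} {w : ℤ} {f : MvPolynomial (Fin 8) ℂ} (h : f ∈ U n w) :
    D1 (D2 f) = D2 (D1 f) + ((7 : ℂ) * n - 2 * w) • f := by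
  rw [mem_U] at h
  rw [comm_12, h.1, h.2]
  module

theorem mem_U_iff {n : ℕ} {w : ℤ} {f : MvPolynomial (Fin 8) ℂ} :
    f ∈ U n w ↔ ∀ m : Fin 8 →₀ ℕ, coeff m f ≠ 0 →
      ∑ i, m i = n ∧ ((∑ i : Fin 8, (i : ℕ) * m i : ℕ) : ℤ) = w := by
  rw [mem_U, MvPolynomial.ext_iff, MvPolynomial.ext_iff, ← forall_and]
  refine forall_congr' fun m => ?_
  rw [Eu, Tw, coeff_diagD, coeff_diagD, coeff_smul, coeff_smul, smul_eq_mul, smul_eq_mul]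
  by_cases h : coeff m f = 0
  · simp [h]
  · rw [mul_left_inj' h, mul_left_inj' h]
    simp only [ne_eq, h, not_false_eq_true, forall_true_left, one_mul]
    refine and_congr ?_ ?_
    · rw [← Nat.cast_sum, Nat.cast_inj]
    · rw [← Int.cast_inj (α := ℂ)]
      push_cast
      rfl

theorem U_neg {n : ℕ} {w : ℤ} (hw : w < 0) {f : MvPolynomial (Fin 8) ℂ} (h : f ∈ U n w) :
    f = 0 := by
  rw [mem_U_iff] at h
  by_contra h0
  obtain ⟨m, hm⟩ := MvPolynomial.ne_zero_iff.1 h0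
  have := (h m hm).2
  omega

def expS (n w : ℕ) : Set (Fin 8 →₀ ℕ) := {m | ∑ i, m i = n ∧ ∑ i : Fin 8, (i : ℕ) * m i = w}

theorem U_eq (n w : ℕ) : U n (w : ℤ) = restrictSupport ℂ (expS n w) := by
  ext f
  rw [mem_U_iff, mem_restrictSupport_iff]
  constructor
  · intro h m hm
    have := h m (mem_support_iff.1 hm)
    exact ⟨this.1, by exact_mod_cast this.2⟩
  · intro h m hm
    have := h (mem_support_iff.2 hm)
    exact ⟨this.1, by exact_mod_cast this.2⟩

noncomputable def expE (n w : ℕ) : expS n w ≃ expA 8 n w :=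
  Finsupp.equivFunOnFinite.subtypeEquiv fun m => by
    rw [mem_expA]
    rfl

theorem U_fin (n w : ℕ) : FiniteDimensional ℂ (U n (w : ℤ)) ∧
    Module.finrank ℂ (U n (w : ℤ)) = (expA 8 n w).card := by
  rw [U_eq]
  have : Finite (expS n w) := Finite.of_equiv _ (expE n w).symm
  refine ⟨Module.Basis.finiteDimensional_of_finite (basisRestrictSupport ℂ (expS n w)), ?_⟩
  rw [Module.finrank_eq_nat_card_basis (basisRestrictSupport ℂ (expS n w)),
    Nat.card_congr (expE n w), Nat.card_eq_fintype_card, Fintype.card_coe]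

theorem inj_aux {n w : ℕ} (hw : 7 * n = 2 * (w + 1)) {g : MvPolynomial (Fin 8) ℂ}
    (hg : g ∈ U n (w : ℤ)) (h0 : D1 (D2 g) = 0) : g = 0 := by
  have hU : ∀ k : ℕ, D1^[k] g ∈ U n ((w : ℤ) - k) := by
    intro k
    induction k with
    | zero => simpa using hg
    | succ k ih =>
      rw [Function.iterate_succ_apply']
      have := D1_mem_U ih
      rwa [sub_sub, ← Nat.cast_succ] at this
  have hc : ∀ k : ℕ, D2 (D1^[k + 1] g) = (-((k : ℂ) + 1) * (k + 2)) • D1^[k] g := by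
    have hn : (7 : ℂ) * n = 2 * (w + 1) := by exact_mod_cast hw
    intro k
    induction k with
    | zero =>
      have h1 := comm_U hg
      rw [h0] at h1
      rw [Function.iterate_succ_apply', Function.iterate_zero, id]
      rw [eq_neg_of_add_eq_zero_left h1.symm, hn]
      push_cast
      module
    | succ k ih =>
      have h1 := comm_U (hU (k + 1))
      rw [ih, Derivation.map_smul, ← Function.iterate_succ_apply' (f := D1)] at h1
      rw [Function.iterate_succ_apply' _ (k + 1), ← sub_eq_iff_eq_add.2 h1, hn]
      push_cast
      module
  have hz : ∀ k : ℕ, D1^[k] g = 0 → g = 0 := by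
    intro k
    induction k with
    | zero => exact id
    | succ k ih =>
      intro h
      apply ih
      have h1 := hc k
      rw [h, map_zero] at h1
      have h2 : (-((k : ℂ) + 1) * (k + 2)) ≠ 0 := by
        have : (((k + 1) * (k + 2) : ℕ) : ℂ) ≠ 0 := Nat.cast_ne_zero.2 (by positivity)
        push_cast at this
        rw [neg_mul]
        exact neg_ne_zero.2 this
      exact (smul_eq_zero.1 h1.symm).resolve_left h2
  exact hz (w + 1) (U_neg (by push_cast; omega) (hU (w + 1)))

theorem V_le_U {n w : ℕ} (hw : 7 * n = 2 * w) : V n ≤ U n (w : ℤ) := by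
  rintro f ⟨⟨h1, h2⟩, h3⟩
  have h2 : D1 f = 0 := h2
  have h3 : D2 f = 0 := h3
  have hE : Eu f = (n : ℂ) • f := by
    ext m
    rw [Eu, coeff_diagD, coeff_smul, smul_eq_mul]
    by_cases h : coeff m f = 0
    · simp [h]
    · have h4 : m.degree = n := by
        have := (mem_homogeneousSubmodule n f).1 h1 h
        rw [Finsupp.degree_eq_weight_one]; exact this
      rw [← h4, Finsupp.degree_eq_sum]
      simp
  rw [mem_U]
  refine ⟨hE, ?_⟩
  have h5 := comm_12 f
  rw [h2, h3, map_zero, map_zero, zero_add, hE] at h5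
  have hn : (7 : ℂ) * n = 2 * w := by exact_mod_cast hw
  have h6 : (2 : ℂ) • Tw f = (2 : ℂ) • ((w : ℂ) • f) := by
    rw [smul_smul, ← hn, mul_smul]
    exact (sub_eq_zero.1 h5.symm).symm
  simpa using h6

theorem finrank_V_le {n w d : ℕ} (hw : 7 * n = 2 * (w + 1))
    (hc : (expA 8 n (w + 1)).card = (expA 8 n w).card + d) :
    FiniteDimensional ℂ (V n) ∧ Module.finrank ℂ (V n) ≤ d := by
  obtain ⟨f1, r1⟩ := U_fin n (w + 1)
  obtain ⟨f0, r0⟩ := U_fin n w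
  have hV := V_le_U hw
  have fV : FiniteDimensional ℂ (V n) := Submodule.finiteDimensional_of_le hV
  refine ⟨fV, ?_⟩
  let d1 : U n ((w + 1 : ℕ) : ℤ) →ₗ[ℂ] U n (w : ℤ) :=
    D1.toLinearMap.restrict fun f hf => by
      have := D1_mem_U hf
      rwa [Nat.cast_succ, add_sub_cancel_right] at this
  let d2 : U n (w : ℤ) →ₗ[ℂ] U n ((w + 1 : ℕ) : ℤ) :=
    D2.toLinearMap.restrict fun f hf => by
      have := D2_mem_U hf
      rwa [Nat.cast_succ]
  have hinj : Function.Injective (d1 ∘ₗ d2) := by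
    rw [← LinearMap.ker_eq_bot, LinearMap.ker_eq_bot']
    intro g hg
    apply Subtype.ext
    exact inj_aux hw g.2 (congrArg Subtype.val hg)
  have hsurj : Function.Surjective d1 := by
    have := LinearMap.injective_iff_surjective.1 hinj
    rw [LinearMap.coe_comp] at this
    exact this.of_comp
  have hrank := LinearMap.finrank_range_add_finrank_ker d1
  rw [LinearMap.range_eq_top.2 hsurj, finrank_top, r0, r1, hc] at hrank
  have hle : Module.finrank ℂ (V n) ≤ Module.finrank ℂ (LinearMap.ker d1) := by
    let j : V n →ₗ[ℂ] LinearMap.ker d1 :=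
      LinearMap.codRestrict _ (Submodule.inclusion hV) fun f => by
        rw [LinearMap.mem_ker]
        apply Subtype.ext
        exact f.2.1.2
    refine LinearMap.finrank_le_finrank_of_injective (f := j) ?_
    intro f g h
    have := congrArg (fun x => x.1.1) h
    exact Subtype.ext this
  omega

theorem W_eq_V {n w d : ℕ} (hw : 7 * n = 2 * (w + 1)) (hn : n < 30) (mons : List (List ℕ))
    (hcnt : cntK n w d = true) (hd : d < 1000) (hl : mons.length = d)
    (hm : ∀ l ∈ mons, okMon n l = true) (hchk : checkK mons d = true) : W n = V n := by
  obtain ⟨fV, hV⟩ := finrank_V_le hw (cntK_spec n w d hn hcnt)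
  have fW : FiniteDimensional ℂ (W n) := Submodule.finiteDimensional_of_le (W_le_V n)
  refine Submodule.eq_of_le_of_finrank_le (W_le_V n) (hV.trans ?_)
  have hli := mon_linInd mons d hd hl hchk
  have hmem : ∀ i : Fin d, mon (X : Fin 8 → MvPolynomial (Fin 8) ℂ) (mons.getD i []) ∈ W n := by
    intro i
    apply mon_mem_W
    apply hm
    rw [List.getD_eq_getElem _ _ (by rw [hl]; exact i.2)]
    exact List.getElem_mem _
  have hli2 : LinearIndependent ℂ fun i : Fin d => (⟨_, hmem i⟩ : W n) :=
    LinearIndependent.of_comp (W n).subtype hli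
  simpa using hli2.fintype_card_le_finrank

theorem concl {n : ℕ} (h : W n = V n) :
    (∀ f : MvPolynomial (Fin 8) ℂ, f.IsHomogeneous n → D1 f = 0 → D2 f = 0 → f ∈ W n) ∧
      delta n = 0 := by
  constructor
  · intro f h1 h2 h3
    rw [h]
    exact ⟨⟨h1, h2⟩, h3⟩
  · unfold delta
    rw [h, Submodule.comap_subtype_self]
    exact Module.finrank_zero_of_subsingleton

set_option maxRecDepth 100000 in
theorem check24 : checkK mons24 62 = true := by decide +kernel

set_option maxRecDepth 100000 in
theorem check28 : checkK mons28 97 = true := by decide +kernel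

end Sept

/-- There are no new irreducible invariants of the binary septimic in degrees 24 and
28: every homogeneous invariant of degree 24 (resp. 28) is a `ℂ`-linear combination of
products of invariants of lower positive degrees, i.e. `δ₂₄ = 0` and `δ₂₈ = 0`. -/
theorem delta_twentyfour_twentyeight :
    (∀ f : MvPolynomial (Fin 8) ℂ, f.IsHomogeneous 24 → D1 f = 0 → D2 f = 0 → f ∈ W 24) ∧
      (∀ f : MvPolynomial (Fin 8) ℂ, f.IsHomogeneous 28 → D1 f = 0 → D2 f = 0 → f ∈ W 28) ∧
      delta 24 = 0 ∧ delta 28 = 0 := by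
  have a := Sept.concl (Sept.W_eq_V (n := 24) (w := 83) (d := 62) (by norm_num) (by norm_num)
    Sept.mons24 Sept.cnt24 (by norm_num) (by decide +kernel) Sept.ok24 Sept.check24)
  have b := Sept.concl (Sept.W_eq_V (n := 28) (w := 97) (d := 97) (by norm_num) (by norm_num)
    Sept.mons28 Sept.cnt28 (by norm_num) (by decide +kernel) Sept.ok28 Sept.check28)
  exact ⟨a.1, b.1, a.2, b.2⟩
end
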